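/- arXiv:2103.09266 — 3 statements merged into one kernel-verified Lean document; each statement's English description precedes it below -/
import Mathlib

section
/- A 2-dimensional real Banach space that is not strictly convex has the Mazur–Ulam property. -/
open Metric Set

/-- A real Banach space is *strictly convex* if every convex subset of its unit sphere
contains at most one point. -/
def StrictlyConvexSphere (X : Type*) [NormedAddCommGroup X] [NormedSpace ℝ X] : Prop :=
  ∀ s : Set X, s ⊆ sphere (0 : X) 1 → Convex ℝ s → s.Subsingleton

open Filter Topology

lemma mu_flat {X : Type*} [NormedAddCommGroup X] [NormedSpace ℝ X] {p q : X}
    (hp : ‖p‖ = 1) (hq : ‖q‖ = 1) (hpq : ‖p + q‖ = 2) {α β : ℝ} (hα : 0 ≤ α) (hβ : 0 ≤ β) :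
    ‖α • p + β • q‖ = α + β := by
  apply le_antisymm
  · calc _ ≤ ‖α • p‖ + ‖β • q‖ := norm_add_le _ _
      _ = _ := by rw [norm_smul, norm_smul, hp, hq, Real.norm_of_nonneg hα, Real.norm_of_nonneg hβ]; ring
  · rcases le_total α β with h | h
    · have h1 : β • (p + q) = (α • p + β • q) + (β - α) • p := by module
      have h2 := norm_add_le (α • p + β • q) ((β - α) • p)
      rw [← h1, norm_smul, norm_smul, hp, hpq, Real.norm_of_nonneg hβ,
        Real.norm_of_nonneg (sub_nonneg.2 h)] at h2
      linarith
    · have h1 : α • (p + q) = (α • p + β • q) + (α - β) • q := by module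
      have h2 := norm_add_le (α • p + β • q) ((α - β) • q)
      rw [← h1, norm_smul, norm_smul, hq, hpq, Real.norm_of_nonneg hα,
        Real.norm_of_nonneg (sub_nonneg.2 h)] at h2
      linarith

lemma mu_lb {X : Type*} [NormedAddCommGroup X] [NormedSpace ℝ X] {p q : X}
    (hp : ‖p‖ = 1) (hq : ‖q‖ = 1) (hpq : ‖p + q‖ = 2) (α β : ℝ) :
    α + β ≤ ‖α • p + β • q‖ := by
  rcases le_or_gt 0 α with hα | hα
  · rcases le_or_gt 0 β with hβ | hβ
    · exact (mu_flat hp hq hpq hα hβ).ge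
    · have h2 := norm_sub_le (α • p + β • q) (β • q)
      rw [add_sub_cancel_right, norm_smul, norm_smul, hp, hq, Real.norm_of_nonneg hα,
        Real.norm_of_nonpos hβ.le] at h2
      linarith
  · rcases le_or_gt 0 β with hβ | hβ
    · have h2 := norm_sub_le (α • p + β • q) (α • p)
      rw [add_sub_cancel_left, norm_smul, norm_smul, hp, hq, Real.norm_of_nonneg hβ,
        Real.norm_of_nonpos hα.le] at h2
      linarith
    · linarith [norm_nonneg (α • p + β • q)]

lemma mu_mono_aux {X : Type*} [NormedAddCommGroup X] [NormedSpace ℝ X] {m w : X} {α β : ℝ}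
    (hα : 0 ≤ α) (hβ : α < β) (h1 : ‖m‖ < ‖m + α • w‖) :
    ‖m + α • w‖ < ‖m + β • w‖ := by
  have hb : 0 < β := lt_of_le_of_lt hα hβ
  have h2 : β • (m + α • w) = (β - α) • m + α • (m + β • w) := by module
  have h3 := norm_add_le ((β - α) • m) (α • (m + β • w))
  rw [← h2, norm_smul, norm_smul, norm_smul, Real.norm_of_nonneg hb.le, Real.norm_of_nonneg hα,
    Real.norm_of_nonneg (sub_nonneg.2 hβ.le)] at h3
  have hα' : 0 < α := by
    rcases hα.eq_or_lt with h | h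
    · subst h; simp at h1
    · exact h
  nlinarith

lemma mu_mono {X : Type*} [NormedAddCommGroup X] [NormedSpace ℝ X] {m w : X} {α β : ℝ}
    (hα : 0 ≤ α) (hβ : 0 ≤ β) (h1 : ‖m‖ < ‖m + α • w‖) (h2 : ‖m + α • w‖ = ‖m + β • w‖) :
    α = β := by
  rcases lt_trichotomy α β with h | h | h
  · have := mu_mono_aux hα h h1; linarith
  · exact h
  · have := mu_mono_aux hβ h (h2 ▸ h1); linarith

/-- Linear coordinates on a two-dimensional space. -/
structure MuCrd (X : Type*) [NormedAddCommGroup X] [NormedSpace ℝ X] where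
  a : X
  e : X
  A : X →L[ℝ] ℝ
  E : X →L[ℝ] ℝ
  Aa : A a = 1
  Ae : A e = 0
  Ea : E a = 0
  Ee : E e = 1
  rep : ∀ x, x = A x • a + E x • e

namespace MuCrd
variable {X : Type*} [NormedAddCommGroup X] [NormedSpace ℝ X] (C : MuCrd X)

lemma ext' {x y : X} (h1 : C.A x = C.A y) (h2 : C.E x = C.E y) : x = y := by
  rw [C.rep x, C.rep y, h1, h2]

/-- determinant -/
def D (x y : X) : ℝ := C.A y * C.E x - C.A x * C.E y

/-- affine parameter -/
def v (t : ℝ) : X := C.e - t • C.a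

/-- sphere parameter -/
noncomputable def g (t : ℝ) : X := ‖C.v t‖⁻¹ • C.v t

lemma Ev (t : ℝ) : C.E (C.v t) = 1 := by simp [v, C.Ee, C.Ea]
lemma Av (t : ℝ) : C.A (C.v t) = -t := by simp [v, C.Ae, C.Aa]
lemma v_ne (t : ℝ) : C.v t ≠ 0 := by
  intro h; have := C.Ev t; rw [h] at this; simp at this
lemma v_pos (t : ℝ) : 0 < ‖C.v t‖ := norm_pos_iff.2 (C.v_ne t)
lemma g_norm (t : ℝ) : ‖C.g t‖ = 1 := by
  have := C.v_pos t
  rw [g, norm_smul, norm_inv, norm_norm, inv_mul_cancel₀ this.ne']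
lemma v_cont : Continuous C.v := by unfold v; fun_prop
lemma g_cont : Continuous C.g := by
  unfold g
  exact (C.v_cont.norm.inv₀ (fun t => (C.v_pos t).ne')).smul C.v_cont
lemma Eg (t : ℝ) : C.E (C.g t) = ‖C.v t‖⁻¹ := by simp [g, C.Ev]
lemma Ag (t : ℝ) : C.A (C.g t) = -t * ‖C.v t‖⁻¹ := by simp [g, C.Av]; ring
lemma Eg_pos (t : ℝ) : 0 < C.E (C.g t) := by rw [C.Eg]; exact inv_pos.2 (C.v_pos t)
/-- slope -/
noncomputable def τ (x : X) : ℝ := - C.A x / C.E x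
lemma Ag' (t : ℝ) : C.A (C.g t) = - t * C.E (C.g t) := by rw [C.Ag, C.Eg]
lemma eq_v {x : X} (h : 0 < C.E x) : x = C.E x • C.v (C.τ x) := by
  apply C.ext'
  · simp [C.Av, τ]; field_simp
  · simp [C.Ev]
lemma eq_g {x : X} (h : 0 < C.E x) : x = ‖x‖ • C.g (C.τ x) := by
  have h1 := C.eq_v h
  have h2 : ‖x‖ = C.E x * ‖C.v (C.τ x)‖ := by
    conv_lhs => rw [h1, norm_smul, Real.norm_of_nonneg h.le]
  rw [h2, g, smul_smul, mul_assoc, mul_inv_cancel₀ (C.v_pos _).ne', mul_one]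
  exact h1
lemma τ_g (t : ℝ) : C.τ (C.g t) = t := by
  have := C.Eg_pos t
  rw [τ, C.Ag']; field_simp
lemma D_τ {x y : X} (hx : 0 < C.E x) (hy : 0 < C.E y) :
    C.D x y = C.E x * C.E y * (C.τ x - C.τ y) := by
  unfold D τ; field_simp; ring
end MuCrd

lemma mu_real {P Q x y u r : ℝ} (hx : 0 < x) (hx1 : x < 1) (hy : 0 < y) (hy1 : y < 1)
    (hu : u < 1) (hr : r < 1) (B1 : 0 ≤ P * 1 + Q * x) (B2 : P * y + Q * 1 ≤ 0)
    (B3 : P * 1 + Q * u ≤ 0) (B4 : 0 ≤ P * r + Q * 1) : P = 0 ∧ Q = 0 := by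
  rcases le_or_gt 0 P with hp | hp
  · rcases le_or_gt 0 Q with hq | hq
    · have := mul_nonneg hp hy.le
      have h2 : P * y = 0 := by linarith
      exact ⟨(mul_eq_zero.1 h2).resolve_right hy.ne', by linarith⟩
    · exfalso
      have h1 : 0 < (-Q) * (1 - u) := mul_pos (by linarith) (by linarith)
      have h2 : 0 ≤ P * (1 - r) := mul_nonneg hp (by linarith)
      nlinarith
  · rcases le_or_gt 0 Q with hq | hq
    · exfalso
      have h1 : 0 < (-P) * (1 - y) := mul_pos (by linarith) (by linarith)
      have h2 : 0 ≤ Q * (1 - x) := mul_nonneg hq (by linarith)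
      nlinarith
    · exfalso
      have h1 : 0 < (-Q) * x := mul_pos (by linarith) hx
      nlinarith

/-- chord lemma -/
lemma mu_chord {X : Type*} [NormedAddCommGroup X] [NormedSpace ℝ X] (C : MuCrd X)
    {z1 z1' z2 z2' w : X} {k1 k2 : ℝ} (hk1 : 0 < k1) (hk2 : 0 < k2)
    (h1 : ‖z1‖ = 1) (h1' : ‖z1'‖ = 1) (h2 : ‖z2‖ = 1) (h2' : ‖z2'‖ = 1)
    (e1 : z1' = z1 + k1 • w) (e2 : z2' = z2 + k2 • w)
    (d1 : 0 < C.D z2 z1') (d2 : 0 < C.D z2' z1)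
    (s1 : ‖z1' + z2‖ < 2) (s2 : ‖z1 + z2'‖ < 2) (f1 : ‖z1' - z2‖ < 1) : w = 0 := by
  -- functionals
  have key : ∀ x : X, ‖x‖ = 1 → ∃ φ : StrongDual ℝ X, φ x = 1 ∧ ∀ y, φ y ≤ ‖y‖ := by
    intro x hx
    obtain ⟨φ, hφ, hφx⟩ := exists_dual_vector'' ℝ x
    refine ⟨φ, by simpa [hx] using hφx, fun y => ?_⟩
    calc φ y ≤ ‖φ y‖ := le_abs_self _
      _ ≤ ‖φ‖ * ‖y‖ := φ.le_opNorm y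
      _ ≤ 1 * ‖y‖ := by gcongr
      _ = ‖y‖ := one_mul _
  obtain ⟨φ1, a1, b1⟩ := key z1 h1
  obtain ⟨φ1', a1', b1'⟩ := key z1' h1'
  obtain ⟨φ2, a2, b2⟩ := key z2 h2
  obtain ⟨φ2', a2', b2'⟩ := key z2' h2'
  have w1 : φ1 w ≤ 0 := by
    have := b1 z1'; rw [h1', e1] at this; simp [a1] at this; nlinarith
  have w2 : φ2 w ≤ 0 := by
    have := b2 z2'; rw [h2', e2] at this; simp [a2] at this; nlinarith
  have w1' : 0 ≤ φ1' w := by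
    have := b1' z1; rw [h1, show z1 = z1' - k1 • w by rw [e1]; module] at this
    simp [a1'] at this; nlinarith
  have w2' : 0 ≤ φ2' w := by
    have := b2' z2; rw [h2, show z2 = z2' - k2 • w by rw [e2]; module] at this
    simp [a2'] at this; nlinarith
  set P := C.D z2 w with hP
  set Q := C.D w z1 with hQ
  have i1 : C.D z2 z1' • w = P • z1' + Q • z2 := by
    apply C.ext' <;> simp [e1, hP, hQ, MuCrd.D] <;> ring
  have i2 : C.D z2' z1 • w = P • z1 + Q • z2' := by
    apply C.ext' <;> simp [e2, hP, hQ, MuCrd.D] <;> ring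
  have j1 : ∀ φ : StrongDual ℝ X, C.D z2 z1' * φ w = P * φ z1' + Q * φ z2 := fun φ => by
    have := congrArg φ i1; simpa using this
  have j2 : ∀ φ : StrongDual ℝ X, C.D z2' z1 * φ w = P * φ z1 + Q * φ z2' := fun φ => by
    have := congrArg φ i2; simpa using this
  have g1 : 0 < φ2 z1' := by
    have := b2 (z2 - z1'); rw [norm_sub_rev] at this; simp [a2] at this; linarith
  have g2 : 0 < φ1' z2 := by
    have := b1' (z1' - z2); simp [a1'] at this; linarith
  have m1 : φ1' z2 < 1 := by
    have := b1' (z1' + z2); simp [a1'] at this; linarith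
  have m2 : φ2 z1' < 1 := by
    have := b2 (z1' + z2); simp [a2] at this; linarith
  have m3 : φ1 z2' < 1 := by
    have := b1 (z1 + z2'); simp [a1] at this; linarith
  have m4 : φ2' z1 < 1 := by
    have := b2' (z1 + z2'); simp [a2'] at this; linarith
  have A1 := j1 φ1'
  have A2 := j1 φ2
  have A3 := j2 φ1
  have A4 := j2 φ2'
  rw [a1'] at A1
  rw [a2] at A2
  rw [a1] at A3
  rw [a2'] at A4
  have B1 : 0 ≤ P * 1 + Q * φ1' z2 := A1 ▸ mul_nonneg d1.le w1'
  have B2 : P * φ2 z1' + Q * 1 ≤ 0 := A2 ▸ mul_nonpos_of_nonneg_of_nonpos d1.le w2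
  have B3 : P * 1 + Q * φ1 z2' ≤ 0 := A3 ▸ mul_nonpos_of_nonneg_of_nonpos d2.le w1
  have B4 : 0 ≤ P * φ2' z1 + Q * 1 := A4 ▸ mul_nonneg d2.le w2'
  have hPQ : P = 0 ∧ Q = 0 := mu_real g2 m1 g1 m2 m3 m4 B1 B2 B3 B4
  rw [hPQ.1, hPQ.2] at i1
  simp at i1
  exact i1.resolve_left d1.ne'


namespace MuCrd
variable {X : Type*} [NormedAddCommGroup X] [NormedSpace ℝ X] (C : MuCrd X)
lemma τ_add {x y : X} (hx : 0 < C.E x) (hy : 0 < C.E y) (h : C.τ x < C.τ y) :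
    C.τ x < C.τ (x + y) ∧ C.τ (x + y) < C.τ y := by
  unfold τ at *
  have hxy : 0 < C.E x + C.E y := by linarith
  rw [map_add, map_add]
  rw [div_lt_div_iff₀ hx hy] at h
  rw [div_lt_div_iff₀ hx hxy, div_lt_div_iff₀ hxy hy]
  constructor <;> nlinarith
lemma τ_smul {x : X} {k : ℝ} (hk : 0 < k) : C.τ (k • x) = C.τ x := by
  unfold τ
  rw [map_smul, map_smul, smul_eq_mul, smul_eq_mul, ← mul_neg, mul_div_mul_left _ _ hk.ne']
lemma ne_of_E {x : X} (h : 0 < C.E x) : x ≠ 0 := by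
  rintro rfl; simp at h
end MuCrd

/-- normalisation -/
noncomputable def muN {X : Type*} [NormedAddCommGroup X] [NormedSpace ℝ X] (x : X) : X := ‖x‖⁻¹ • x

lemma muN_cont {X : Type*} [NormedAddCommGroup X] [NormedSpace ℝ X] {x : X} (h : x ≠ 0) :
    ContinuousAt (muN : X → X) x := by
  unfold muN
  exact (continuous_norm.continuousAt.inv₀ (norm_ne_zero_iff.2 h)).smul continuousAt_id

lemma muN_norm {X : Type*} [NormedAddCommGroup X] [NormedSpace ℝ X] {x : X} (h : x ≠ 0) :
    ‖muN x‖ = 1 := by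
  rw [muN, norm_smul, norm_inv, norm_norm, inv_mul_cancel₀ (norm_ne_zero_iff.2 h)]

lemma muN_eq {X : Type*} [NormedAddCommGroup X] [NormedSpace ℝ X] (C : MuCrd X) {x : X}
    (h : 0 < C.E x) : muN x = C.g (C.τ x) := by
  have h0 := norm_ne_zero_iff.2 (C.ne_of_E h)
  unfold muN
  conv_lhs => rw [C.eq_g h]
  rw [norm_smul, C.g_norm, norm_norm, mul_one, smul_smul, inv_mul_cancel₀ h0, one_smul]

lemma mu_K {X Y : Type*} [NormedAddCommGroup X] [NormedSpace ℝ X] [NormedAddCommGroup Y]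
    [NormedSpace ℝ Y] (C : MuCrd X) (T : X →ₗ[ℝ] Y) (y : ℝ → X)
    (hy1 : ∀ t, ‖T (y t)‖ = 1) {s0 t0 : ℝ}
    (H2 : ∀ s ∈ Icc s0 t0, y s = C.g s) {x : X} (hx : 0 < C.E x) (hτ : C.τ x ∈ Icc s0 t0) :
    ‖T x‖ = ‖x‖ := by
  conv_lhs => rw [C.eq_g hx]
  rw [map_smul, norm_smul, ← H2 _ hτ, hy1, norm_norm, mul_one]

lemma mu_case1 {X Y : Type*} [NormedAddCommGroup X] [NormedSpace ℝ X] [NormedAddCommGroup Y]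
    [NormedSpace ℝ Y] (C : MuCrd X) (T : X →ₗ[ℝ] Y) (y : ℝ → X) (hy : Continuous y)
    (hy1 : ∀ t, ‖T (y t)‖ = 1) {s0 t0 : ℝ} (hst : s0 < t0)
    (H2 : ∀ s ∈ Icc s0 t0, y s = C.g s)
    (H3p : ∀ t, ∀ s ∈ Icc s0 t0, ‖T (y t + C.g s)‖ = ‖C.g t + C.g s‖)
    (hc : ∀ s ∈ Ico s0 t0, ‖C.g s + C.g t0‖ < 2) :
    ∀ᶠ t in 𝓝 t0, y t = C.g t := by
  have hyt : y t0 = C.g t0 := H2 t0 ⟨hst.le, le_rfl⟩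
  have hE : ∀ s t, 0 < C.E (C.g t + C.g s) := fun s t => by
    rw [map_add]; exact add_pos (C.Eg_pos _) (C.Eg_pos _)
  have hτ : ∀ s, s < t0 → s < C.τ (C.g t0 + C.g s) ∧ C.τ (C.g t0 + C.g s) < t0 := fun s hs => by
    have := C.τ_add (C.Eg_pos s) (C.Eg_pos t0) (by rwa [C.τ_g, C.τ_g])
    rw [C.τ_g, C.τ_g, add_comm] at this
    exact this
  have hq : muN (C.g t0 + C.g t0) = C.g t0 := by
    rw [muN_eq C (hE _ _)]
    congr 1
    rw [← two_smul ℝ, C.τ_smul two_pos, C.τ_g]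
  have hcont : ContinuousAt (fun s => muN (C.g t0 + C.g s)) t0 :=
    ContinuousAt.comp (g := muN) (muN_cont (C.ne_of_E (hE _ _)))
      (continuous_const.add C.g_cont).continuousAt
  have ev1 : ∀ᶠ s in 𝓝[<] t0, ‖muN (C.g t0 + C.g s) - C.g t0‖ < 1 / 2 := by
    apply Filter.Eventually.filter_mono nhdsWithin_le_nhds
    have : ContinuousAt (fun s => ‖muN (C.g t0 + C.g s) - C.g t0‖) t0 :=
      (hcont.sub continuousAt_const).norm
    apply this.eventually_lt continuousAt_const
    simp [hq]
  have ev2 : ∀ r < t0, ∀ᶠ s in 𝓝[<] t0, s ∈ Ioo r t0 := fun r hr => Ioo_mem_nhdsLT hr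
  obtain ⟨s1, hs1, hs1'⟩ := (ev1.and (ev2 s0 hst)).exists
  set m1 := muN (C.g t0 + C.g s1) with hm1
  obtain ⟨hr1, hr1'⟩ := hτ s1 hs1'.2
  set r1 := C.τ (C.g t0 + C.g s1)
  have hm1g : m1 = C.g r1 := muN_eq C (hE _ _)
  have hm1q : ‖m1 + C.g t0‖ < 2 := by
    rw [hm1g]; exact hc _ ⟨(hs1'.1.trans hr1).le, hr1'⟩
  have ev3 : ∀ᶠ s in 𝓝[<] t0, ‖m1 + muN (C.g t0 + C.g s)‖ < 2 := by
    apply Filter.Eventually.filter_mono nhdsWithin_le_nhds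
    have : ContinuousAt (fun s => ‖m1 + muN (C.g t0 + C.g s)‖) t0 :=
      (continuousAt_const.add hcont).norm
    apply this.eventually_lt continuousAt_const
    simpa [hq] using hm1q
  obtain ⟨s2, ⟨hs2, hs2'⟩, hs2''⟩ := ((ev1.and ev3).and (ev2 r1 hr1')).exists
  set m2 := muN (C.g t0 + C.g s2) with hm2
  obtain ⟨hr2, hr2'⟩ := hτ s2 hs2''.2
  set r2 := C.τ (C.g t0 + C.g s2)
  have hm2g : m2 = C.g r2 := muN_eq C (hE _ _)
  have hD : 0 < C.D m2 m1 := by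
    rw [hm1g, hm2g, C.D_τ (C.Eg_pos _) (C.Eg_pos _), C.τ_g, C.τ_g]
    exact mul_pos (mul_pos (C.Eg_pos _) (C.Eg_pos _)) (by linarith [hs2''.1])
  have hd : ‖m1 - m2‖ < 1 := by
    have : m1 - m2 = (m1 - C.g t0) - (m2 - C.g t0) := by abel
    rw [this]
    exact (norm_sub_le _ _).trans_lt (by linarith)
  -- continuity
  have cg : ∀ s, ContinuousAt (fun t => muN (C.g t + C.g s)) t0 := fun s =>
    ContinuousAt.comp (g := muN) (muN_cont (C.ne_of_E (hE _ _)))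
      (C.g_cont.add continuous_const).continuousAt
  have cy : ∀ s, ContinuousAt (fun t => muN (y t + C.g s)) t0 := fun s =>
    ContinuousAt.comp (g := muN) (muN_cont (by rw [hyt]; exact C.ne_of_E (hE _ _)))
      (hy.add continuous_const).continuousAt
  have cD : ∀ {u w : ℝ → X}, ContinuousAt u t0 → ContinuousAt w t0 →
      ContinuousAt (fun t => C.D (u t) (w t)) t0 := by
    intro u w hu hw
    unfold MuCrd.D
    have a1 := C.A.continuous.continuousAt.comp hu
    have a2 := C.A.continuous.continuousAt.comp hw
    have a3 := C.E.continuous.continuousAt.comp hu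
    have a4 := C.E.continuous.continuousAt.comp hw
    exact (a2.mul a3).sub (a1.mul a4)
  have evK : ∀ s, s0 < s → s < t0 → ∀ᶠ t in 𝓝 t0, 0 < C.E (y t + C.g s) ∧
      ‖y t + C.g s‖ = ‖C.g t + C.g s‖ := by
    intro s hs0 hs
    have c1 : ContinuousAt (fun t => y t + C.g s) t0 := (hy.add continuous_const).continuousAt
    have cA := C.A.continuous.continuousAt.comp c1
    have cE := C.E.continuous.continuousAt.comp c1
    have e0 : 0 < C.E (y t0 + C.g s) := by rw [hyt]; exact hE _ _
    have cτ : ContinuousAt (fun t => C.τ (y t + C.g s)) t0 := by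
      unfold MuCrd.τ
      exact cA.neg.div cE e0.ne'
    have q1 : ∀ᶠ t in 𝓝 t0, 0 < C.E (y t + C.g s) := continuousAt_const.eventually_lt cE e0
    have q2 : ∀ᶠ t in 𝓝 t0, C.τ (y t + C.g s) ∈ Icc s0 t0 := by
      apply cτ.eventually_mem
      rw [hyt]
      exact Icc_mem_nhds (hs0.trans (hτ s hs).1) (hτ s hs).2
    filter_upwards [q1, q2] with t h1 h2
    refine ⟨h1, ?_⟩
    rw [← H3p t s ⟨hs0.le, hs.le⟩, mu_K C T y hy1 H2 h1 h2]
  have b2 : s0 < s2 := by linarith [hs1'.1, hs2''.1]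
  have E1 := evK s1 hs1'.1 hs1'.2
  have E2 := evK s2 b2 hs2''.2
  have E3 : ∀ᶠ t in 𝓝 t0, 0 < C.D (muN (C.g t + C.g s2)) (muN (y t + C.g s1)) :=
    continuousAt_const.eventually_lt (cD (cg s2) (cy s1)) (by rw [hyt]; exact hD)
  have E4 : ∀ᶠ t in 𝓝 t0, 0 < C.D (muN (y t + C.g s2)) (muN (C.g t + C.g s1)) :=
    continuousAt_const.eventually_lt (cD (cy s2) (cg s1)) (by rw [hyt]; exact hD)
  have E5 : ∀ᶠ t in 𝓝 t0, ‖(muN (y t + C.g s1)) + (muN (C.g t + C.g s2))‖ < 2 :=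
    ((cy s1).add (cg s2)).norm.eventually_lt continuousAt_const (by simpa [hyt] using hs2')
  have E6 : ∀ᶠ t in 𝓝 t0, ‖(muN (C.g t + C.g s1)) + (muN (y t + C.g s2))‖ < 2 :=
    ((cg s1).add (cy s2)).norm.eventually_lt continuousAt_const (by simpa [hyt] using hs2')
  have E7 : ∀ᶠ t in 𝓝 t0, ‖(muN (y t + C.g s1)) - (muN (C.g t + C.g s2))‖ < 1 :=
    ((cy s1).sub (cg s2)).norm.eventually_lt continuousAt_const (by simpa [hyt] using hd)
  filter_upwards [E1, E2, E3, E4, E5, E6, E7] with t h1 h2 h3 h4 h5 h6 h7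
  have n1 : C.g t + C.g s1 ≠ 0 := C.ne_of_E (hE _ _)
  have n2 : C.g t + C.g s2 ≠ 0 := C.ne_of_E (hE _ _)
  have n1' : y t + C.g s1 ≠ 0 := C.ne_of_E h1.1
  have n2' : y t + C.g s2 ≠ 0 := C.ne_of_E h2.1
  have := mu_chord C (w := y t - C.g t) (inv_pos.2 (norm_pos_iff.2 n1)) (inv_pos.2 (norm_pos_iff.2 n2))
    (muN_norm n1) (muN_norm n1') (muN_norm n2) (muN_norm n2')
    (by unfold muN; rw [h1.2]; module) (by unfold muN; rw [h2.2]; module) h3 h4 h5 h6 h7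
  exact sub_eq_zero.1 this


lemma mu_crd2 {X : Type*} [NormedAddCommGroup X] [NormedSpace ℝ X] (C : MuCrd X) {p q : X}
    (hD : 0 < C.D q p) : ∃ φ ρ : X →L[ℝ] ℝ, φ q = 1 ∧ φ (q - p) = 0 ∧ ρ q = 0 ∧ ρ (q - p) = 1 ∧
      (∀ x, x = φ x • q + ρ x • (q - p)) ∧ ∀ x, ρ x = (C.D q p)⁻¹ * C.D x q := by
  have h0 := hD.ne'
  refine ⟨(C.D q p)⁻¹ • (C.E (q - p) • C.A - C.A (q - p) • C.E),
    (C.D q p)⁻¹ • (C.A q • C.E - C.E q • C.A), ?_, ?_, ?_, ?_, ?_, ?_⟩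
  · simp only [MuCrd.D] at h0 ⊢
    simp; field_simp; ring
  · simp; right; ring
  · simp; right; ring
  · simp only [MuCrd.D] at h0 ⊢
    simp; field_simp; ring
  · intro x
    simp only [MuCrd.D] at h0 ⊢
    apply C.ext' <;> simp <;> field_simp <;> ring
  · intro x
    simp [MuCrd.D]; left; ring

lemma mu_R1 {X Y : Type*} [NormedAddCommGroup X] [NormedSpace ℝ X] [NormedAddCommGroup Y]
    [NormedSpace ℝ Y] (T : X →ₗ[ℝ] Y) {q d : X} (Tq : ‖T q‖ = 1) (Td : ‖T d‖ = ‖d‖)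
    {s s' P P' W W' : ℝ} (s0 : 0 < s) (s0' : 0 < s') (l1 : s' ≤ s) (l2 : s ≤ 2 * s')
    (g4 : s' < ‖d‖ / 32) (g1 : -(1/16) < P ∧ P < 1/16) (g2 : -(1/16) < W ∧ W < 1/16)
    (g1' : -(1/16) < P' ∧ P' < 1/16) (g2' : -(1/16) < W' ∧ W' < 1/16) (p1 : 0 < P') (p2 : 0 < P)
    (u1 : ‖T ((-s) • q + (W + 1/2) • d)‖ = ‖(-s) • q + (P + 1/2) • d‖)
    (u2 : ∀ τ ∈ Icc (0:ℝ) 1, ‖T ((-s') • q + (W' + τ) • d)‖ = ‖(-s') • q + (P' + τ) • d‖) :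
    (W - P) * s' = (W' - P') * s := by
  obtain ⟨k, hk⟩ : ∃ k, k = s' / s := ⟨_, rfl⟩
  have ks : k * s = s' := by rw [hk]; field_simp
  have k1 : k ≤ 1 := by rw [hk, div_le_one s0]; exact l1
  have k2 : 1 / 2 ≤ k := by rw [hk, le_div_iff₀ s0]; linarith
  have b1 : k * (P + 1/2) ≤ 1 * (P + 1/2) := mul_le_mul_of_nonneg_right k1 (by linarith)
  have b2 : 1/2 * (P + 1/2) ≤ k * (P + 1/2) := mul_le_mul_of_nonneg_right k2 (by linarith)
  have v2 := u2 (k * (P + 1/2) - P') (by constructor <;> linarith)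
  have e3 : (-s') • q + (P' + (k * (P + 1/2) - P')) • d = k • ((-s) • q + (P + 1/2) • d) := by
    rw [← ks]; module
  have e5 : k • ((-s) • q + (W + 1/2) • d) = (-s') • q + (k * (W + 1/2)) • d := by
    rw [← ks]; module
  rw [e3, norm_smul, ← u1, ← norm_smul, ← map_smul, e5, map_add, map_add, map_smul _ _ d,
    map_smul _ _ d] at v2
  have c1 : 1 / 8 ≤ W' + (k * (P + 1/2) - P') := by linarith
  have c2 : 0 ≤ k * (W + 1/2) := mul_nonneg (by linarith) (by linarith)
  have Tq : ‖T ((-s') • q)‖ = s' := by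
    rw [map_smul, norm_smul, Tq, norm_neg, Real.norm_of_nonneg s0'.le, mul_one]
  have c3 : ‖T ((-s') • q)‖ < ‖T ((-s') • q) + (W' + (k * (P + 1/2) - P')) • T d‖ := by
    have := norm_sub_le (T ((-s') • q) + (W' + (k * (P + 1/2) - P')) • T d) (T ((-s') • q))
    rw [add_sub_cancel_left, norm_smul, Td, Real.norm_of_nonneg (by linarith), Tq] at this
    have h2 := mul_le_mul_of_nonneg_right c1 (norm_nonneg d)
    rw [Tq]
    linarith
  have := mu_mono (by linarith) c2 c3 v2
  rw [← ks]
  linear_combination (-s) * this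

set_option maxHeartbeats 1000000 in
lemma mu_case2 {X Y : Type*} [NormedAddCommGroup X] [NormedSpace ℝ X] [NormedAddCommGroup Y]
    [NormedSpace ℝ Y] (C : MuCrd X) (T : X →ₗ[ℝ] Y) (y : ℝ → X) (hy : Continuous y)
    (hy1 : ∀ t, ‖T (y t)‖ = 1) {s0 t0 : ℝ} (hst : s0 < t0)
    (H2 : ∀ s ∈ Icc s0 t0, y s = C.g s)
    (H3m : ∀ t, ∀ s ∈ Icc s0 t0, ‖T (y t - C.g s)‖ = ‖C.g t - C.g s‖)
    (H3p : ∀ t, ∀ s ∈ Icc s0 t0, ‖T (y t + C.g s)‖ = ‖C.g t + C.g s‖)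
    {s1 : ℝ} (hs1 : s1 ∈ Ico s0 t0) (hflat : ‖C.g s1 + C.g t0‖ = 2) :
    ∃ t1 > t0, ∀ t ∈ Icc t0 t1, y t = C.g t := by
  have hyt : y t0 = C.g t0 := H2 t0 ⟨hst.le, le_rfl⟩
  set p := C.g s1 with hp
  set q := C.g t0 with hq
  have hpn : ‖p‖ = 1 := C.g_norm _
  have hqn : ‖q‖ = 1 := C.g_norm _
  have hD : 0 < C.D q p := by
    rw [C.D_τ (C.Eg_pos _) (C.Eg_pos _), C.τ_g, C.τ_g]
    exact mul_pos (mul_pos (C.Eg_pos _) (C.Eg_pos _)) (by linarith [hs1.2])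
  obtain ⟨φ, ρ, φq, φd, ρq, ρd, rep, hρ⟩ := mu_crd2 C hD
  set d := q - p with hd
  have hdn : 0 < ‖d‖ := norm_pos_iff.2 (by intro h; rw [h] at ρd; simp at ρd)
  have hpd : p = q - d := by rw [hd]; abel
  have seg : ∀ τ ∈ Icc (0:ℝ) 1, ∃ r ∈ Icc s0 t0, C.g r = q - τ • d := by
    intro τ hτ
    have e1 : q - τ • d = τ • p + (1 - τ) • q := by rw [hd]; module
    rcases hτ.1.eq_or_lt with h | h
    · exact ⟨t0, ⟨hst.le, le_rfl⟩, by simp [← h, hq]⟩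
    rcases hτ.2.eq_or_lt with h' | h'
    · exact ⟨s1, ⟨hs1.1, hs1.2.le⟩, by rw [h', ← hp, hpd]; simp⟩
    have h1 : 0 < C.E (τ • p) := by
      rw [map_smul]; exact mul_pos h (C.Eg_pos _)
    have h2 : 0 < C.E ((1 - τ) • q) := by
      rw [map_smul]; exact mul_pos (by linarith) (C.Eg_pos _)
    have k1 : C.τ (τ • p) = s1 := by rw [C.τ_smul h, hp, C.τ_g]
    have k2 : C.τ ((1 - τ) • q) = t0 := by rw [C.τ_smul (by linarith), hq, C.τ_g]
    obtain ⟨l1, l2⟩ := C.τ_add h1 h2 (by rw [k1, k2]; exact hs1.2)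
    rw [k1] at l1
    rw [k2] at l2
    refine ⟨_, ⟨hs1.1.trans l1.le, l2.le⟩, ?_⟩
    have h3 : 0 < C.E (τ • p + (1 - τ) • q) := by rw [map_add]; linarith
    have h4 := C.eq_g h3
    rw [mu_flat hpn hqn hflat h.le (by linarith)] at h4
    rw [show τ + (1 - τ) = 1 by ring, one_smul] at h4
    rw [e1]; exact h4.symm
  have P3 : ∀ t, ∀ τ ∈ Icc (0:ℝ) 1, ‖T (y t - (q - τ • d))‖ = ‖C.g t - (q - τ • d)‖ := by
    intro t τ hτ
    obtain ⟨r, hr, hr'⟩ := seg τ hτ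
    rw [← hr']; exact H3m t r hr
  have P4 : ∀ t, ∀ τ ∈ Icc (0:ℝ) 1, ‖T (y t + (q - τ • d))‖ = ‖C.g t + (q - τ • d)‖ := by
    intro t τ hτ
    obtain ⟨r, hr, hr'⟩ := seg τ hτ
    rw [← hr']; exact H3p t r hr
  have Td : ‖T d‖ = ‖d‖ := by
    have := H3m t0 s1 ⟨hs1.1, hs1.2.le⟩
    rwa [hyt] at this
  have F1 : ∀ x, -φ x ≤ ρ x → ρ x ≤ 0 → ‖x‖ = φ x ∧ ‖T x‖ = φ x := by
    intro x h1 h2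
    have h3 : 0 ≤ φ x := by linarith
    rcases h3.eq_or_lt with h | h
    · have hx : x = 0 := by
        rw [rep x, ← h, show ρ x = 0 by linarith]; simp
      rw [← h, hx]; simp
    · obtain ⟨r, hr, hr'⟩ := seg (-ρ x / φ x)
        ⟨div_nonneg (by linarith) h3, by rw [div_le_one h]; linarith⟩
      have e : x = φ x • C.g r := by
        rw [hr', smul_sub, smul_smul, mul_div_cancel₀ _ h.ne']
        conv_lhs => rw [rep x]
        module
      constructor
      · conv_lhs => rw [e, norm_smul, C.g_norm, Real.norm_of_nonneg h3, mul_one]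
      · conv_lhs => rw [e, map_smul, norm_smul, ← H2 r hr, hy1, Real.norm_of_nonneg h3, mul_one]
  have F0 : ∀ x, φ x ≤ ‖x‖ := by
    intro x
    have := mu_lb hpn hqn hflat (-ρ x) (φ x + ρ x)
    have e : (-ρ x) • p + (φ x + ρ x) • q = x := by
      conv_rhs => rw [rep x, hd]
      module
    rw [e] at this; linarith
  have ρpos : ∀ t, t0 < t → 0 < ρ (C.g t) := by
    intro t ht
    rw [hρ, C.D_τ (C.Eg_pos t) (C.Eg_pos t0), C.τ_g, C.τ_g]
    exact mul_pos (inv_pos.2 hD) (mul_pos (mul_pos (C.Eg_pos _) (C.Eg_pos _)) (by linarith))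
  -- good neighbourhood
  obtain ⟨t1, ht1, good⟩ : ∃ t1 > t0, ∀ t ∈ Icc t0 t1, |ρ (C.g t)| < 1 / 16 ∧
      |ρ (y t)| < 1 / 16 ∧ 1 - φ (C.g t) < 1 / 2 ∧ 1 - φ (C.g t) < ‖d‖ / 32 ∧
      1 / 2 < φ (y t) := by
    have c1 : ContinuousAt (fun t => |ρ (C.g t)|) t0 := (ρ.continuous.comp C.g_cont).abs.continuousAt
    have c2 : ContinuousAt (fun t => |ρ (y t)|) t0 := (ρ.continuous.comp hy).abs.continuousAt
    have c3 : ContinuousAt (fun t => 1 - φ (C.g t)) t0 :=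
      (continuous_const.sub (φ.continuous.comp C.g_cont)).continuousAt
    have c4 : ContinuousAt (fun t => φ (y t)) t0 := (φ.continuous.comp hy).continuousAt
    have E1 := c1.eventually_lt (continuousAt_const (y := (1/16:ℝ))) (by rw [← hq, ρq]; norm_num)
    have E2 := c2.eventually_lt (continuousAt_const (y := (1/16:ℝ))) (by rw [hyt, ρq]; norm_num)
    have E3 := c3.eventually_lt (continuousAt_const (y := (1/2:ℝ))) (by rw [← hq, φq]; norm_num)
    have E4 := c3.eventually_lt (continuousAt_const (y := ‖d‖/32)) (by rw [← hq, φq]; linarith)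
    have E5 := (continuousAt_const (y := (1/2:ℝ))).eventually_lt c4 (by rw [hyt, φq]; norm_num)
    have E := E1.and (E2.and (E3.and (E4.and E5)))
    obtain ⟨l, u, hlu, hs⟩ := mem_nhds_iff_exists_Ioo_subset.1 E
    refine ⟨(t0 + u) / 2, by linarith [hlu.2], fun t ht => hs ⟨?_, ?_⟩⟩
    · linarith [hlu.1, ht.1]
    · linarith [hlu.2, ht.2]
  have F4 : ∀ t ∈ Icc t0 t1, φ (y t) = φ (C.g t) := by
    intro t ht
    obtain ⟨g1, g2, g3, g4, g5⟩ := good t ht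
    rw [abs_lt] at g1 g2
    have h := P4 t 1 (by simp)
    rw [one_smul] at h
    rw [(F1 (y t + (q - d)) (by simp [φq, φd, ρq, ρd]; linarith)
      (by simp [ρq, ρd]; linarith)).2,
      (F1 (C.g t + (q - d)) (by simp [φq, φd, ρq, ρd]; linarith)
      (by simp [ρq, ρd]; linarith)).1] at h
    simpa [φq, φd] using h
  by_cases hfl : ∃ t2 > t0, φ (C.g t2) = 1
  · obtain ⟨t2, ht2, h2⟩ := hfl
    have hn : ‖q + C.g t2‖ = 2 := by
      apply le_antisymm
      · have := norm_add_le q (C.g t2); rw [hqn, C.g_norm] at this; linarith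
      · have := F0 (q + C.g t2); rw [map_add, φq, h2] at this; linarith
    refine ⟨min t1 t2, lt_min ht1 ht2, fun t ht => ?_⟩
    have htt : t ∈ Icc t0 t1 := ⟨ht.1, ht.2.trans (min_le_left _ _)⟩
    have ht2' : t ≤ t2 := ht.2.trans (min_le_right _ _)
    obtain ⟨g1, g2, g3, g4, g5⟩ := good t htt
    rw [abs_lt] at g1 g2
    have φ1 : φ (C.g t) = 1 := by
      have i : (t2 - t0) • C.v t = (t2 - t) • C.v t0 + (t - t0) • C.v t2 := by
        unfold MuCrd.v; module
      have vg : ∀ r, C.v r = ‖C.v r‖ • C.g r := fun r => by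
        rw [MuCrd.g, smul_smul, mul_inv_cancel₀ (C.v_pos r).ne', one_smul]
      have k1 : 0 ≤ (t2 - t) * ‖C.v t0‖ := mul_nonneg (by linarith) (norm_nonneg _)
      have k2 : 0 ≤ (t - t0) * ‖C.v t2‖ := mul_nonneg (by linarith [ht.1]) (norm_nonneg _)
      rw [vg t, vg t0, vg t2, smul_smul, smul_smul, smul_smul] at i
      have i1 := congrArg norm i
      have i2 := congrArg φ i
      rw [← hq, mu_flat hqn (C.g_norm _) hn k1 k2, norm_smul, C.g_norm, Real.norm_of_nonneg
        (mul_nonneg (by linarith) (norm_nonneg _)), mul_one] at i1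
      rw [← hq, map_smul, map_add, map_smul, map_smul, φq, h2, i1] at i2
      simp only [smul_eq_mul, mul_one] at i2
      have k3 : 0 < (t2 - t) * ‖C.v t0‖ + (t - t0) * ‖C.v t2‖ := by
        rw [← i1]; exact mul_pos (by linarith) (C.v_pos t)
      have := mul_left_cancel₀ k3.ne' (i2.trans (mul_one _).symm)
      exact this
    have φ2 := (F4 t htt).trans φ1
    have h := P3 t 1 (by simp)
    have e1 : C.g t - (q - (1:ℝ) • d) = (1 + ρ (C.g t)) • d := by
      conv_lhs => rw [rep (C.g t), φ1]
      module
    have e2 : y t - (q - (1:ℝ) • d) = (1 + ρ (y t)) • d := by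
      conv_lhs => rw [rep (y t), φ2]
      module
    rw [e1, e2, map_smul, norm_smul, norm_smul, Td, Real.norm_of_nonneg (by linarith),
      Real.norm_of_nonneg (by linarith)] at h
    have h' := mul_right_cancel₀ hdn.ne' h
    rw [rep (y t), rep (C.g t), φ1, φ2, show ρ (y t) = ρ (C.g t) by linarith]
  have hlt : ∀ t, t0 < t → φ (C.g t) < 1 := by
    intro t ht
    refine lt_of_le_of_ne ((F0 _).trans (C.g_norm t).le) fun h => hfl ⟨t, ht, h⟩
  have yrep : ∀ t ∈ Icc t0 t1, y t = φ (C.g t) • q + ρ (y t) • d := by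
    intro t ht
    conv_lhs => rw [rep (y t), F4 t ht]
  have R1 : ∀ t ∈ Ioo t0 t1, ∀ t' ∈ Ioo t0 t1, 1 - φ (C.g t') ≤ 1 - φ (C.g t) →
      1 - φ (C.g t) ≤ 2 * (1 - φ (C.g t')) →
      (ρ (y t) - ρ (C.g t)) * (1 - φ (C.g t')) = (ρ (y t') - ρ (C.g t')) * (1 - φ (C.g t)) := by
    intro t ht t' ht' l1 l2
    obtain ⟨g1, g2, g3, g4, g5⟩ := good t ⟨ht.1.le, ht.2.le⟩
    obtain ⟨g1', g2', g3', g4', g5'⟩ := good t' ⟨ht'.1.le, ht'.2.le⟩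
    rw [abs_lt] at g1 g2 g1' g2'
    have z1 := yrep t ⟨ht.1.le, ht.2.le⟩
    have z2 := yrep t' ⟨ht'.1.le, ht'.2.le⟩
    have z3 := rep (C.g t)
    have z4 := rep (C.g t')
    have u1 := P3 t (1/2) (by constructor <;> norm_num)
    have u2 := P3 t'
    have sp := hlt t ht.1
    have sp' := hlt t' ht'.1
    have Tq : ‖T q‖ = 1 := by
      rw [(F1 q (by rw [φq, ρq]; norm_num) ρq.le).2, φq]
    refine mu_R1 T Tq Td (by linarith) (by linarith) l1 l2 g4' g1 g2 g1' g2' (ρpos t' ht'.1)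
      (ρpos t ht.1) ?_ ?_
    · convert u1 using 2
      · congr 1
        conv_rhs => rw [z1]
        module
      · conv_rhs => rw [z3]
        module
    · intro τ hτ
      convert u2 τ hτ using 2
      · congr 1
        conv_rhs => rw [z2]
        module
      · conv_rhs => rw [z4]
        module
  have R : ∀ t ∈ Ioo t0 t1, ∀ t' ∈ Ioo t0 t1,
      (ρ (y t) - ρ (C.g t)) * (1 - φ (C.g t')) = (ρ (y t') - ρ (C.g t')) * (1 - φ (C.g t)) := by
    intro t ht t' ht'
    refine isPreconnected_Ioo.induction₂ (fun t t' => (ρ (y t) - ρ (C.g t)) * (1 - φ (C.g t')) =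
      (ρ (y t') - ρ (C.g t')) * (1 - φ (C.g t))) ?_ ?_ ?_ ht ht'
    · intro t ht
      have sp := hlt t ht.1
      have c3 : ContinuousAt (fun t => 1 - φ (C.g t)) t :=
        (continuous_const.sub (φ.continuous.comp C.g_cont)).continuousAt
      have E1 := c3.eventually_lt (continuousAt_const (y := 2 * (1 - φ (C.g t)))) (by linarith)
      have E2 := (continuousAt_const (y := (1 - φ (C.g t)) / 2)).eventually_lt c3 (by linarith)
      filter_upwards [nhdsWithin_le_nhds E1, nhdsWithin_le_nhds E2, self_mem_nhdsWithin]
        with t' h1 h2 ht'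
      rcases le_total (1 - φ (C.g t')) (1 - φ (C.g t)) with h | h
      · exact R1 t ht t' ht' h (by linarith)
      · exact (R1 t' ht' t ht h (by linarith)).symm
    · intro a b c ha hb hc h1 h2
      have sp := hlt b hb.1
      apply mul_right_cancel₀ (sub_pos.2 sp).ne'
      linear_combination (1 - φ (C.g c)) * h1 + (1 - φ (C.g a)) * h2
    · intro a b _ _ h
      exact h.symm
  have main : ∀ t ∈ Ioo t0 t1, y t = C.g t := by
    intro t ht
    have htI : t ∈ Icc t0 t1 := ⟨ht.1.le, ht.2.le⟩
    obtain ⟨g1, g2, g3, g4, g5⟩ := good t htI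
    rw [abs_lt] at g1 g2
    have sp := hlt t ht.1
    have Pp := ρpos t ht.1
    obtain ⟨η, η0, ηP, ηs⟩ : ∃ η : ℝ, 0 < η ∧ η < ρ (C.g t) ∧ η * ‖d‖ < 1 - φ (C.g t) := by
      refine ⟨min (ρ (C.g t)) ((1 - φ (C.g t)) / ‖d‖) / 2, ?_, ?_, ?_⟩
      · exact half_pos (lt_min Pp (div_pos (by linarith) hdn))
      · linarith [min_le_left (ρ (C.g t)) ((1 - φ (C.g t)) / ‖d‖)]
      · have := min_le_right (ρ (C.g t)) ((1 - φ (C.g t)) / ‖d‖)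
        calc _ ≤ (1 - φ (C.g t)) / ‖d‖ / 2 * ‖d‖ := by gcongr
          _ = (1 - φ (C.g t)) / 2 := by field_simp
          _ < _ := by linarith
    have hu := P4 t (ρ (C.g t) - η) ⟨by linarith, by linarith⟩
    obtain ⟨r, hr, hr'⟩ := seg (ρ (C.g t) - η) ⟨by linarith, by linarith⟩
    obtain ⟨z, hz⟩ : ∃ z, z = C.g t + (q - (ρ (C.g t) - η) • d) := ⟨_, rfl⟩
    have Ez : 0 < C.E z := by
      rw [hz, ← hr', map_add]; exact add_pos (C.Eg_pos _) (C.Eg_pos _)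
    have φz : φ z = φ (C.g t) + 1 := by rw [hz]; simp [φq, φd]
    have ρz : ρ z = η := by rw [hz]; simp [ρq, ρd]
    have zrep : z = (φ (C.g t) + 1) • q + η • d := by rw [← φz, ← ρz]; exact rep z
    obtain ⟨t', ht'⟩ : ∃ t', t' = C.τ z := ⟨_, rfl⟩
    have zg : z = ‖z‖ • C.g t' := by rw [ht']; exact C.eq_g Ez
    have hrt : r < t := lt_of_le_of_lt hr.2 ht.1
    have t'lt : t' < t := by
      have := (C.τ_add (C.Eg_pos r) (C.Eg_pos t) (by rwa [C.τ_g, C.τ_g])).2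
      rw [C.τ_g] at this
      rw [ht', hz, ← hr', add_comm]; exact this
    have t'gt : t0 < t' := by
      have h := hρ z
      rw [ρz, C.D_τ Ez (C.Eg_pos t0), C.τ_g, ← ht'] at h
      by_contra hcon
      have h1 : C.E z * C.E (C.g t0) * (t' - t0) ≤ 0 :=
        mul_nonpos_of_nonneg_of_nonpos (mul_pos Ez (C.Eg_pos _)).le (by linarith)
      have := mul_nonpos_of_nonneg_of_nonpos (inv_pos.2 hD).le h1
      linarith
    have htI' : t' ∈ Ioo t0 t1 := ⟨t'gt, t'lt.trans ht.2⟩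
    obtain ⟨k1, k2, k3, k4, k5⟩ := good t' ⟨htI'.1.le, htI'.2.le⟩
    rw [abs_lt] at k1 k2
    have sp' := hlt t' t'gt
    obtain ⟨N, hN⟩ : ∃ N, N = ‖z‖ := ⟨_, rfl⟩
    rw [← hN] at zg
    have N0 : 0 < N := by rw [hN]; exact norm_pos_iff.2 (C.ne_of_E Ez)
    have N2 : N < 2 := by
      have := norm_add_le ((φ (C.g t) + 1) • q) (η • d)
      rw [← zrep, norm_smul, norm_smul, hqn, Real.norm_of_nonneg η0.le,
        Real.norm_of_nonneg (by linarith), ← hN] at this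
      linarith
    have φz' : N * φ (C.g t') = φ (C.g t) + 1 := by
      rw [← φz]; conv_rhs => rw [zg]
      simp
    have ρz' : N * ρ (C.g t') = η := by
      rw [← ρz]; conv_rhs => rw [zg]
      simp
    have lN : φ (C.g t) + 1 < N := by rw [← φz']; nlinarith
    -- two points
    have a1 : ‖T ((φ (C.g t) + 1) • q) + (η + (ρ (y t) - ρ (C.g t))) • T d‖ = N := by
      rw [hN, hz, ← hu, ← map_smul, ← map_add]
      congr 2
      conv_rhs => rw [yrep t htI]
      module
    have a2 : ‖T ((φ (C.g t) + 1) • q) + (N * ρ (y t')) • T d‖ = N := by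
      have : N = ‖T (N • y t')‖ := by
        rw [map_smul, norm_smul, hy1, Real.norm_of_nonneg N0.le, mul_one]
      conv_rhs => rw [this, yrep t' ⟨htI'.1.le, htI'.2.le⟩]
      rw [← map_smul, ← map_add]
      congr 2
      rw [smul_add, smul_smul, smul_smul, φz']
    have pos : ∀ c : ℝ, -1 < c → ‖T ((φ (C.g t) + 1) • q) + c • T d‖ = N → 0 ≤ c := by
      intro c hc hcN
      by_contra hneg
      rw [← map_smul, ← map_add, (F1 _ (by simp [φq, φd, ρq, ρd]; linarith)
        (by simp [ρq, ρd]; linarith)).2] at hcN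
      simp [φq, φd] at hcN
      linarith
    have Tm : ‖T ((φ (C.g t) + 1) • q)‖ = φ (C.g t) + 1 := by
      rw [(F1 _ (by simp [φq, ρq]; linarith) (by simp [ρq])).2]
      simp [φq]
    have c1 := pos _ (by linarith) a1
    have c2 := pos _ (by nlinarith) a2
    have := mu_mono c1 c2 (by rw [Tm, a1]; exact lN) (a1.trans a2.symm)
    have r1 := R t ht t' htI'
    have e1 : ρ (y t) - ρ (C.g t) = N * (ρ (y t') - ρ (C.g t')) := by
      rw [mul_sub, ρz']; linarith
    rw [e1] at r1
    have e2 : (ρ (y t') - ρ (C.g t')) * (N - 2) = 0 := by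
      linear_combination r1 + (ρ (y t') - ρ (C.g t')) * φz'
    have e3 := (mul_eq_zero.1 e2).resolve_right (by linarith)
    rw [e3, mul_zero] at e1
    rw [yrep t htI]
    conv_rhs => rw [rep (C.g t)]
    rw [sub_eq_zero.1 e1]
  refine ⟨(t0 + t1) / 2, by linarith, fun t ht => ?_⟩
  rcases ht.1.eq_or_lt with h | h
  · rw [← h]; exact hyt
  · exact main t ⟨h, by linarith [ht.2]⟩


lemma mu_step {X Y : Type*} [NormedAddCommGroup X] [NormedSpace ℝ X] [NormedAddCommGroup Y]
    [NormedSpace ℝ Y] (C : MuCrd X) (T : X →ₗ[ℝ] Y) (y : ℝ → X) (hy : Continuous y)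
    (hy1 : ∀ t, ‖T (y t)‖ = 1) {s0 t0 : ℝ} (hst : s0 < t0)
    (H2 : ∀ s ∈ Icc s0 t0, y s = C.g s)
    (H3m : ∀ t, ∀ s ∈ Icc s0 t0, ‖T (y t - C.g s)‖ = ‖C.g t - C.g s‖)
    (H3p : ∀ t, ∀ s ∈ Icc s0 t0, ‖T (y t + C.g s)‖ = ‖C.g t + C.g s‖) :
    ∃ t1 > t0, ∀ t ∈ Icc t0 t1, y t = C.g t := by
  by_cases h : ∃ s1 ∈ Ico s0 t0, ‖C.g s1 + C.g t0‖ = 2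
  · obtain ⟨s1, hs1, hf⟩ := h
    exact mu_case2 C T y hy hy1 hst H2 H3m H3p hs1 hf
  · push Not at h
    have := mu_case1 C T y hy hy1 hst H2 H3p (fun s hs => lt_of_le_of_ne (by
      have := norm_add_le (C.g s) (C.g t0)
      rw [C.g_norm, C.g_norm] at this; linarith) (h s hs))
    obtain ⟨ε, he, hb⟩ := Metric.eventually_nhds_iff.1 this
    refine ⟨t0 + ε / 2, by linarith, fun t ht => hb ?_⟩
    rw [Real.dist_eq, abs_lt]; constructor <;> linarith [ht.1, ht.2]

lemma mu_glob {X Y : Type*} [NormedAddCommGroup X] [NormedSpace ℝ X] [NormedAddCommGroup Y]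
    [NormedSpace ℝ Y] [FiniteDimensional ℝ X] (C : MuCrd X) (T : X ≃ₗ[ℝ] Y) (F : X → Y)
    (hn : ∀ x, ‖x‖ = 1 → ‖F x‖ = 1)
    (hd : ∀ x y, ‖x‖ = 1 → ‖y‖ = 1 → ‖F x - F y‖ = ‖x - y‖)
    (h0 : ∀ t ≤ (-1 : ℝ), F (C.g t) = T (C.g t) ∧ F (-C.g t) = - T (C.g t)) (t : ℝ) :
    F (C.g t) = T (C.g t) ∧ F (-C.g t) = - T (C.g t) := by
  have : FiniteDimensional ℝ Y := T.finiteDimensional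
  have hTs : Continuous (T.symm : Y → X) :=
    (T.symm : Y →ₗ[ℝ] X).continuous_of_finiteDimensional
  have hTc : Continuous (T : X → Y) :=
    (T : X →ₗ[ℝ] Y).continuous_of_finiteDimensional
  have hgm : ∀ t, ‖-C.g t‖ = 1 := fun t => by rw [norm_neg, C.g_norm]
  have c1 : Continuous (fun t => F (C.g t)) := by
    rw [Metric.continuous_iff]
    intro b ε hε
    obtain ⟨δ, hδ, h⟩ := Metric.continuous_iff.1 C.g_cont b ε hε
    refine ⟨δ, hδ, fun a ha => ?_⟩
    rw [dist_eq_norm, hd _ _ (C.g_norm _) (C.g_norm _), ← dist_eq_norm]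
    exact h a ha
  have c2 : Continuous (fun t => F (-C.g t)) := by
    rw [Metric.continuous_iff]
    intro b ε hε
    obtain ⟨δ, hδ, h⟩ := Metric.continuous_iff.1 C.g_cont.neg b ε hε
    refine ⟨δ, hδ, fun a ha => ?_⟩
    rw [dist_eq_norm, hd _ _ (hgm _) (hgm _), ← dist_eq_norm]
    exact h a ha
  by_contra hbad
  set P : ℝ → Prop := fun t => F (C.g t) = T (C.g t) ∧ F (-C.g t) = - T (C.g t) with hP
  set B : Set ℝ := {t | ¬ P t} with hB
  have hBo : IsOpen B := by
    have : IsClosed {t | P t} :=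
      (isClosed_eq c1 (hTc.comp C.g_cont)).inter (isClosed_eq c2 (hTc.comp C.g_cont).neg)
    exact this.isOpen_compl
  have hBn : B.Nonempty := ⟨t, hbad⟩
  have hlb : ∀ b ∈ B, -1 ≤ b := fun b hb => by
    by_contra h
    exact hb (h0 b (by linarith))
  have hBb : BddBelow B := ⟨-1, hlb⟩
  set t0 := sInf B with ht0
  have ht0' : -1 ≤ t0 := le_csInf hBn hlb
  have hlt : ∀ s < t0, P s := fun s hs => by
    by_contra h
    exact absurd (csInf_le hBb h) (not_le.2 hs)
  have hPt0 : P t0 := by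
    by_contra h
    obtain ⟨ε, he, hb⟩ := Metric.isOpen_iff.1 hBo t0 h
    have : t0 - ε / 2 ∈ B := hb (by
      rw [Metric.mem_ball, Real.dist_eq, abs_lt]; constructor <;> linarith)
    exact this (hlt _ (by linarith))
  have hle : ∀ s ≤ t0, P s := fun s hs => by
    rcases hs.eq_or_lt with h | h
    · rw [h]; exact hPt0
    · exact hlt s h
  have st : (-2 : ℝ) < t0 := by linarith
  obtain ⟨t1, ht1, k1⟩ := mu_step C (T : X →ₗ[ℝ] Y) (fun t => T.symm (F (C.g t)))
    (hTs.comp c1) (fun t => by simp [hn _ (C.g_norm t)]) st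
    (fun s hs => by simp [(hle s hs.2).1])
    (fun t s hs => by
      have := hd _ _ (C.g_norm t) (C.g_norm s)
      rw [(hle s hs.2).1] at this
      simpa using this)
    (fun t s hs => by
      have := hd _ _ (C.g_norm t) (hgm s)
      rw [(hle s hs.2).2] at this
      simpa using this)
  obtain ⟨t2, ht2, k2⟩ := mu_step C (T : X →ₗ[ℝ] Y) (fun t => T.symm (-F (-C.g t)))
    (hTs.comp c2.neg) (fun t => by simp [hn _ (hgm t)]) st
    (fun s hs => by simp [(hle s hs.2).2])
    (fun t s hs => by
      have := hd _ _ (hgm t) (hgm s)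
      rw [(hle s hs.2).2, ← norm_neg, ← norm_neg (_ - -C.g s)] at this
      rw [show C.g t - C.g s = -(-C.g t - -C.g s) by abel, ← this]
      congr 1
      simp only [LinearEquiv.coe_coe, map_sub, map_neg, LinearEquiv.apply_symm_apply]
      abel)
    (fun t s hs => by
      have := hd _ _ (hgm t) (C.g_norm s)
      rw [(hle s hs.2).1, ← norm_neg, ← norm_neg (_ - C.g s)] at this
      rw [show C.g t + C.g s = -(-C.g t - C.g s) by abel, ← this]
      congr 1
      simp only [LinearEquiv.coe_coe, map_add, map_neg, LinearEquiv.apply_symm_apply]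
      abel)
  have : min t1 t2 ≤ t0 := le_csInf hBn (fun b hb => by
    by_contra h
    push Not at h
    rw [lt_min_iff] at h
    rcases le_or_gt b t0 with h' | h'
    · exact hb (hle b h')
    · apply hb
      have q1 := k1 b ⟨h'.le, h.1.le⟩
      have q2 := k2 b ⟨h'.le, h.2.le⟩
      rw [LinearEquiv.symm_apply_eq] at q1 q2
      exact ⟨q1, by rw [← q2, neg_neg]⟩)
  rw [min_le_iff] at this
  rcases this with h | h <;> linarith

/-- conclusion from agreement on the curve -/
lemma mu_fin {X Y : Type*} [NormedAddCommGroup X] [NormedSpace ℝ X] [NormedAddCommGroup Y]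
    [NormedSpace ℝ Y] [FiniteDimensional ℝ X] (C : MuCrd X) (T : X ≃ₗ[ℝ] Y) (F : X → Y)
    (ha : ‖C.a‖ = 1)
    (hn : ∀ x, ‖x‖ = 1 → ‖F x‖ = 1)
    (hd : ∀ x y, ‖x‖ = 1 → ‖y‖ = 1 → ‖F x - F y‖ = ‖x - y‖)
    (h0 : ∀ t ≤ (-1 : ℝ), F (C.g t) = T (C.g t) ∧ F (-C.g t) = - T (C.g t))
    (h1 : F C.a = T C.a) (h2 : F (-C.a) = - T C.a) :
    ∃ G : X ≃ₗᵢ[ℝ] Y, ∀ x, ‖x‖ = 1 → G x = F x := by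
  have key := mu_glob C T F hn hd h0
  have all : ∀ x, ‖x‖ = 1 → T x = F x := by
    intro x hx
    rcases lt_trichotomy (C.E x) 0 with h | h | h
    · have := C.eq_g (x := -x) (by simpa using h)
      rw [norm_neg, hx, one_smul] at this
      have h3 := (key (C.τ (-x))).2
      rw [← this] at h3
      simpa using h3.symm
    · have h3 := C.rep x
      rw [h, zero_smul, add_zero] at h3
      have h4 : |C.A x| = 1 := by
        have := congrArg norm h3
        rw [hx, norm_smul, ha] at this
        simpa using this.symm
      rcases (abs_eq one_pos.le).1 h4 with h5 | h5
      · rw [h5, one_smul] at h3; rw [h3, h1]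
      · rw [h5, neg_one_smul] at h3; rw [h3, h2, map_neg]
    · have := C.eq_g h
      rw [hx, one_smul] at this
      have h3 := (key (C.τ x)).1
      rw [← this] at h3
      exact h3.symm
  refine ⟨⟨T, fun x => ?_⟩, fun x hx => all x hx⟩
  by_cases hx : x = 0
  · simp [hx]
  · have hx' : 0 < ‖x‖ := norm_pos_iff.2 hx
    have hu : ‖‖x‖⁻¹ • x‖ = 1 := by
      rw [norm_smul, norm_inv, norm_norm, inv_mul_cancel₀ hx'.ne']
    have h5 := hn _ hu
    rw [← all _ hu, map_smul, norm_smul, norm_inv, norm_norm] at h5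
    change ‖T x‖ = ‖x‖
    field_simp at h5
    linarith


lemma mu_pair {Y : Type*} [NormedAddCommGroup Y] [NormedSpace ℝ Y] {p q : Y}
    (hp : ‖p‖ = 1) (hq : ‖q‖ = 1) (hpq : ‖p + q‖ = 2) (hne : p ≠ q) {α β : ℝ}
    (h : α • p + β • q = 0) : α = 0 ∧ β = 0 := by
  have h1 : |α| = |β| := by
    have : α • p = -(β • q) := eq_neg_of_add_eq_zero_left h
    have := congrArg norm this
    rwa [norm_neg, norm_smul, norm_smul, hp, hq, mul_one, mul_one] at this
  rcases abs_eq_abs.1 h1 with h2 | h2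
  · subst h2
    rw [← smul_add] at h
    have := congrArg norm h
    rw [norm_smul, hpq, norm_zero] at this
    have : α = 0 := by
      rw [← norm_eq_zero]; linarith
    exact ⟨this, this⟩
  · subst h2
    have h3 : β • (q - p) = 0 := by rw [← h]; module
    rcases smul_eq_zero.1 h3 with h4 | h4
    · simp [h4]
    · exact absurd (sub_eq_zero.1 h4).symm hne

lemma mu_mkcrd {X : Type*} [NormedAddCommGroup X] [NormedSpace ℝ X]
    (hdim : Module.finrank ℝ X = 2) (a e : X)
    (hli : ∀ α β : ℝ, α • a + β • e = 0 → α = 0 ∧ β = 0) :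
    ∃ C : MuCrd X, C.a = a ∧ C.e = e := by
  have hfd : FiniteDimensional ℝ X := Module.finite_of_finrank_pos (by omega)
  have hl : LinearIndependent ℝ ![a, e] := LinearIndependent.pair_iff.2 hli
  let b := basisOfLinearIndependentOfCardEqFinrank hl (by simp [hdim])
  have b0 : b 0 = a := by simp [b]
  have b1 : b 1 = e := by simp [b]
  refine ⟨⟨a, e, LinearMap.toContinuousLinearMap (b.coord 0),
    LinearMap.toContinuousLinearMap (b.coord 1), ?_, ?_, ?_, ?_, ?_⟩, rfl, rfl⟩
  · rw [← b0]; simp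
  · rw [← b1]; simp
  · rw [← b0]; simp
  · rw [← b1]; simp
  · intro x
    have := b.sum_repr x
    rw [Fin.sum_univ_two, b0, b1] at this
    simpa using this.symm

/-- linear equivalence matching coordinates -/
def MuCrd.equiv {X Y : Type*} [NormedAddCommGroup X] [NormedSpace ℝ X] [NormedAddCommGroup Y]
    [NormedSpace ℝ Y] (C : MuCrd X) (C' : MuCrd Y) : X ≃ₗ[ℝ] Y where
  toFun x := C.A x • C'.a + C.E x • C'.e
  invFun y := C'.A y • C.a + C'.E y • C.e
  map_add' x y := by simp only [map_add]; module
  map_smul' r x := by simp only [map_smul, smul_eq_mul, RingHom.id_apply]; module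
  left_inv x := by
    apply C.ext' <;> simp [C.Aa, C.Ae, C.Ea, C.Ee, C'.Aa, C'.Ae, C'.Ea, C'.Ee]
  right_inv x := by
    apply C'.ext' <;> simp [C.Aa, C.Ae, C.Ea, C.Ee, C'.Aa, C'.Ae, C'.Ea, C'.Ee]

lemma MuCrd.equiv_apply {X Y : Type*} [NormedAddCommGroup X] [NormedSpace ℝ X]
    [NormedAddCommGroup Y]
    [NormedSpace ℝ Y] (C : MuCrd X) (C' : MuCrd Y) (x : X) :
    C.equiv C' x = C.A x • C'.a + C.E x • C'.e := rfl

lemma mu_seg {X : Type*} [NormedAddCommGroup X] [NormedSpace ℝ X]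
    (h : ¬ StrictlyConvexSphere X) :
    ∃ a d : X, d ≠ 0 ∧ ∀ r : ℝ, ‖a + r • d‖ = 1 ↔ r ∈ Icc (0 : ℝ) 1 := by
  unfold StrictlyConvexSphere at h
  push Not at h
  obtain ⟨s, hs, hc, hne⟩ := h
  obtain ⟨p, hp, q, hq, hpq⟩ := hne
  have sn : ∀ x ∈ s, ‖x‖ = 1 := fun x hx => by simpa using hs hx
  have h2 : ‖p + q‖ = 2 := by
    have := sn _ (hc hp hq (by norm_num : (0:ℝ) ≤ 1/2) (by norm_num : (0:ℝ) ≤ 1/2) (by norm_num))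
    rw [← smul_add, norm_smul] at this
    norm_num at this; linarith
  have hge : ∀ r : ℝ, 1 ≤ ‖p + r • (q - p)‖ := fun r => by
    have := mu_lb (sn p hp) (sn q hq) h2 (1 - r) r
    rw [show (1 - r) • p + r • q = p + r • (q - p) by module] at this
    linarith
  set w := q - p with hw
  have hw0 : w ≠ 0 := sub_ne_zero.2 (Ne.symm hpq)
  have hwp : 0 < ‖w‖ := norm_pos_iff.2 hw0
  set K : Set ℝ := {r | ‖p + r • w‖ ≤ 1} with hK
  have K0 : (0:ℝ) ∈ K := by simp [hK, sn p hp]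
  have K1 : (1:ℝ) ∈ K := by simp [hK, hw, sn q hq]
  have Kcl : IsClosed K := isClosed_le (by fun_prop) continuous_const
  have Kcv : Convex ℝ K := by
    intro x hx y hy α β hα hβ hab
    have e : p + (α • x + β • y) • w = α • (p + x • w) + β • (p + y • w) := by
      have : p = (α + β) • p := by rw [hab, one_smul]
      conv_lhs => rw [this]
      simp only [smul_eq_mul]; module
    change ‖_‖ ≤ 1
    rw [e]
    have hx' : ‖p + x • w‖ ≤ 1 := hx
    have hy' : ‖p + y • w‖ ≤ 1 := hy
    calc _ ≤ ‖α • (p + x • w)‖ + ‖β • (p + y • w)‖ := norm_add_le _ _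
      _ = α * ‖p + x • w‖ + β * ‖p + y • w‖ := by
        rw [norm_smul, norm_smul, Real.norm_of_nonneg hα, Real.norm_of_nonneg hβ]
      _ ≤ α * 1 + β * 1 := by gcongr
      _ = 1 := by linarith
  have Kb : K ⊆ Icc (-(2 / ‖w‖)) (2 / ‖w‖) := by
    intro r hr
    have hr' : ‖p + r • w‖ ≤ 1 := hr
    have := norm_sub_le (p + r • w) p
    rw [add_sub_cancel_left, norm_smul, sn p hp] at this
    rw [mem_Icc, ← abs_le, le_div_iff₀ hwp]
    exact this.trans (by linarith)
  have Kc : IsCompact K := isCompact_Icc.of_isClosed_subset Kcl Kb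
  have m0 := Kc.sInf_mem ⟨0, K0⟩
  have m1 := Kc.sSup_mem ⟨0, K0⟩
  set r0 := sInf K
  set r1 := sSup K
  have l0 : r0 ≤ 0 := csInf_le Kc.bddBelow K0
  have l1 : 1 ≤ r1 := le_csSup Kc.bddAbove K1
  refine ⟨p + r0 • w, (r1 - r0) • w, smul_ne_zero (by linarith) hw0, fun r => ?_⟩
  rw [show p + r0 • w + r • (r1 - r0) • w = p + (r0 + r * (r1 - r0)) • w by module]
  constructor
  · intro h
    have hm : r0 + r * (r1 - r0) ∈ K := h.le
    have i1 := csInf_le Kc.bddBelow hm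
    have i2 := le_csSup Kc.bddAbove hm
    change r0 ≤ _ at i1
    change _ ≤ r1 at i2
    constructor <;> by_contra hh <;> nlinarith
  · intro h
    refine le_antisymm ?_ (hge _)
    have : r0 + r * (r1 - r0) ∈ K := Kcv.ordConnected.out m0 m1
      ⟨by nlinarith [h.1, h.2], by nlinarith [h.1, h.2]⟩
    exact this

lemma mu_crdX {X : Type*} [NormedAddCommGroup X] [NormedSpace ℝ X]
    (hdim : Module.finrank ℝ X = 2) (h : ¬ StrictlyConvexSphere X) :
    ∃ C : MuCrd X, ∀ r : ℝ, ‖C.a + r • C.e‖ = 1 ↔ r ∈ Icc (0 : ℝ) 1 := by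
  obtain ⟨a, d, hd, hseg⟩ := mu_seg h
  have n0 : ‖a‖ = 1 := by simpa using (hseg 0).2 (by simp)
  have n1 : ‖a + d‖ = 1 := by simpa using (hseg 1).2 (by simp)
  have n2 := (hseg (1/2)).2 (by constructor <;> norm_num)
  have n3 : ‖a + (a + d)‖ = 2 := by
    rw [show a + (a + d) = (2:ℝ) • (a + (1/2 : ℝ) • d) by module, norm_smul, n2]; norm_num
  obtain ⟨C, h1, h2⟩ := mu_mkcrd hdim a d (fun α β hab => by
    have := mu_pair n0 n1 n3 (by simpa using hd) (α := α - β) (β := β) (by rw [← hab]; module)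
    constructor <;> linarith [this.1, this.2])
  exact ⟨C, by rw [h1, h2]; exact hseg⟩

/-- the standing hypotheses -/
structure MuS {X Y : Type*} [NormedAddCommGroup X] [NormedSpace ℝ X] [NormedAddCommGroup Y]
    [NormedSpace ℝ Y] (C : MuCrd X) (F : X → Y) : Prop where
  seg : ∀ r : ℝ, ‖C.a + r • C.e‖ = 1 ↔ r ∈ Icc (0 : ℝ) 1
  hn : ∀ x, ‖x‖ = 1 → ‖F x‖ = 1
  hd : ∀ x y, ‖x‖ = 1 → ‖y‖ = 1 → ‖F x - F y‖ = ‖x - y‖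
  hs : ∀ y, ‖y‖ = 1 → ∃ x, ‖x‖ = 1 ∧ F x = y

namespace MuS
variable {X Y : Type*} [NormedAddCommGroup X] [NormedSpace ℝ X] [NormedAddCommGroup Y]
    [NormedSpace ℝ Y] {C : MuCrd X} {F : X → Y}

lemma n0 (H : MuS C F) : ‖C.a‖ = 1 := by simpa using (H.seg 0).2 (by simp)
lemma n1 (H : MuS C F) : ‖C.a + C.e‖ = 1 := by simpa using (H.seg 1).2 (by simp)
lemma n2 (H : MuS C F) : ‖C.a + (C.a + C.e)‖ = 2 := by
  rw [show C.a + (C.a + C.e) = (2:ℝ) • (C.a + (1/2 : ℝ) • C.e) by module, norm_smul,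
    (H.seg (1/2)).2 (by constructor <;> norm_num)]; norm_num
lemma e_pos (H : MuS C F) : 0 < ‖C.e‖ := by
  rw [norm_pos_iff]; intro h; have := C.Ee; rw [h] at this; simp at this

lemma A_le (H : MuS C F) (u : X) : C.A u ≤ ‖u‖ := by
  have := mu_lb H.n0 H.n1 H.n2 (C.A u - C.E u) (C.E u)
  rw [show (C.A u - C.E u) • C.a + C.E u • (C.a + C.e) = C.A u • C.a + C.E u • C.e by module,
    ← C.rep] at this
  linarith

lemma A_eq (H : MuS C F) {u : X} (h0 : 0 ≤ C.E u) (h1 : C.E u ≤ C.A u) : ‖u‖ = C.A u := by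
  have := mu_flat H.n0 H.n1 H.n2 (sub_nonneg.2 h1) h0
  rw [show (C.A u - C.E u) • C.a + C.E u • (C.a + C.e) = C.A u • C.a + C.E u • C.e by module,
    ← C.rep] at this
  linarith

lemma A_lt (H : MuS C F) {u : X} (h0 : 0 < C.A u) (h1 : C.A u < C.E u) : C.A u < ‖u‖ := by
  refine lt_of_le_of_ne (H.A_le u) (fun h => ?_)
  have : ‖C.a + (C.E u / C.A u) • C.e‖ = 1 := by
    have e : u = C.A u • (C.a + (C.E u / C.A u) • C.e) := by
      rw [smul_add, smul_smul, mul_div_cancel₀ _ h0.ne', ← C.rep]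
    have e2 := congrArg norm e
    rw [norm_smul, ← h, Real.norm_of_nonneg h0.le] at e2
    field_simp at e2
    linarith
  have := ((H.seg _).1 this).2
  rw [div_le_one h0] at this
  linarith

lemma int (H : MuS C F) {x : X} {r : ℝ} (h0 : 0 < r) (h1 : r < 1) (hx : ‖x‖ = 1)
    (h : ‖x + (C.a + r • C.e)‖ = 2) : ∃ s ∈ Icc (0 : ℝ) 1, x = C.a + s • C.e := by
  obtain ⟨φ, hφ, hφx⟩ := exists_dual_vector'' ℝ (x + (C.a + r • C.e))
  have b : ∀ y, φ y ≤ ‖y‖ := fun y => by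
    calc φ y ≤ ‖φ y‖ := le_abs_self _
      _ ≤ ‖φ‖ * ‖y‖ := φ.le_opNorm y
      _ ≤ 1 * ‖y‖ := by gcongr
      _ = ‖y‖ := one_mul _
  rw [h] at hφx
  simp only [map_add, map_smul, smul_eq_mul] at hφx
  have b1 := b x
  have b2 := b C.a
  have b3 := b (C.a + C.e)
  rw [hx] at b1
  rw [H.n0] at b2
  rw [H.n1, map_add] at b3
  have hφx' : φ x + (φ C.a + r * φ C.e) = 2 := by simpa using hφx
  have e0 : φ C.e = 0 := by
    apply le_antisymm <;> by_contra hh <;> push Not at hh <;> nlinarith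
  rw [e0] at hφx' b3
  have a1 : φ C.a = 1 := by linarith
  have x1 : φ x = 1 := by linarith
  rw [C.rep x] at x1
  simp only [map_add, map_smul, smul_eq_mul, a1, e0] at x1
  have hA : C.A x = 1 := by linarith
  have hr := C.rep x
  rw [hA, one_smul] at hr
  exact ⟨C.E x, (H.seg _).1 (by rw [← hr, hx]), hr⟩

lemma cont (H : MuS C F) : ContinuousOn F (sphere 0 1) := by
  rw [Metric.continuousOn_iff]
  intro b hb ε hε
  refine ⟨ε, hε, fun a ha hab => ?_⟩
  rw [dist_eq_norm, H.hd _ _ (by simpa using ha) (by simpa using hb), ← dist_eq_norm]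
  exact hab

lemma opp_int (H : MuS C F) {r : ℝ} (h0 : 0 < r) (h1 : r < 1) :
    ∃ s ∈ Icc (0 : ℝ) 1, F (-(C.a + s • C.e)) = -F (C.a + r • C.e) := by
  have hr := (H.seg r).2 ⟨h0.le, h1.le⟩
  obtain ⟨z, hz, hFz⟩ := H.hs (-F (C.a + r • C.e)) (by rw [norm_neg, H.hn _ hr])
  have := H.hd _ _ hr hz
  rw [hFz, sub_neg_eq_add, ← two_smul ℝ, norm_smul, H.hn _ hr] at this
  obtain ⟨s, hs, e⟩ := H.int (x := -z) h0 h1 (by rwa [norm_neg]) (by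
    rw [neg_add_eq_sub, ← this]; norm_num)
  exact ⟨s, hs, by rw [← e, neg_neg, hFz]⟩

lemma opp (H : MuS C F) {r : ℝ} (hr : r ∈ Icc (0 : ℝ) 1) :
    ∃ s ∈ Icc (0 : ℝ) 1, F (-(C.a + s • C.e)) = -F (C.a + r • C.e) := by
  have cI : Continuous (fun s : ℝ => C.a + s • C.e) := by fun_prop
  have hK : IsCompact ((fun s : ℝ => F (-(C.a + s • C.e))) '' Icc (0:ℝ) 1) := by
    apply isCompact_Icc.image_of_continuousOn
    exact H.cont.comp cI.neg.continuousOn (fun s hs => by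
      rw [mem_sphere_zero_iff_norm, norm_neg]; exact (H.seg s).2 hs)
  have hm : MapsTo (fun s : ℝ => -F (C.a + s • C.e)) (Ioo 0 1)
      ((fun s : ℝ => F (-(C.a + s • C.e))) '' Icc (0:ℝ) 1) := fun s hs => H.opp_int hs.1 hs.2
  have hcl : closure (Ioo (0:ℝ) 1) = Icc 0 1 := closure_Ioo (by norm_num)
  have := hm.closure_of_continuousOn (by
    rw [hcl]
    exact (H.cont.comp cI.continuousOn (fun s hs => by simpa using (H.seg s).2 hs)).neg)
  rw [hcl, hK.isClosed.closure_eq] at this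
  exact this hr

lemma sum2 (H : MuS C F) {r s : ℝ} (hr : r ∈ Icc (0 : ℝ) 1) (hs : s ∈ Icc (0 : ℝ) 1) :
    ‖F (C.a + r • C.e) + F (C.a + s • C.e)‖ = 2 := by
  obtain ⟨w, hw, h⟩ := H.opp hs
  have := H.hd (C.a + r • C.e) (-(C.a + w • C.e)) ((H.seg _).2 hr)
    (by rw [norm_neg]; exact (H.seg _).2 hw)
  rw [h, sub_neg_eq_add] at this
  rw [this, show C.a + r • C.e - -(C.a + w • C.e) = (2:ℝ) • (C.a + ((r+w)/2) • C.e) by module,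
    norm_smul, (H.seg _).2 ⟨by linarith [hr.1, hw.1], by linarith [hr.2, hw.2]⟩]
  norm_num

lemma dis (H : MuS C F) {r s : ℝ} (hr : r ∈ Icc (0 : ℝ) 1) (hs : s ∈ Icc (0 : ℝ) 1) :
    ‖F (C.a + r • C.e) - F (C.a + s • C.e)‖ = |r - s| * ‖C.e‖ := by
  rw [H.hd _ _ ((H.seg _).2 hr) ((H.seg _).2 hs),
    show C.a + r • C.e - (C.a + s • C.e) = (r - s) • C.e by module, norm_smul, Real.norm_eq_abs]

end MuS


lemma mu_ivt {Y : Type*} [NormedAddCommGroup Y] [NormedSpace ℝ Y] {y v : Y} (hy : ‖y‖ = 1)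
    (hli : ∀ α β : ℝ, α • y + β • v = 0 → α = 0 ∧ β = 0) {ρ : ℝ} (h0 : 0 < ρ) (h2 : ρ < 2) :
    ∃ α β : ℝ, β ≠ 0 ∧ ‖α • y + β • v‖ = 1 ∧ ‖α • y + β • v - y‖ = ρ := by
  set γ : ℝ → Y := fun θ => Real.cos θ • y + Real.sin θ • v with hγ
  have γne : ∀ θ, γ θ ≠ 0 := fun θ h => by
    have := hli _ _ h
    have h3 := Real.sin_sq_add_cos_sq θ
    rw [this.1, this.2] at h3; norm_num at h3
  have γc : Continuous γ := by
    rw [hγ]; fun_prop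
  have γp : ∀ θ, 0 < ‖γ θ‖ := fun θ => norm_pos_iff.2 (γne θ)
  have hc : Continuous (fun θ => ‖‖γ θ‖⁻¹ • γ θ - y‖) :=
    (((γc.norm.inv₀ (fun t => (γp t).ne')).smul γc).sub continuous_const).norm
  have e0 : ‖‖γ 0‖⁻¹ • γ 0 - y‖ = 0 := by simp [hγ, hy]
  have e1 : ‖‖γ Real.pi‖⁻¹ • γ Real.pi - y‖ = 2 := by
    have : γ Real.pi = -y := by simp [hγ]
    rw [this, norm_neg, hy, inv_one, one_smul, show -y - y = (-2 : ℝ) • y by module, norm_smul, hy]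
    norm_num
  obtain ⟨θ, -, hθ⟩ := intermediate_value_Icc Real.pi_pos.le hc.continuousOn
    (show ρ ∈ _ by rw [e0, e1]; exact ⟨h0.le, h2.le⟩)
  have e : ‖γ θ‖⁻¹ • γ θ = (‖γ θ‖⁻¹ * Real.cos θ) • y + (‖γ θ‖⁻¹ * Real.sin θ) • v := by
    simp only [hγ]; module
  have hnorm : ‖‖γ θ‖⁻¹ • γ θ‖ = 1 := by
    rw [norm_smul, norm_inv, norm_norm, inv_mul_cancel₀ (γp θ).ne']
  simp only at hθ
  rw [e] at hθ hnorm
  refine ⟨_, _, fun hb => ?_, hnorm, hθ⟩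
  rw [hb, zero_smul, add_zero] at hθ hnorm
  rw [norm_smul, hy, mul_one, Real.norm_eq_abs] at hnorm
  rcases (abs_eq one_pos.le).1 hnorm with h5 | h5
  · rw [h5] at hθ; simp at hθ; linarith
  · rw [h5, show (-1:ℝ) • y - y = (-2 : ℝ) • y by module, norm_smul, hy] at hθ
    norm_num at hθ; linarith

lemma mu_dim {Y : Type*} [NormedAddCommGroup Y] [NormedSpace ℝ Y] {y p1 p2 : Y} (hy : ‖y‖ = 1)
    {ρ : ℝ} (h0 : 0 < ρ) (h2 : ρ < 2)
    (hp : ∀ z : Y, ‖z‖ = 1 → ‖z - y‖ = ρ → z = p1 ∨ z = p2) (v1 v2 : Y)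
    (hli : ∀ α β γ : ℝ, α • y + β • v1 + γ • v2 = 0 → α = 0 ∧ β = 0 ∧ γ = 0) : False := by
  obtain ⟨a1, b1, n1, s1, t1⟩ := mu_ivt (v := v1) hy (fun α β h => by
    have := hli α β 0 (by rw [← h]; module)
    exact ⟨this.1, this.2.1⟩) h0 h2
  obtain ⟨a2, b2, n2, s2, t2⟩ := mu_ivt (v := v2) hy (fun α β h => by
    have := hli α 0 β (by rw [← h]; module)
    exact ⟨this.1, this.2.2⟩) h0 h2
  obtain ⟨a3, b3, n3, s3, t3⟩ := mu_ivt (v := v1 + v2) hy (fun α β h => by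
    have := hli α β β (by rw [← h]; module)
    exact ⟨this.1, this.2.2⟩) h0 h2
  have k12 : a1 • y + b1 • v1 ≠ a2 • y + b2 • v2 := fun h => by
    have := hli (a1 - a2) b1 (-b2) (by rw [← sub_eq_zero] at h; rw [← h]; module)
    exact n1 this.2.1
  have k13 : a1 • y + b1 • v1 ≠ a3 • y + b3 • (v1 + v2) := fun h => by
    have := hli (a1 - a3) (b1 - b3) (-b3) (by rw [← sub_eq_zero] at h; rw [← h]; module)
    exact n3 (by linarith [this.2.2])
  have k23 : a2 • y + b2 • v2 ≠ a3 • y + b3 • (v1 + v2) := fun h => by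
    have := hli (a2 - a3) (-b3) (b2 - b3) (by rw [← sub_eq_zero] at h; rw [← h]; module)
    exact n3 (by linarith [this.2.1])
  rcases hp _ s1 t1 with q1 | q1 <;> rcases hp _ s2 t2 with q2 | q2 <;>
    rcases hp _ s3 t3 with q3 | q3
  · exact k12 (q1.trans q2.symm)
  · exact k12 (q1.trans q2.symm)
  · exact k13 (q1.trans q3.symm)
  · exact k23 (q2.trans q3.symm)
  · exact k23 (q2.trans q3.symm)
  · exact k13 (q1.trans q3.symm)
  · exact k12 (q1.trans q2.symm)
  · exact k12 (q1.trans q2.symm)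

lemma mu_aff {Y : Type*} [NormedAddCommGroup Y] [NormedSpace ℝ Y] {y0 y1 z : Y} {L r α β : ℝ}
    (h0 : ‖y0‖ = 1) (h1 : ‖y1‖ = 1) (hz : ‖z‖ = 1) (h01 : ‖y0 + y1‖ = 2) (h0z : ‖z + y0‖ = 2)
    (h1z : ‖z + y1‖ = 2) (hL : 0 < L) (hr : r ∈ Icc (0:ℝ) 1) (hd : ‖y1 - y0‖ = L)
    (hd0 : ‖z - y0‖ = r * L) (hd1 : ‖z - y1‖ = (1 - r) * L) (he : z = α • y0 + β • y1) :
    α = 1 - r ∧ β = r := by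
  have L2 : L ≤ 2 := by
    rw [← hd]; have := norm_sub_le y1 y0; rw [h0, h1] at this; linarith
  rcases le_or_gt 0 α with ha | ha
  · rcases le_or_gt 0 β with hb | hb
    · have e := mu_flat h0 h1 h01 ha hb
      rw [← he, hz] at e
      have : z - y0 = β • (y1 - y0) := by
        rw [he, show α = 1 - β by linarith]; module
      rw [this, norm_smul, hd, Real.norm_of_nonneg hb] at hd0
      have := mul_right_cancel₀ hL.ne' hd0
      constructor <;> linarith
    · exfalso
      have e := mu_flat hz h1 h1z zero_le_one (neg_pos.2 hb).le
      rw [show (1:ℝ) • z + (-β) • y1 = α • y0 by rw [he]; module, norm_smul, h0,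
        Real.norm_of_nonneg ha] at e
      have : z - y1 = α • (y0 - y1) := by
        rw [he, show β = 1 - α by linarith]; module
      rw [this, norm_smul, norm_sub_rev, hd, Real.norm_of_nonneg ha] at hd1
      have := mul_right_cancel₀ hL.ne' hd1
      linarith [hr.1]
  · rcases le_or_gt 0 β with hb | hb
    · exfalso
      have e := mu_flat hz h0 h0z zero_le_one (neg_pos.2 ha).le
      rw [show (1:ℝ) • z + (-α) • y0 = β • y1 by rw [he]; module, norm_smul, h1,
        Real.norm_of_nonneg hb] at e
      have : z - y0 = β • (y1 - y0) := by
        rw [he, show α = 1 - β by linarith]; module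
      rw [this, norm_smul, hd, Real.norm_of_nonneg hb] at hd0
      have := mul_right_cancel₀ hL.ne' hd0
      linarith [hr.2]
    · exfalso
      have e := mu_flat h0 h1 h01 (neg_pos.2 ha).le (neg_pos.2 hb).le
      rw [show (-α) • y0 + (-β) • y1 = -z by rw [he]; module, norm_neg, hz] at e
      rw [show z + y0 = (-β) • (y0 - y1) by
        rw [he, show α = -1 - β by linarith]; module, norm_smul, norm_sub_rev, hd,
        Real.norm_of_nonneg (neg_pos.2 hb).le] at h0z
      rw [show z + y1 = (-α) • (y1 - y0) by
        rw [he, show β = -1 - α by linarith]; module, norm_smul, hd,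
        Real.norm_of_nonneg (neg_pos.2 ha).le] at h1z
      nlinarith

namespace MuS
variable {X Y : Type*} [NormedAddCommGroup X] [NormedSpace ℝ X] [NormedAddCommGroup Y]
    [NormedSpace ℝ Y] {C : MuCrd X} {F : X → Y}

lemma two (H : MuS C F) : ∃ ρ : ℝ, 0 < ρ ∧ ρ < 2 ∧ ∃ p1 p2 : Y, ∀ z : Y, ‖z‖ = 1 →
    ‖z - F (C.a + (1/2 : ℝ) • C.e)‖ = ρ → z = p1 ∨ z = p2 := by
  set c := C.a + (1/2 : ℝ) • C.e with hc
  have hcn : ‖c‖ = 1 := (H.seg _).2 (by constructor <;> norm_num)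
  have Ac : C.A c = 1 := by simp [hc, C.Aa, C.Ae]
  have Ec : C.E c = 1/2 := by simp [hc, C.Ea, C.Ee]
  have ev : ∀ᶠ x in 𝓝 c, 0 < C.E x ∧ C.E x < C.A x := by
    apply Filter.Eventually.and
    · exact continuousAt_const.eventually_lt C.E.continuous.continuousAt (by rw [Ec]; norm_num)
    · exact C.E.continuous.continuousAt.eventually_lt C.A.continuous.continuousAt
        (by rw [Ec, Ac]; norm_num)
  obtain ⟨ε, he, hb⟩ := Metric.eventually_nhds_iff.1 ev
  have hL := H.e_pos
  refine ⟨min (ε / 2) 1, by positivity, lt_of_le_of_lt (min_le_right _ _) (by norm_num),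
    F (C.a + (1/2 + min (ε / 2) 1 / ‖C.e‖) • C.e), F (C.a + (1/2 - min (ε / 2) 1 / ‖C.e‖) • C.e),
    fun z hz hzr => ?_⟩
  obtain ⟨x, hx, rfl⟩ := H.hs z hz
  rw [H.hd _ _ hx hcn] at hzr
  obtain ⟨k1, k2⟩ := hb (y := x) (by
    rw [dist_eq_norm, hzr]; exact lt_of_le_of_lt (min_le_left _ _) (by linarith))
  have hA : C.A x = 1 := by rw [← H.A_eq k1.le k2.le, hx]
  have hrep := C.rep x
  rw [hA, one_smul] at hrep
  have hxc : x - c = (C.E x - 1/2) • C.e := by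
    conv_lhs => rw [hrep]
    rw [hc]; module
  rw [hxc, norm_smul, Real.norm_eq_abs] at hzr
  have : |C.E x - 1/2| = min (ε / 2) 1 / ‖C.e‖ := by rw [← hzr]; field_simp
  rcases (abs_eq (by positivity)).1 this with h | h
  · left; rw [← show C.E x = 1/2 + min (ε / 2) 1 / ‖C.e‖ by linarith, ← hrep]
  · right; rw [← show C.E x = 1/2 - min (ε / 2) 1 / ‖C.e‖ by linarith, ← hrep]

lemma ne (H : MuS C F) {r s : ℝ} (hr : r ∈ Icc (0 : ℝ) 1) (hs : s ∈ Icc (0 : ℝ) 1) (hrs : r ≠ s) :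
    F (C.a + r • C.e) ≠ F (C.a + s • C.e) := fun h => by
  have := H.dis hr hs
  rw [h, sub_self, norm_zero] at this
  have h2 : 0 < |r - s| * ‖C.e‖ := mul_pos (abs_pos.2 (sub_ne_zero.2 hrs)) H.e_pos
  linarith

lemma finrankY (H : MuS C F) : Module.finrank ℝ Y = 2 := by
  have i1 : (1/2 : ℝ) ∈ Icc (0:ℝ) 1 := by constructor <;> norm_num
  have i2 : (1 : ℝ) ∈ Icc (0:ℝ) 1 := by constructor <;> norm_num
  set y := F (C.a + (1/2 : ℝ) • C.e) with hy
  set z := F (C.a + (1 : ℝ) • C.e) with hz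
  have hli : ∀ α β : ℝ, α • y + β • z = 0 → α = 0 ∧ β = 0 := fun α β h =>
    mu_pair (H.hn _ ((H.seg _).2 i1)) (H.hn _ ((H.seg _).2 i2)) (H.sum2 i1 i2)
      (H.ne i1 i2 (by norm_num)) h
  obtain ⟨ρ, h0, h2, p1, p2, hp⟩ := H.two
  have hspan : ∀ v : Y, ∃ α β : ℝ, v = α • y + β • z := by
    intro v
    by_contra hv
    push Not at hv
    refine mu_dim (H.hn _ ((H.seg _).2 i1)) h0 h2 hp z v (fun α β γ h => ?_)
    have hγ : γ = 0 := by
      by_contra hγ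
      refine hv (-α / γ) (-β / γ) ?_
      have : γ • v = (-α) • y + (-β) • z := by
        rw [← sub_eq_zero, ← h]; module
      calc v = γ⁻¹ • (γ • v) := by rw [smul_smul, inv_mul_cancel₀ hγ, one_smul]
        _ = _ := by rw [this, smul_add, smul_smul, smul_smul]; ring_nf
    subst hγ
    have := hli α β (by rw [← h]; module)
    exact ⟨this.1, this.2, rfl⟩
  have hl : LinearIndependent ℝ ![y, z] := LinearIndependent.pair_iff.2 hli
  have hsp : ⊤ ≤ Submodule.span ℝ (Set.range ![y, z]) := by
    intro v _
    obtain ⟨α, β, rfl⟩ := hspan v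
    rw [Matrix.range_cons, Matrix.range_cons, Matrix.range_empty, union_empty, singleton_union]
    exact Submodule.mem_span_pair.2 ⟨α, β, rfl⟩
  rw [Module.finrank_eq_card_basis (Module.Basis.mk hl hsp)]
  simp

lemma exT (H : MuS C F) : ∃ T : X ≃ₗ[ℝ] Y, ∀ r ∈ Icc (0:ℝ) 1, F (C.a + r • C.e) = T (C.a + r • C.e) := by
  have i0 : (0 : ℝ) ∈ Icc (0:ℝ) 1 := by constructor <;> norm_num
  have i2 : (1 : ℝ) ∈ Icc (0:ℝ) 1 := by constructor <;> norm_num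
  set y0 := F (C.a + (0 : ℝ) • C.e) with hy0
  set y1 := F (C.a + (1 : ℝ) • C.e) with hy1
  have n0 : ‖y0‖ = 1 := H.hn _ ((H.seg _).2 i0)
  have n1 : ‖y1‖ = 1 := H.hn _ ((H.seg _).2 i2)
  obtain ⟨C', ha, he⟩ := mu_mkcrd H.finrankY y0 (y1 - y0) (fun α β h => by
    have := mu_pair n0 n1 (H.sum2 i0 i2)
      (H.ne i0 i2 (by norm_num)) (α := α - β) (β := β) (by rw [← h]; module)
    constructor <;> linarith [this.1, this.2])
  refine ⟨C.equiv C', fun r hr => ?_⟩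
  have hrep := C'.rep (F (C.a + r • C.e))
  rw [ha, he] at hrep
  have hd := H.dis i2 i0
  have hd0 := H.dis hr i0
  have hd1 := H.dis hr i2
  rw [sub_zero, abs_one, one_mul] at hd
  rw [sub_zero, abs_of_nonneg hr.1] at hd0
  rw [abs_of_nonpos (by linarith [hr.2]), neg_sub] at hd1
  have := mu_aff n0 n1 (H.hn _ ((H.seg _).2 hr)) (H.sum2 i0 i2) (H.sum2 hr i0) (H.sum2 hr i2)
    H.e_pos hr hd hd0 hd1 (α := C'.A (F (C.a + r • C.e)) - C'.E (F (C.a + r • C.e)))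
    (β := C'.E (F (C.a + r • C.e))) (by conv_lhs => rw [hrep]
                                        module)
  rw [C.equiv_apply, ha, he, hrep, this.2, show C'.A (F (C.a + r • C.e)) = 1 by linarith]
  simp [C.Aa, C.Ae, C.Ea, C.Ee]

lemma noflip (H : MuS C F) (T : X ≃ₗ[ℝ] Y) [FiniteDimensional ℝ X]
    (hT : ∀ r ∈ Icc (0:ℝ) 1, F (C.a + r • C.e) = T (C.a + r • C.e))
    (f0 : F (-(C.a + (1:ℝ) • C.e)) = -T (C.a + (0:ℝ) • C.e))
    (f1 : F (-(C.a + (0:ℝ) • C.e)) = -T (C.a + (1:ℝ) • C.e)) : False := by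
  have i0 : (0 : ℝ) ∈ Icc (0:ℝ) 1 := by constructor <;> norm_num
  have i2 : (1 : ℝ) ∈ Icc (0:ℝ) 1 := by constructor <;> norm_num
  have : FiniteDimensional ℝ Y := T.finiteDimensional
  have hTs : Continuous (T.symm : Y → X) :=
    (T.symm : Y →ₗ[ℝ] X).continuous_of_finiteDimensional
  have c1 : Continuous (fun t => T.symm (F (C.g t))) :=
    hTs.comp (H.cont.comp_continuous C.g_cont (fun t => by simp [C.g_norm]))
  have m0 : ‖T C.a‖ = 1 := by
    have := hT 0 i0; rw [zero_smul, add_zero] at this; rw [← this, H.hn _ H.n0]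
  have m1 : ‖T (C.a + C.e)‖ = 1 := by
    have := hT 1 i2; rw [one_smul] at this; rw [← this, H.hn _ H.n1]
  have m2 : ‖T C.a + T (C.a + C.e)‖ = 2 := by
    have := H.sum2 i0 i2
    rw [hT 0 i0, hT 1 i2, one_smul, zero_smul, add_zero] at this
    exact this
  have TA : ∀ u, T u = (C.A u - C.E u) • T C.a + C.E u • T (C.a + C.e) := fun u => by
    conv_lhs => rw [C.rep u]
    simp only [map_add, map_smul]; module
  have TA_le : ∀ u, C.A u ≤ ‖T u‖ := fun u => by
    have := mu_lb m0 m1 m2 (C.A u - C.E u) (C.E u)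
    rw [← TA] at this; linarith
  have TA_eq : ∀ u, 0 ≤ C.E u → C.E u ≤ C.A u → ‖T u‖ = C.A u := fun u h0 h1 => by
    have := mu_flat m0 m1 m2 (sub_nonneg.2 h1) h0
    rw [← TA] at this; linarith
  have hv : C.v (-1) = C.a + C.e := by simp [MuCrd.v]; abel
  have g1 : C.g (-1) = C.a + C.e := by rw [MuCrd.g, hv, H.n1, inv_one, one_smul]
  have y1 : T.symm (F (C.g (-1))) = C.a + C.e := by
    have := hT 1 i2
    rw [one_smul] at this
    rw [g1, this, LinearEquiv.symm_apply_apply]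
  have Ab : C.A (C.a + C.e) = 1 := by simp [C.Aa, C.Ae]
  have Eb : C.E (C.a + C.e) = 1 := by simp [C.Ea, C.Ee]
  have key : ∀ h : ℝ → X, Continuous h → h (-1) = C.a + C.e →
      ∀ᶠ t in 𝓝 (-1 : ℝ), 0 < C.E (h t + C.a) ∧ C.E (h t + C.a) < C.A (h t + C.a) := by
    intro h hc hh
    have hE : Continuous (fun t => C.E (h t + C.a)) := by fun_prop
    have hA : Continuous (fun t => C.A (h t + C.a)) := by fun_prop
    apply Filter.Eventually.and
    · refine continuousAt_const.eventually_lt hE.continuousAt ?_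
      rw [hh, map_add, Eb, C.Ea]; norm_num
    · refine hE.continuousAt.eventually_lt hA.continuousAt ?_
      rw [hh, map_add, Eb, map_add, Ab, C.Ea, C.Aa]; norm_num
  obtain ⟨ε, he, hb⟩ := Metric.eventually_nhds_iff.1 ((key _ c1 y1).and (key _ C.g_cont g1))
  have hm : 0 < min (ε / 2) (1 / 2) := by positivity
  have hm1 := min_le_left (ε / 2) (1 / 2)
  have hm2 := min_le_right (ε / 2) (1 / 2)
  set t := -1 + min (ε / 2) (1 / 2) with ht
  obtain ⟨⟨k1, k2⟩, k3, k4⟩ := hb (y := t) (by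
    rw [Real.dist_eq, abs_lt]; constructor <;> linarith)
  set x := C.g t with hx
  set y := T.symm (F x) with hy
  have hTy : T y = F x := by rw [hy, LinearEquiv.apply_symm_apply]
  have xn : ‖x‖ = 1 := C.g_norm t
  have q1 := H.hd x (-(C.a + C.e)) xn (by rw [norm_neg, H.n1])
  rw [one_smul, zero_smul, add_zero] at f0 f1
  rw [f0, sub_neg_eq_add, sub_neg_eq_add, ← hTy, ← map_add, TA_eq _ k1.le k2.le] at q1
  have q2 := H.hd x (-C.a) xn (by rw [norm_neg, H.n0])
  rw [f1, sub_neg_eq_add, sub_neg_eq_add, ← hTy, ← map_add, H.A_eq k3.le k4.le] at q2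
  have q3 := TA_le (y + (C.a + C.e))
  rw [q2, map_add, Ab, map_add, C.Aa] at q3
  rw [map_add, C.Aa] at q1
  have Ex := C.Eg_pos t
  have Ax := C.Ag' t
  rw [← hx] at Ex Ax
  have q4 := H.A_lt (u := x + (C.a + C.e)) (by rw [map_add, Ab, Ax]; nlinarith)
    (by rw [map_add, Ab, map_add, Eb, Ax]; nlinarith)
  rw [map_add, Ab] at q4
  linarith

lemma main (H : MuS C F) [FiniteDimensional ℝ X] : ∃ G : X ≃ₗᵢ[ℝ] Y, ∀ x, ‖x‖ = 1 → G x = F x := by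
  have i0 : (0 : ℝ) ∈ Icc (0:ℝ) 1 := by constructor <;> norm_num
  have i2 : (1 : ℝ) ∈ Icc (0:ℝ) 1 := by constructor <;> norm_num
  obtain ⟨T, hT⟩ := H.exT
  have opp' : ∀ r ∈ Icc (0:ℝ) 1, ∃ s ∈ Icc (0 : ℝ) 1,
      F (-(C.a + s • C.e)) = -T (C.a + r • C.e) := fun r hr => by
    rw [← hT r hr]; exact H.opp hr
  have hdis : ∀ r ∈ Icc (0:ℝ) 1, ∀ r' ∈ Icc (0:ℝ) 1, ∀ s ∈ Icc (0:ℝ) 1, ∀ s' ∈ Icc (0:ℝ) 1,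
      F (-(C.a + s • C.e)) = -T (C.a + r • C.e) → F (-(C.a + s' • C.e)) = -T (C.a + r' • C.e) →
      |s - s'| = |r - r'| := by
    intro r hr r' hr' s hs s' hs' h h'
    have q := H.hd (-(C.a + s • C.e)) (-(C.a + s' • C.e))
      (by rw [norm_neg]; exact (H.seg _).2 hs) (by rw [norm_neg]; exact (H.seg _).2 hs')
    rw [h, h', ← hT r hr, ← hT r' hr', ← norm_neg, neg_sub_neg, neg_sub, H.dis hr hr',
      show -(C.a + s • C.e) - -(C.a + s' • C.e) = (s' - s) • C.e by module, norm_smul,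
      Real.norm_eq_abs, abs_sub_comm s'] at q
    exact (mul_right_cancel₀ H.e_pos.ne' q).symm
  obtain ⟨w0, hw0, e0⟩ := opp' 0 i0
  obtain ⟨w1, hw1, e1⟩ := opp' 1 i2
  have h01 := hdis 1 i2 0 i0 w1 hw1 w0 hw0 e1 e0
  rw [sub_zero, abs_one] at h01
  have hw : w0 = 0 := by
    rcases (abs_eq one_pos.le).1 h01 with h | h
    · linarith [hw0.1, hw1.2]
    · exfalso
      have a1 : w0 = 1 := by linarith [hw0.2, hw1.1]
      have a2 : w1 = 0 := by linarith [hw0.2, hw1.1]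
      subst a1 a2
      exact H.noflip T hT e0 e1
  subst hw
  have anti : ∀ r ∈ Icc (0:ℝ) 1, F (-(C.a + r • C.e)) = -T (C.a + r • C.e) := by
    intro r hr
    obtain ⟨s, hs, e⟩ := opp' r hr
    have := hdis r hr 0 i0 s hs 0 hw0 e e0
    rw [sub_zero, sub_zero, abs_of_nonneg hs.1, abs_of_nonneg hr.1] at this
    rwa [this] at e
  have gI : ∀ t ≤ (-1 : ℝ), ∃ r ∈ Icc (0:ℝ) 1, C.g t = C.a + r • C.e := by
    intro t ht
    have hn : ‖C.v t‖ = -t := by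
      rw [H.A_eq (by rw [C.Ev]; norm_num) (by rw [C.Ev, C.Av]; linarith), C.Av]
    have tp : 0 < -t := by linarith
    refine ⟨(-t)⁻¹, ⟨by positivity, inv_le_one_of_one_le₀ (by linarith)⟩, ?_⟩
    rw [MuCrd.g, hn, MuCrd.v, show C.e - t • C.a = C.e + (-t) • C.a by module, smul_add, smul_smul,
      inv_mul_cancel₀ tp.ne', one_smul, add_comm]
  refine mu_fin C T F H.n0 H.hn H.hd (fun t ht => ?_) ?_ ?_
  · obtain ⟨r, hr, e⟩ := gI t ht
    rw [e]
    exact ⟨hT r hr, anti r hr⟩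
  · simpa using hT 0 i0
  · simpa using anti 0 i0

end MuS

theorem not_strictly_convex_two_dim_mazur_ulam
    {X : Type*} [NormedAddCommGroup X] [NormedSpace ℝ X] [CompleteSpace X]
    (hdim : Module.finrank ℝ X = 2)
    (hnsc : ¬ StrictlyConvexSphere X)
    (Y : Type*) [NormedAddCommGroup Y] [NormedSpace ℝ Y] [CompleteSpace Y]
    (f : sphere (0 : X) 1 → sphere (0 : Y) 1)
    (hf_iso : Isometry f) (hf_surj : Function.Surjective f) :
    ∃ F : X ≃ₗᵢ[ℝ] Y, ∀ x : sphere (0 : X) 1, F (x : X) = (f x : Y) := by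
  classical
  obtain ⟨C, hC⟩ := mu_crdX hdim hnsc
  have hfd : FiniteDimensional ℝ X := Module.finite_of_finrank_pos (by omega)
  set F : X → Y := fun x => if h : ‖x‖ = 1 then (f ⟨x, by simpa using h⟩ : Y) else 0 with hF
  have Fe : ∀ x (h : ‖x‖ = 1), F x = f ⟨x, by simpa using h⟩ := fun x h => by
    simp [hF, h]
  have H : MuS C F := by
    refine ⟨hC, fun x hx => ?_, fun x y hx hy => ?_, fun y hy => ?_⟩
    · rw [Fe x hx]; simp
    · rw [Fe x hx, Fe y hy, ← dist_eq_norm, ← Subtype.dist_eq, hf_iso.dist_eq,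
        Subtype.dist_eq, dist_eq_norm]
    · obtain ⟨x, hx⟩ := hf_surj ⟨y, by simpa using hy⟩
      have xn : ‖(x : X)‖ = 1 := by simp
      exact ⟨x, xn, by rw [Fe _ xn, Subtype.coe_eta, hx]⟩
  obtain ⟨G, hG⟩ := H.main
  refine ⟨G, fun x => ?_⟩
  have xn : ‖(x : X)‖ = 1 := by simp
  rw [hG _ xn, Fe _ xn]
end

section
/- Every non-smooth point of the unit sphere of a strictly convex 2-dimensional real Banach space is special: if X is a strictly convex 2-dimensional real Banach space and c ∈ S_X is a non-smooth point, then c is a special point of S_X. -/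
open Metric Set

/-- A point `x` of the unit sphere of `X` is *smooth* if there is a unique continuous
linear functional `g : X →L[ℝ] ℝ` with `g x = 1 = ‖g‖`. -/
def IsSmoothPoint {X : Type*} [NormedAddCommGroup X] [NormedSpace ℝ X] (x : X) : Prop :=
  ∃! g : X →L[ℝ] ℝ, g x = 1 ∧ ‖g‖ = 1

/-- A point `x` of the unit sphere of `X` is *special* if for every real Banach space `Y`,
every surjective isometry `f : S_X → S_Y`, and all `y, z ∈ S_X` with `y - z = ‖y - z‖ • x`,
one has `f y - f z = ‖y - z‖ • f x`. -/
def IsSpecialPoint {X : Type*} [NormedAddCommGroup X] [NormedSpace ℝ X]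
    (x : sphere (0 : X) 1) : Prop :=
  ∀ (Y : Type*) [NormedAddCommGroup Y] [NormedSpace ℝ Y] [CompleteSpace Y],
    ∀ f : sphere (0 : X) 1 → sphere (0 : Y) 1, Isometry f → Function.Surjective f →
      ∀ y z : sphere (0 : X) 1, (y : X) - (z : X) = ‖(y : X) - (z : X)‖ • (x : X) →
        (f y : Y) - (f z : Y) = ‖(y : X) - (z : X)‖ • (f x : Y)

open Filter Topology

/-- Working form of strict convexity. -/
def SCP (V : Type*) [NormedAddCommGroup V] : Prop :=
  ∀ a b : V, ‖a‖ = 1 → ‖b‖ = 1 → ‖a + b‖ = 2 → a = b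

/-- The set of non-smooth directions. -/
def NSet (V : Type*) [NormedAddCommGroup V] [NormedSpace ℝ V] : Set V :=
  {d | ‖d‖ = 1 ∧ ∃ G H : V →L[ℝ] ℝ, G ≠ H ∧ ‖G‖ ≤ 1 ∧ ‖H‖ ≤ 1 ∧ G d = 1 ∧ H d = 1}

lemma clm_le {V : Type*} [NormedAddCommGroup V] [NormedSpace ℝ V] {G : V →L[ℝ] ℝ}
    (hG : ‖G‖ ≤ 1) (v : V) : G v ≤ ‖v‖ :=
  calc G v ≤ ‖G v‖ := le_abs_self _
    _ ≤ ‖G‖ * ‖v‖ := G.le_opNorm v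
    _ ≤ 1 * ‖v‖ := by gcongr
    _ = ‖v‖ := one_mul _

lemma exists_supp {V : Type*} [NormedAddCommGroup V] [NormedSpace ℝ V] (v : V) :
    ∃ G : V →L[ℝ] ℝ, ‖G‖ ≤ 1 ∧ G v = ‖v‖ := by
  obtain ⟨g, h1, h2⟩ := exists_dual_vector'' ℝ v
  exact ⟨g, h1, by simpa using h2⟩

lemma scp_of_sphere {V : Type*} [NormedAddCommGroup V] [NormedSpace ℝ V]
    (h : StrictlyConvexSphere V) : SCP V := by
  intro a b ha hb hab
  obtain ⟨G, hG, hGv⟩ := exists_supp (a + b)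
  have h1 := clm_le hG a
  have h2 := clm_le hG b
  rw [map_add] at hGv
  have hGa : G a = 1 := by linarith
  have hGb : G b = 1 := by linarith
  refine h (segment ℝ a b) ?_ (convex_segment a b) (left_mem_segment ℝ a b) (right_mem_segment ℝ a b)
  rintro x ⟨r, s, hr, hs, hrs, rfl⟩
  rw [mem_sphere_zero_iff_norm]
  apply le_antisymm
  · calc ‖r • a + s • b‖ ≤ ‖r • a‖ + ‖s • b‖ := norm_add_le _ _
      _ = 1 := by rw [norm_smul, norm_smul, ha, hb, Real.norm_of_nonneg hr, Real.norm_of_nonneg hs]; linarith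
  · have := clm_le hG (r • a + s • b)
    simp only [map_add, map_smul, hGa, hGb, smul_eq_mul] at this
    linarith

lemma SCP.eq_of_supp {V : Type*} [NormedAddCommGroup V] [NormedSpace ℝ V] (h : SCP V)
    {G : V →L[ℝ] ℝ} (hG : ‖G‖ ≤ 1) {a b : V} (ha : ‖a‖ = 1) (hb : ‖b‖ = 1)
    (hGa : G a = 1) (hGb : G b = 1) : a = b := by
  apply h a b ha hb
  apply le_antisymm
  · calc ‖a + b‖ ≤ ‖a‖ + ‖b‖ := norm_add_le _ _
      _ = 2 := by linarith
  · have := clm_le hG (a + b)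
    simp only [map_add, hGa, hGb] at this
    linarith

lemma ulim {ι V : Type*} [NormedAddCommGroup V] [ProperSpace V] (U : Ultrafilter ι)
    (u : ι → V) (R : ℝ) (h : ∀ᶠ n in (U : Filter ι), ‖u n‖ ≤ R) :
    ∃ a, Tendsto u U (𝓝 a) := by
  obtain ⟨a, -, ha⟩ := (isCompact_closedBall (0 : V) R).ultrafilter_le_nhds (U.map u) (by
    rw [le_principal_iff]
    change ∀ᶠ n in (U : Filter ι), u n ∈ closedBall (0 : V) R
    filter_upwards [h] with n hn
    simpa using hn)
  exact ⟨a, ha⟩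

lemma dual_finrank {V : Type*} [NormedAddCommGroup V] [NormedSpace ℝ V]
    (hd : Module.finrank ℝ V = 2) : Module.finrank ℝ (V →L[ℝ] ℝ) = 2 := by
  have : FiniteDimensional ℝ V := Module.finite_of_finrank_pos (by omega)
  rw [← (LinearMap.toContinuousLinearMap : (V →ₗ[ℝ] ℝ) ≃ₗ[ℝ] (V →L[ℝ] ℝ)).finrank_eq]
  rw [← hd]
  exact Subspace.dual_finrank_eq

lemma exists_ker {V : Type*} [NormedAddCommGroup V] [NormedSpace ℝ V]
    (hd : Module.finrank ℝ V = 2) (v : V) : ∃ φ : V →L[ℝ] ℝ, φ ≠ 0 ∧ φ v = 0 := by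
  have : FiniteDimensional ℝ V := Module.finite_of_finrank_pos (by omega)
  have hlt : Submodule.span ℝ {v} < ⊤ := by
    rw [lt_top_iff_ne_top]
    intro h
    have h1 := finrank_span_le_card (R := ℝ) ({v} : Set V)
    rw [h, finrank_top] at h1
    simp at h1
    omega
  obtain ⟨f, hf, hle⟩ := Submodule.exists_le_ker_of_lt_top _ hlt
  refine ⟨LinearMap.toContinuousLinearMap f, ?_, ?_⟩
  · simpa using hf
  · exact hle (Submodule.mem_span_singleton_self v)

lemma ker_one {V : Type*} [NormedAddCommGroup V] [NormedSpace ℝ V]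
    (hd : Module.finrank ℝ V = 2) {φ : V →L[ℝ] ℝ} (hφ : φ ≠ 0) {v w : V} (hv : v ≠ 0)
    (h1 : φ v = 0) (h2 : φ w = 0) : ∃ r : ℝ, w = r • v := by
  have : FiniteDimensional ℝ V := Module.finite_of_finrank_pos (by omega)
  have hne : (φ : V →ₗ[ℝ] ℝ) ≠ 0 := by
    intro h; apply hφ; ext x; exact LinearMap.congr_fun h x
  have hr := LinearMap.finrank_range_add_finrank_ker (φ : V →ₗ[ℝ] ℝ)
  rw [LinearMap.range_eq_top.2 (LinearMap.surjective hne), finrank_top, hd] at hr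
  simp only [Module.finrank_self] at hr
  have hk : Module.finrank ℝ (LinearMap.ker (φ : V →ₗ[ℝ] ℝ)) = 1 := by omega
  have hv' : (⟨v, h1⟩ : LinearMap.ker (φ : V →ₗ[ℝ] ℝ)) ≠ 0 := by
    intro h; exact hv (congrArg Subtype.val h)
  obtain ⟨r, hr⟩ := (finrank_eq_one_iff_of_nonzero' _ hv').1 hk ⟨w, h2⟩
  exact ⟨r, (congrArg Subtype.val hr).symm⟩

lemma nset_countable {V : Type*} [NormedAddCommGroup V] [NormedSpace ℝ V]
    (hd : Module.finrank ℝ V = 2) (hs : SCP V) : (NSet V).Countable := by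
  have : FiniteDimensional ℝ V := Module.finite_of_finrank_pos (by omega)
  have hdd := dual_finrank hd
  have : FiniteDimensional ℝ (V →L[ℝ] ℝ) := Module.finite_of_finrank_pos (by omega)
  have : ProperSpace (V →L[ℝ] ℝ) := FiniteDimensional.proper ℝ _
  let O : V → Set (V →L[ℝ] ℝ) := fun d =>
    interior {F | F ≠ 0 ∧ F d = ‖F‖}
  refine Set.PairwiseDisjoint.countable_of_isOpen (s := O) ?_ (fun _ _ => isOpen_interior) ?_
  · intro d hd' e he hde
    rw [Function.onFun, Set.disjoint_left]
    intro F hF hF'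
    have h1 := interior_subset hF
    have h2 := interior_subset hF'
    apply hde
    have hpos : 0 < ‖F‖ := norm_pos_iff.2 h1.1
    refine hs.eq_of_supp (G := ‖F‖⁻¹ • F) ?_ hd'.1 he.1 ?_ ?_
    · rw [norm_smul, norm_inv, norm_norm, inv_mul_cancel₀ hpos.ne']
    · simp [h1.2, hpos.ne']
    · simp [h2.2, hpos.ne']
  · rintro d ⟨hdn, G, H, hGH, hG, hH, hGd, hHd⟩
    let L : ℝ × ℝ →ₗ[ℝ] (V →L[ℝ] ℝ) :=
      (LinearMap.fst ℝ ℝ ℝ).smulRight G + (LinearMap.snd ℝ ℝ ℝ).smulRight H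
    have hL : ∀ p, L p = p.1 • G + p.2 • H := fun p => rfl
    have hinj : Function.Injective L := by
      rw [← LinearMap.ker_eq_bot, LinearMap.ker_eq_bot']
      rintro ⟨a, b⟩ hab
      rw [hL] at hab
      have h1 : a + b = 0 := by
        have := congrArg (fun F : V →L[ℝ] ℝ => F d) hab
        simpa [hGd, hHd] using this
      have hb : b = -a := by linarith
      subst hb
      have h2 : a • (G - H) = 0 := by
        rw [← hab]; simp only; module
      rcases smul_eq_zero.1 h2 with h | h
      · simp [h]
      · exact absurd (sub_eq_zero.1 h) hGH
    have hsurj : Function.Surjective L :=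
      (LinearMap.injective_iff_surjective_of_finrank_eq_finrank (by rw [hdd]; simp)).1 hinj
    have hopen := L.isOpenMap_of_finiteDimensional hsurj
    refine ⟨L (1, 1), ?_⟩
    refine interior_maximal (s := {F : V →L[ℝ] ℝ | F ≠ 0 ∧ F d = ‖F‖})
      (t := L '' (Set.Ioi 0 ×ˢ Set.Ioi 0)) ?_ (hopen _ (isOpen_Ioi.prod isOpen_Ioi)) ?_
    · rintro _ ⟨⟨a, b⟩, ⟨ha, hb⟩, rfl⟩
      simp only [Set.mem_Ioi] at ha hb
      have hv : (L (a, b)) d = a + b := by simp [hL, hGd, hHd]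
      refine ⟨?_, ?_⟩
      · intro h0
        rw [h0] at hv
        simp at hv
        linarith
      · apply le_antisymm
        · calc L (a, b) d ≤ ‖L (a, b) d‖ := le_abs_self _
            _ ≤ ‖L (a, b)‖ * ‖d‖ := ContinuousLinearMap.le_opNorm _ _
            _ = _ := by rw [hdn, mul_one]
        · rw [hv, hL]
          calc ‖a • G + b • H‖ ≤ ‖a • G‖ + ‖b • H‖ := norm_add_le _ _
            _ = a * ‖G‖ + b * ‖H‖ := by
              rw [norm_smul, norm_smul, Real.norm_of_nonneg ha.le, Real.norm_of_nonneg hb.le]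
            _ ≤ a * 1 + b * 1 := by gcongr
            _ = _ := by ring
    · exact ⟨(1, 1), ⟨by simp, by simp⟩, rfl⟩

/-- One-sided points of the sphere at a prescribed small distance. -/
lemma side {V : Type*} [NormedAddCommGroup V] [NormedSpace ℝ V] {y e : V} {φ : V →L[ℝ] ℝ}
    (hy : ‖y‖ = 1) (h0 : φ y = 0) (h1 : φ e = 1) :
    ∃ ρ > 0, ∀ h, 0 < h → h ≤ ρ → ∃ x : V, ‖x‖ = 1 ∧ ‖x - y‖ = h ∧ 0 ≤ φ x := by
  have hne : ∀ s : ℝ, y + s • e ≠ 0 := by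
    intro s hs
    have h2 : s = 0 := by
      have := congrArg φ hs
      simpa [h0, h1] using this
    rw [h2] at hs
    simp at hs
    simp [hs] at hy
  let γ : ℝ → V := fun s => ‖y + s • e‖⁻¹ • (y + s • e)
  have hγ : Continuous γ := by
    apply Continuous.smul _ (by fun_prop)
    exact Continuous.inv₀ (by fun_prop) (fun s => norm_ne_zero_iff.2 (hne s))
  have hφγ : ∀ s, φ (γ s) = ‖y + s • e‖⁻¹ * s := by intro s; simp [γ, h0, h1]
  have hγ0 : γ 0 = y := by simp [γ, hy]
  refine ⟨‖γ 1 - y‖, ?_, ?_⟩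
  · rw [gt_iff_lt, norm_pos_iff, sub_ne_zero]
    intro h
    have := hφγ 1
    rw [h, h0, mul_one] at this
    exact (inv_ne_zero (norm_ne_zero_iff.2 (hne 1))) this.symm
  · intro h hh hh'
    have hiv := intermediate_value_Icc (f := fun s => ‖γ s - y‖) (zero_le_one : (0:ℝ) ≤ 1)
      (by fun_prop)
    obtain ⟨s, hs, hs'⟩ := hiv (show h ∈ _ from ⟨by simp [hγ0, hh.le], hh'⟩)
    refine ⟨γ s, ?_, hs', ?_⟩
    · simp only [γ]
      rw [norm_smul, norm_inv, norm_norm, inv_mul_cancel₀ (norm_ne_zero_iff.2 (hne s))]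
    · rw [hφγ]
      exact mul_nonneg (by positivity) hs.1

lemma tendsto_clm {ι V : Type*} [NormedAddCommGroup V] [NormedSpace ℝ V] {l : Filter ι}
    {G : ι → V →L[ℝ] ℝ} {A : V →L[ℝ] ℝ} {u : ι → V} {a : V} (hG : Tendsto G l (𝓝 A))
    (hu : Tendsto u l (𝓝 a)) : Tendsto (fun n => G n (u n)) l (𝓝 (A a)) :=
  ((isBoundedBilinearMap_apply (𝕜 := ℝ) (E := V) (F := ℝ)).continuous.tendsto (A, a)).comp
    (hG.prodMk_nhds hu)

lemma tangent {V : Type*} [NormedAddCommGroup V] [NormedSpace ℝ V] [ProperSpace (V →L[ℝ] ℝ)]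
    {U : Ultrafilter ℕ} {y : V} (hy : ‖y‖ = 1) (hyn : y ∉ NSet V) {g : V →L[ℝ] ℝ}
    (hg : ‖g‖ ≤ 1) (hgy : g y = 1) {x : ℕ → V} {h : ℕ → ℝ} (hx : ∀ n, ‖x n‖ = 1)
    (hh : ∀ n, 0 < h n) (hxy : Tendsto x U (𝓝 y)) {p : V}
    (hp : Tendsto (fun n => (h n)⁻¹ • (x n - y)) U (𝓝 p)) : g p = 0 := by
  apply le_antisymm
  · have ht : Tendsto (fun n => g ((h n)⁻¹ • (x n - y))) U (𝓝 (g p)) :=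
      (g.continuous.tendsto p).comp hp
    refine le_of_tendsto ht (Eventually.of_forall fun n => ?_)
    have := clm_le hg (x n)
    rw [map_smul, map_sub, hgy, smul_eq_mul]
    refine mul_nonpos_of_nonneg_of_nonpos (inv_nonneg.2 (hh n).le) ?_
    rw [hx] at this; linarith
  · choose G hG hGx using fun n => exists_supp (x n)
    obtain ⟨A, hA⟩ := ulim U G 1 (Eventually.of_forall hG)
    have hA1 : ‖A‖ ≤ 1 := le_of_tendsto hA.norm (Eventually.of_forall hG)
    have hAy : A y = 1 := by
      have h1 : Tendsto (fun n => G n (x n)) U (𝓝 (A y)) := tendsto_clm hA hxy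
      have h2 : (fun n => G n (x n)) = fun _ => 1 := by funext n; rw [hGx, hx]
      rw [h2] at h1
      exact tendsto_nhds_unique h1 tendsto_const_nhds
    have hAg : A = g := by
      by_contra hne
      exact hyn ⟨hy, A, g, hne, hA1, hg, hAy, hgy⟩
    rw [← hAg]
    refine ge_of_tendsto (tendsto_clm hA hp) (Eventually.of_forall fun n => ?_)
    have := clm_le (hG n) y
    rw [map_smul, map_sub, hGx, hx, smul_eq_mul]
    refine mul_nonneg (inv_nonneg.2 (hh n).le) ?_
    rw [hy] at this; linarith

lemma kink {X Y : Type*} [NormedAddCommGroup X] [NormedSpace ℝ X]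
    [NormedAddCommGroup Y] [NormedSpace ℝ Y]
    (hdX : Module.finrank ℝ X = 2) (hdY : Module.finrank ℝ Y = 2) (hsX : SCP X) (hsY : SCP Y)
    (f : sphere (0 : X) 1 → sphere (0 : Y) 1) (hf : Isometry f) {c : X} (hc : c ∈ NSet X)
    (y z : sphere (0 : X) 1) {t : ℝ} (ht : 0 < t) (hyz : (y : X) - z = t • c)
    (hy : (y : X) ∉ NSet X) : t⁻¹ • ((f y : Y) - f z) ∈ NSet Y := by
  have : FiniteDimensional ℝ X := Module.finite_of_finrank_pos (by omega)
  have : FiniteDimensional ℝ Y := Module.finite_of_finrank_pos (by omega)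
  have := dual_finrank hdX
  have := dual_finrank hdY
  have : FiniteDimensional ℝ (X →L[ℝ] ℝ) := Module.finite_of_finrank_pos (by omega)
  have : FiniteDimensional ℝ (Y →L[ℝ] ℝ) := Module.finite_of_finrank_pos (by omega)
  have : ProperSpace X := FiniteDimensional.proper ℝ _
  have : ProperSpace Y := FiniteDimensional.proper ℝ _
  have : ProperSpace (X →L[ℝ] ℝ) := FiniteDimensional.proper ℝ _
  have : ProperSpace (Y →L[ℝ] ℝ) := FiniteDimensional.proper ℝ _
  have hnf : ∀ a b, ‖(f a : Y) - f b‖ = ‖(a : X) - b‖ := by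
    intro a b
    have := hf.dist_eq a b
    rwa [Subtype.dist_eq, Subtype.dist_eq, dist_eq_norm, dist_eq_norm] at this
  have hn1 : ∀ a : sphere (0 : X) 1, ‖(a : X)‖ = 1 := fun a => mem_sphere_zero_iff_norm.1 a.2
  obtain ⟨hcn, G, H, hGH, hG, hH, hGc, hHc⟩ := hc
  -- side points
  have hy1 := hn1 y
  have hy0 : (y : X) ≠ 0 := by intro h; simp [h] at hy1
  obtain ⟨φ, hφ, hφy⟩ := exists_ker hdX (y : X)
  obtain ⟨e, he⟩ : ∃ e, φ e = 1 := by
    obtain ⟨e, he⟩ : ∃ e, φ e ≠ 0 := by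
      by_contra! h; exact hφ (by ext x; simp [h x])
    exact ⟨(φ e)⁻¹ • e, by simp [he]⟩
  obtain ⟨ρ, hρ, hside⟩ := side hy1 hφy he
  obtain ⟨ρ', hρ', hside'⟩ := side (y := (y : X)) (e := -e) (φ := -φ) hy1 (by simp [hφy]) (by simp [he])
  let h : ℕ → ℝ := fun n => min ρ ρ' * (1 / ((n : ℝ) + 1))
  have hmin : 0 < min ρ ρ' := lt_min hρ hρ'
  have hh : ∀ n, 0 < h n := fun n => by positivity
  have hhle : ∀ n, h n ≤ min ρ ρ' := fun n => by
    apply mul_le_of_le_one_right hmin.le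
    rw [div_le_one (by positivity)]
    linarith [Nat.cast_nonneg (α := ℝ) n]
  let U : Ultrafilter ℕ := hyperfilter ℕ
  have hh0 : Tendsto h U (𝓝 0) := by
    have h1 : Tendsto h atTop (𝓝 0) := by
      have := (tendsto_one_div_add_atTop_nhds_zero_nat (𝕜 := ℝ)).const_mul (min ρ ρ')
      rw [mul_zero] at this
      exact this
    exact h1.mono_left Nat.hyperfilter_le_atTop
  choose x hx1 hxy hxφ using fun n => hside (h n) (hh n) ((hhle n).trans (min_le_left _ _))
  choose x' hx1' hxy' hxφ' using fun n => hside' (h n) (hh n) ((hhle n).trans (min_le_right _ _))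
  have hlim : ∀ {w : ℕ → X}, (∀ n, ‖w n - y‖ = h n) → Tendsto w U (𝓝 (y : X)) := by
    intro w hw
    rw [tendsto_iff_norm_sub_tendsto_zero]
    simpa [hw] using hh0
  have hxl := hlim hxy
  have hxl' := hlim hxy'
  have hnu : ∀ {W : Type _} [NormedAddCommGroup W] [NormedSpace ℝ W] (w : ℕ → W),
      (∀ n, ‖w n‖ = h n) → ∀ n, ‖(h n)⁻¹ • w n‖ = 1 := by
    intro W _ _ w hw n
    rw [norm_smul, hw, norm_inv, Real.norm_of_nonneg (hh n).le, inv_mul_cancel₀ (hh n).ne']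
  have hnu' : ∀ {W : Type _} [NormedAddCommGroup W] [NormedSpace ℝ W] (w : ℕ → W),
      (∀ n, ‖w n‖ = h n) → ∀ n, ‖(h n)⁻¹ • w n‖ = 1 := by
    intro W _ _ w hw n
    rw [norm_smul, hw, norm_inv, Real.norm_of_nonneg (hh n).le, inv_mul_cancel₀ (hh n).ne']
  have hu1 := hnu (fun n => x n - y) hxy
  have hu1' := hnu (fun n => x' n - y) hxy'
  obtain ⟨p, hp⟩ := ulim U _ 1 (Eventually.of_forall fun n => (hu1 n).le)
  obtain ⟨q, hq⟩ := ulim U _ 1 (Eventually.of_forall fun n => (hu1' n).le)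
  have hunit : ∀ {W : Type _} [NormedAddCommGroup W] {w : ℕ → W} {a : W},
      Tendsto w U (𝓝 a) → (∀ n, ‖w n‖ = 1) → ‖a‖ = 1 := by
    intro W _ w a ha hw
    have := ha.norm
    simp only [hw] at this
    exact tendsto_nhds_unique this tendsto_const_nhds
  have hunit' : ∀ {W : Type _} [NormedAddCommGroup W] {w : ℕ → W} {a : W},
      Tendsto w U (𝓝 a) → (∀ n, ‖w n‖ = 1) → ‖a‖ = 1 := by
    intro W _ w a ha hw
    have := ha.norm
    simp only [hw] at this
    exact tendsto_nhds_unique this tendsto_const_nhds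
  have hp1 : ‖p‖ = 1 := hunit hp hu1
  have hq1 : ‖q‖ = 1 := hunit hq hu1'
  have hp0 : p ≠ 0 := by intro h; simp [h] at hp1
  obtain ⟨g, hg, hgy⟩ := exists_supp (y : X)
  rw [hy1] at hgy
  have hg0 : g ≠ 0 := by intro h; simp [h] at hgy
  have hgp : g p = 0 := tangent hy1 hy hg hgy hx1 hh hxl hp
  have hgq : g q = 0 := tangent hy1 hy hg hgy hx1' hh hxl' hq
  have hφp : 0 ≤ φ p := by
    refine ge_of_tendsto ((φ.continuous.tendsto p).comp hp) (Eventually.of_forall fun n => ?_)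
    simp only [Function.comp, map_smul, map_sub, hφy, sub_zero, smul_eq_mul]
    exact mul_nonneg (inv_nonneg.2 (hh n).le) (hxφ n)
  have hφq : φ q ≤ 0 := by
    refine le_of_tendsto ((φ.continuous.tendsto q).comp hq) (Eventually.of_forall fun n => ?_)
    simp only [Function.comp, map_smul, map_sub, hφy, sub_zero, smul_eq_mul]
    have := hxφ' n
    simp only [neg_apply] at this
    exact mul_nonpos_of_nonneg_of_nonpos (inv_nonneg.2 (hh n).le) (by linarith)
  have hφp' : φ p ≠ 0 := by
    intro h0
    obtain ⟨r, hr⟩ := ker_one hdX hφ hy0 hφy h0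
    rw [hr, map_smul, hgy] at hgp
    have : r = 0 := by simpa using hgp
    rw [this] at hr
    simp at hr
    exact hp0 hr
  have hqp : q = -p := by
    obtain ⟨r, hr⟩ := ker_one hdX hg0 hp0 hgp hgq
    have habs : |r| = 1 := by
      have := hq1
      rwa [hr, norm_smul, hp1, mul_one, Real.norm_eq_abs] at this
    rcases (abs_eq zero_le_one).1 habs with h1 | h1
    · rw [hr, h1, one_smul] at hφq
      exact absurd (le_antisymm hφq hφp) hφp'
    · rw [hr, h1]; simp
  -- the kink is nontrivial
  have hkne : G p ≠ H p := by
    intro hGHp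
    have hc0 : c ≠ 0 := by intro h; simp [h] at hcn
    obtain ⟨r, hr⟩ := ker_one hdX (sub_ne_zero.2 hGH) hp0 (v := p) (w := c)
      (by simp [hGHp]) (by simp [hGc, hHc])
    have hgz : g z = 1 := by
      have := congrArg g hyz
      rw [hr, map_sub, map_smul, map_smul, hgp, hgy] at this
      simp at this
      linarith
    have := hsX.eq_of_supp hg hy1 (hn1 z) hgy hgz
    rw [this, sub_self] at hyz
    exact (smul_ne_zero ht.ne' hc0) hyz.symm
  -- images
  let a : ℕ → sphere (0 : X) 1 := fun n => ⟨x n, mem_sphere_zero_iff_norm.2 (hx1 n)⟩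
  let a' : ℕ → sphere (0 : X) 1 := fun n => ⟨x' n, mem_sphere_zero_iff_norm.2 (hx1' n)⟩
  have hV0 : ∀ n, ‖(f (a n) : Y) - f y‖ = h n := fun n => by rw [hnf]; exact hxy n
  have hV0' : ∀ n, ‖(f (a' n) : Y) - f y‖ = h n := fun n => by rw [hnf]; exact hxy' n
  have hV1 := hnu' (fun n => (f (a n) : Y) - f y) hV0
  have hV1' := hnu' (fun n => (f (a' n) : Y) - f y) hV0'
  obtain ⟨P, hP⟩ := ulim U _ 1 (Eventually.of_forall fun n => (hV1 n).le)
  obtain ⟨Q, hQ⟩ := ulim U _ 1 (Eventually.of_forall fun n => (hV1' n).le)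
  have hP1 : ‖P‖ = 1 := hunit' hP hV1
  have hQ1 : ‖Q‖ = 1 := hunit' hQ hV1'
  have hPQ : ‖P - Q‖ = 2 := by
    have h1 := (hP.sub hQ).norm
    have h2 := (hp.sub hq).norm
    have h3 : ∀ n, ‖(h n)⁻¹ • ((f (a n) : Y) - f y) - (h n)⁻¹ • ((f (a' n) : Y) - f y)‖
        = ‖(h n)⁻¹ • (x n - y) - (h n)⁻¹ • (x' n - y)‖ := by
      intro n
      rw [← smul_sub, ← smul_sub, sub_sub_sub_cancel_right, sub_sub_sub_cancel_right,
        norm_smul, norm_smul, hnf]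
    simp only [h3] at h1
    rw [tendsto_nhds_unique h1 h2, hqp, sub_neg_eq_add, ← two_smul ℝ, norm_smul, hp1]
    simp
  have hQP : Q = -P := by
    have := hsY P (-Q) hP1 (by rw [norm_neg, hQ1]) (by rw [← sub_eq_add_neg, hPQ])
    rw [this, neg_neg]
  have hYl : ∀ {w : ℕ → Y}, (∀ n, ‖w n - f y‖ = h n) → Tendsto w U (𝓝 (f y : Y)) := by
    intro w hw
    rw [tendsto_iff_norm_sub_tendsto_zero]
    simpa [hw] using hh0
  choose K hK hKv using fun n => exists_supp ((f (a n) : Y) - f z)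
  choose K' hK' hKv' using fun n => exists_supp ((f (a' n) : Y) - f z)
  obtain ⟨A, hA⟩ := ulim U K 1 (Eventually.of_forall hK)
  obtain ⟨B, hB⟩ := ulim U K' 1 (Eventually.of_forall hK')
  have hA1 : ‖A‖ ≤ 1 := le_of_tendsto hA.norm (Eventually.of_forall hK)
  have hB1 : ‖B‖ ≤ 1 := le_of_tendsto hB.norm (Eventually.of_forall hK')
  have htn : ‖(f y : Y) - f z‖ = t := by
    rw [hnf, hyz, norm_smul, hcn, mul_one, Real.norm_of_nonneg ht.le]
  have hAB : ∀ {w : ℕ → Y} {k : ℕ → Y →L[ℝ] ℝ} {C : Y →L[ℝ] ℝ}, (∀ n, ‖w n - f y‖ = h n) →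
      (∀ n, k n (w n - f z) = ‖w n - f z‖) → Tendsto k U (𝓝 C) → C ((f y : Y) - f z) = t := by
    intro w k C hw hk hC
    have h1 := (hYl hw).sub_const (f z : Y)
    have h2 := tendsto_clm hC h1
    simp only [hk] at h2
    rw [← htn]
    exact tendsto_nhds_unique h2 h1.norm
  have hAt := hAB hV0 hKv hA
  have hBt := hAB hV0' hKv' hB
  -- main inequality
  have main : ∀ {G : X →L[ℝ] ℝ} (_ : ‖G‖ ≤ 1) (_ : G c = 1) (b : sphere (0 : X) 1)
      (k : Y →L[ℝ] ℝ) (_ : ‖k‖ ≤ 1) (_ : k ((f b : Y) - f z) = ‖(f b : Y) - f z‖) (r : ℝ)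
      (_ : 0 < r), G (r⁻¹ • ((b : X) - y)) ≤ k (r⁻¹ • ((f b : Y) - f y)) := by
    intro G hG hGc b k hk hkb r hr
    rw [map_smul, map_smul, smul_eq_mul, smul_eq_mul]
    refine mul_le_mul_of_nonneg_left ?_ (inv_nonneg.2 hr.le)
    have h1 := clm_le hG ((b : X) - z)
    have h2 := clm_le hk ((f y : Y) - f z)
    rw [hnf] at hkb
    have h3 := congrArg G hyz
    rw [map_smul, hGc, smul_eq_mul, mul_one] at h3
    simp only [map_sub] at h1 h2 h3 hkb ⊢
    rw [htn] at h2
    linarith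
  have final : ∀ {G H : X →L[ℝ] ℝ}, ‖G‖ ≤ 1 → ‖H‖ ≤ 1 → G c = 1 → H c = 1 →
      G p - H p ≤ A P - B P := by
    intro G H hG hH hGc hHc
    have h1 : G p ≤ A P := le_of_tendsto_of_tendsto ((G.continuous.tendsto p).comp hp)
      (tendsto_clm hA hP) (Eventually.of_forall fun n => main hG hGc (a n) _ (hK n) (hKv n) _ (hh n))
    have h2 : H q ≤ B Q := le_of_tendsto_of_tendsto ((H.continuous.tendsto q).comp hq)
      (tendsto_clm hB hQ)
      (Eventually.of_forall fun n => main hH hHc (a' n) _ (hK' n) (hKv' n) _ (hh n))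
    rw [hqp, hQP, map_neg, map_neg] at h2
    linarith
  refine ⟨?_, A, B, ?_, hA1, hB1, ?_, ?_⟩
  · rw [norm_smul, htn, norm_inv, Real.norm_of_nonneg ht.le, inv_mul_cancel₀ ht.ne']
  · rintro rfl
    have h1 := final hG hH hGc hHc
    have h2 := final hH hG hHc hGc
    exact hkne (by linarith)
  · rw [map_smul, hAt, smul_eq_mul, inv_mul_cancel₀ ht.ne']
  · rw [map_smul, hBt, smul_eq_mul, inv_mul_cancel₀ ht.ne']

lemma neg_sph {X Y : Type*} [NormedAddCommGroup X] [NormedSpace ℝ X]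
    [NormedAddCommGroup Y] [NormedSpace ℝ Y] (hsX : SCP X)
    (f : sphere (0 : X) 1 → sphere (0 : Y) 1) (hf : Isometry f) (hsurj : Function.Surjective f) :
    SCP Y ∧ ∀ a, (f (-a) : Y) = -(f a : Y) := by
  have hnf : ∀ a b, ‖(f a : Y) - f b‖ = ‖(a : X) - b‖ := by
    intro a b
    have := hf.dist_eq a b
    rwa [Subtype.dist_eq, Subtype.dist_eq, dist_eq_norm, dist_eq_norm] at this
  have hn1 : ∀ a : sphere (0 : X) 1, ‖(a : X)‖ = 1 := fun a => mem_sphere_zero_iff_norm.1 a.2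
  have key : ∀ a b : sphere (0 : X) 1, ‖(f a : Y) - f b‖ = 2 → b = -a := by
    intro a b h
    rw [hnf, sub_eq_add_neg] at h
    have := hsX a (-b) (hn1 a) (by rw [norm_neg, hn1]) h
    ext
    simp [this]
  have hY : SCP Y := by
    intro a b ha hb hab
    obtain ⟨u, hu⟩ := hsurj ⟨a, mem_sphere_zero_iff_norm.2 ha⟩
    obtain ⟨v, hv⟩ := hsurj ⟨-a, mem_sphere_zero_iff_norm.2 (by rwa [norm_neg])⟩
    obtain ⟨w, hw⟩ := hsurj ⟨-b, mem_sphere_zero_iff_norm.2 (by rwa [norm_neg])⟩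
    have h1 := key u v (by
      rw [hu, hv]; simp only [sub_neg_eq_add]; rw [← two_smul ℝ, norm_smul, ha]; simp)
    have h2 := key u w (by rw [hu, hw]; simpa only [sub_neg_eq_add] using hab)
    have h3 : f v = f w := by rw [h1, h2]
    rw [hv, hw] at h3
    exact neg_injective (congrArg Subtype.val h3)
  refine ⟨hY, fun a => ?_⟩
  have h1 : ‖(f a : Y) - f (-a)‖ = 2 := by
    rw [hnf]
    simp only [coe_neg_sphere, sub_neg_eq_add]
    rw [← two_smul ℝ, norm_smul, hn1]; simp
  rw [sub_eq_add_neg] at h1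
  have := hY (f a) (-(f (-a))) (mem_sphere_zero_iff_norm.1 (f a).2)
    (by rw [norm_neg]; exact mem_sphere_zero_iff_norm.1 (f (-a)).2) h1
  rw [this, neg_neg]

lemma dimY {X Y : Type*} [NormedAddCommGroup X] [NormedSpace ℝ X]
    [NormedAddCommGroup Y] [NormedSpace ℝ Y] (hdX : Module.finrank ℝ X = 2) (hsX : SCP X)
    (f : sphere (0 : X) 1 → sphere (0 : Y) 1) (hf : Isometry f) (hsurj : Function.Surjective f)
    (c m : sphere (0 : X) 1) (φ : X →L[ℝ] ℝ) (hc : φ c = 0) (hm : φ m = 1) :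
    Module.finrank ℝ Y = 2 := by
  obtain ⟨hsY, hneg⟩ := neg_sph hsX f hf hsurj
  have hn1 : ∀ a : sphere (0 : X) 1, ‖(a : X)‖ = 1 := fun a => mem_sphere_zero_iff_norm.1 a.2
  have hn1' : ∀ a : sphere (0 : Y) 1, ‖(a : Y)‖ = 1 := fun a => mem_sphere_zero_iff_norm.1 a.2
  have hφ : φ ≠ 0 := by intro h; simp [h] at hm
  have hc0 : (c : X) ≠ 0 := by intro h; have := hn1 c; simp [h] at this
  have hp0 : (f c : Y) ≠ 0 := by intro h; have := hn1' (f c); simp [h] at this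
  let E : Submodule ℝ Y := Submodule.span ℝ {(f c : Y)}
  have hE : ∀ a : sphere (0 : X) 1, (f a : Y) ∈ E ↔ φ a = 0 := by
    intro a
    constructor
    · intro h
      obtain ⟨r, hr⟩ := Submodule.mem_span_singleton.1 h
      have habs : |r| = 1 := by
        have := hn1' (f a)
        rwa [← hr, norm_smul, hn1', mul_one, Real.norm_eq_abs] at this
      rcases (abs_eq zero_le_one).1 habs with h1 | h1
      · rw [h1, one_smul] at hr
        rw [← hf.injective (Subtype.ext hr), hc]
      · rw [h1, neg_one_smul, ← hneg] at hr
        rw [← hf.injective (Subtype.ext hr)]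
        simp [hc]
    · intro h
      obtain ⟨r, hr⟩ := ker_one hdX hφ hc0 hc h
      have habs : |r| = 1 := by
        have := hn1 a
        rwa [hr, norm_smul, hn1, mul_one, Real.norm_eq_abs] at this
      rcases (abs_eq zero_le_one).1 habs with h1 | h1
      · have : a = c := by ext; rw [hr, h1, one_smul]
        rw [this]; exact Submodule.mem_span_singleton_self _
      · have : a = -c := by ext; rw [hr, h1, neg_one_smul]; rfl
        rw [this, hneg]; exact E.neg_mem (Submodule.mem_span_singleton_self _)
  let F : sphere (0 : X) 1 ≃ᵢ sphere (0 : Y) 1 :=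
    IsometryEquiv.mk (Equiv.ofBijective f ⟨hf.injective, hsurj⟩) hf
  have hFf : ∀ a, F.symm (f a) = a := fun a => F.symm_apply_apply a
  have hcod : ¬ 1 < Module.rank ℝ (Y ⧸ E) := by
    intro hlt
    have hconn := isConnected_compl_of_one_lt_codim hlt
    have hpre : IsPreconnected (univ : Set ↥((E : Set Y)ᶜ)) :=
      Subtype.preconnectedSpace hconn.isPreconnected |>.isPreconnected_univ
    have hne : ∀ w : ↥((E : Set Y)ᶜ), (w : Y) ≠ 0 := by
      intro w h
      exact w.2 (by rw [h]; exact E.zero_mem)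
    let N : ↥((E : Set Y)ᶜ) → sphere (0 : Y) 1 := fun w =>
      ⟨‖(w : Y)‖⁻¹ • (w : Y), mem_sphere_zero_iff_norm.2 (by
        rw [norm_smul, norm_inv, norm_norm, inv_mul_cancel₀ (norm_ne_zero_iff.2 (hne w))])⟩
    have hN : Continuous N := by
      apply Continuous.subtype_mk
      exact (Continuous.inv₀ (by fun_prop) (fun w => norm_ne_zero_iff.2 (hne w))).smul (by fun_prop)
    let ψ : ↥((E : Set Y)ᶜ) → ℝ := fun w => φ (F.symm (N w) : X)
    have hψ : Continuous ψ :=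
      φ.continuous.comp (continuous_subtype_val.comp (F.symm.continuous.comp hN))
    have hψ0 : ∀ w, ψ w ≠ 0 := by
      intro w h
      have h1 := (hE (F.symm (N w))).2 h
      have h2 : f (F.symm (N w)) = N w := F.apply_symm_apply _
      rw [h2] at h1
      apply w.2
      have h3 := E.smul_mem ‖(w : Y)‖ h1
      simp only [N] at h3
      rwa [smul_inv_smul₀ (norm_ne_zero_iff.2 (hne w))] at h3
    have hval : ∀ a : sphere (0 : X) 1, φ a ≠ 0 → φ a ∈ range ψ := by
      intro a ha
      refine ⟨⟨f a, fun h => ha ((hE a).1 h)⟩, ?_⟩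
      have : N ⟨f a, fun h => ha ((hE a).1 h)⟩ = f a := by
        ext; simp [N]
      simp only [ψ, this, hFf]
    have h1 := hval m (by rw [hm]; norm_num)
    have h2 := hval (-m) (by simp [hm])
    have hr : (range ψ).OrdConnected := by
      rw [← image_univ]
      exact (hpre.image ψ hψ.continuousOn).ordConnected
    have h0 : (0 : ℝ) ∈ range ψ := hr.out h2 h1 (by simp [hm])
    obtain ⟨w, hw⟩ := h0
    exact hψ0 w hw
  have hrank : Module.rank ℝ Y ≤ 2 := by
    rw [← Submodule.rank_quotient_add_rank E]
    have h1 : Module.rank ℝ E ≤ 1 := by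
      have := rank_span_le (R := ℝ) ({(f c : Y)} : Set Y)
      simpa using this
    calc _ ≤ (1 : Cardinal) + 1 := add_le_add (not_lt.1 hcod) h1
      _ = 2 := one_add_one_eq_two
  have hfin : FiniteDimensional ℝ Y := by
    refine Module.rank_lt_aleph0_iff.1 ?_
    exact hrank.trans_lt (by exact_mod_cast Cardinal.nat_lt_aleph0 2)
  apply le_antisymm
  · exact Module.finrank_le_of_rank_le (by exact_mod_cast hrank)
  · have hli : LinearIndependent ℝ ![(f c : Y), (f m : Y)] := by
      rw [LinearIndependent.pair_iff' hp0]
      intro r hr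
      have := (hE m).1 (Submodule.mem_span_singleton.2 ⟨r, hr⟩)
      rw [hm] at this
      norm_num at this
    simpa using hli.fintype_card_le_finrank

lemma ray_unique {V : Type*} [NormedAddCommGroup V] [NormedSpace ℝ V] {a c : V} (ha : ‖a‖ < 1)
    {r s : ℝ} (hr : 0 ≤ r) (hrs : r < s) (h1 : ‖a + r • c‖ = 1) (h2 : ‖a + s • c‖ = 1) : False := by
  have hs : 0 < s := hr.trans_lt hrs
  have he : s • (a + r • c) = (s - r) • a + r • (a + s • c) := by module
  have := norm_add_le ((s - r) • a) (r • (a + s • c))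
  rw [← he, norm_smul, norm_smul, norm_smul, h1, h2, Real.norm_of_nonneg hs.le,
    Real.norm_of_nonneg hr, Real.norm_of_nonneg (sub_nonneg.2 hrs.le)] at this
  nlinarith

lemma ray_exists {V : Type*} [NormedAddCommGroup V] [NormedSpace ℝ V] {a c : V} (ha : ‖a‖ < 1)
    (hc : ‖c‖ = 1) : ∃ r : ℝ, 0 < r ∧ r ≤ 2 ∧ ‖a + r • c‖ = 1 := by
  have hiv := intermediate_value_Icc (f := fun r : ℝ => ‖a + r • c‖) (zero_le_two : (0:ℝ) ≤ 2)
    (by fun_prop)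
  have h2 : 1 ≤ ‖a + (2:ℝ) • c‖ := by
    have := norm_sub_le (a + (2:ℝ) • c) a
    rw [add_sub_cancel_left, norm_smul, hc] at this
    norm_num at this
    linarith
  obtain ⟨r, hr, hr'⟩ := hiv (show (1:ℝ) ∈ _ from ⟨by simpa using ha.le, h2⟩)
  refine ⟨r, lt_of_le_of_ne hr.1 ?_, hr.2, hr'⟩
  rintro rfl
  simp at hr'
  linarith

/-- Every non-smooth point of the unit sphere of a strictly convex 2-dimensional real
Banach space is special. -/
theorem nonsmooth_point_is_special
    {X : Type*} [NormedAddCommGroup X] [NormedSpace ℝ X] [CompleteSpace X]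
    (hdim : Module.finrank ℝ X = 2)
    (hsc : StrictlyConvexSphere X)
    (c : sphere (0 : X) 1) (hc : ¬ IsSmoothPoint (c : X)) :
    IsSpecialPoint c := by
  intro Y _ _ _ f hf hsurj y z hyz
  have hsX := scp_of_sphere hsc
  obtain ⟨hsY, hneg⟩ := neg_sph hsX f hf hsurj
  have : FiniteDimensional ℝ X := Module.finite_of_finrank_pos (by omega)
  have : ProperSpace X := FiniteDimensional.proper ℝ _
  have hn1 : ∀ a : sphere (0 : X) 1, ‖(a : X)‖ = 1 := fun a => mem_sphere_zero_iff_norm.1 a.2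
  have hc1 := hn1 c
  have hc0 : (c : X) ≠ 0 := by intro h; simp [h] at hc1
  have hcN : (c : X) ∈ NSet X := by
    obtain ⟨G, hG, hGc⟩ := exists_supp (c : X)
    rw [hc1] at hGc
    have hnorm : ∀ G : X →L[ℝ] ℝ, ‖G‖ ≤ 1 → G c = 1 → ‖G‖ = 1 := by
      intro G hG hGc
      apply le_antisymm hG
      have := G.le_opNorm (c : X)
      rwa [hGc, hc1, mul_one, norm_one] at this
    refine ⟨hc1, ?_⟩
    by_contra! hcon
    refine hc ⟨G, ⟨hGc, hnorm G hG hGc⟩, ?_⟩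
    rintro H ⟨hHc, hH⟩
    by_contra hne
    exact hcon H G hne hH.le hG hHc hGc
  -- coordinates
  obtain ⟨φ, m, hφ1, hφc, hm⟩ : ∃ (φ : X →L[ℝ] ℝ) (m : sphere (0 : X) 1),
      ‖φ‖ ≤ 1 ∧ φ c = 0 ∧ φ m = 1 := by
    obtain ⟨φ, hφ, hφc⟩ := exists_ker hdim (c : X)
    obtain ⟨m, hmS, hmax⟩ := (isCompact_sphere (0 : X) 1).exists_isMaxOn ⟨c, c.2⟩
      φ.continuous.continuousOn
    have hb : ∀ v, ‖φ v‖ ≤ φ m * ‖v‖ := by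
      have h1 : ∀ v, φ v ≤ φ m * ‖v‖ := by
        intro v
        by_cases hv : v = 0
        · simp [hv]
        have hv' := norm_pos_iff.2 hv
        have := hmax (show ‖v‖⁻¹ • v ∈ sphere (0 : X) 1 by
          rw [mem_sphere_zero_iff_norm, norm_smul, norm_inv, norm_norm, inv_mul_cancel₀ hv'.ne'])
        simp only [mem_ofPred_eq, map_smul, smul_eq_mul] at this
        rw [inv_mul_le_iff₀ hv'] at this
        linarith
      intro v
      rw [Real.norm_eq_abs, abs_le]
      have h2 := h1 (-v)
      rw [map_neg, norm_neg] at h2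
      exact ⟨by linarith, h1 v⟩
    have hpos : 0 < φ m := by
      by_contra! hle
      apply hφ
      ext v
      have h1 := hb v
      have h2 : φ m * ‖v‖ ≤ 0 := mul_nonpos_of_nonpos_of_nonneg hle (norm_nonneg _)
      exact norm_le_zero_iff.1 (h1.trans h2)
    refine ⟨(φ m)⁻¹ • φ, ⟨m, hmS⟩, ?_, by simp [hφc], by simp [hpos.ne']⟩
    refine ContinuousLinearMap.opNorm_le_bound _ zero_le_one fun v => ?_
    rw [smul_apply, norm_smul, norm_inv, Real.norm_of_nonneg hpos.le, one_mul,
      inv_mul_le_iff₀ hpos]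
    exact hb v
  have hφ0 : φ ≠ 0 := by intro h; simp [h] at hm
  have hdY := dimY hdim hsX f hf hsurj c m φ hφc hm
  have hm1 := hn1 m
  -- trivial case
  by_cases hyz0 : y = z
  · simp [hyz0]
  let I := Ioo (-1 : ℝ) 1
  have hsm : ∀ s : I, ‖(s : ℝ) • (m : X)‖ < 1 := by
    intro s
    rw [norm_smul, hm1, mul_one, Real.norm_eq_abs, abs_lt]
    exact s.2
  choose τ hτ0 hτ2 hτ using fun s : I => ray_exists (hsm s) hc1
  have huniq : ∀ (s : I) (r : ℝ), 0 ≤ r → ‖(s : ℝ) • (m : X) + r • (c : X)‖ = 1 → r = τ s := by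
    intro s r hr h
    rcases lt_trichotomy r (τ s) with h1 | h1 | h1
    · exact (ray_unique (hsm s) hr h1 h (hτ s)).elim
    · exact h1
    · exact (ray_unique (hsm s) (hτ0 s).le h1 (hτ s) h).elim
  have hτc : Continuous τ := by
    rw [continuous_iff_continuousAt]
    intro s
    rw [ContinuousAt, tendsto_iff_ultrafilter]
    intro U hU
    obtain ⟨r, hr⟩ := ulim U τ 2 (Eventually.of_forall fun s => by
      rw [Real.norm_of_nonneg (hτ0 s).le]; exact hτ2 s)
    have hr0 : 0 ≤ r := ge_of_tendsto hr (Eventually.of_forall fun s => (hτ0 s).le)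
    have hid : Tendsto (fun s : I => (s : ℝ)) U (𝓝 (s : ℝ)) :=
      (continuous_subtype_val.tendsto s).mono_left hU
    have h1 : Tendsto (fun s : I => ‖(s : ℝ) • (m : X) + τ s • (c : X)‖) U
        (𝓝 ‖(s : ℝ) • (m : X) + r • (c : X)‖) :=
      ((hid.smul_const _).add (hr.smul_const _)).norm
    simp only [hτ] at h1
    rw [← huniq s r hr0 (tendsto_nhds_unique h1 tendsto_const_nhds)]
    exact hr
  let σ : I → I := fun s => ⟨-s, by have := s.2; exact ⟨by linarith [this.2], by linarith [this.1]⟩⟩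
  have hσ : Continuous σ := by fun_prop
  let w : I → sphere (0 : X) 1 := fun s =>
    ⟨(s : ℝ) • (m : X) + τ s • (c : X), mem_sphere_zero_iff_norm.2 (hτ s)⟩
  have hw : Continuous w := by
    apply Continuous.subtype_mk
    fun_prop
  have hww : ∀ s, (w s : X) - ((-w (σ s) : sphere (0 : X) 1) : X) = (τ s + τ (σ s)) • (c : X) := by
    intro s
    simp only [coe_neg_sphere, w, σ]
    module
  have hT : ∀ s, 0 < τ s + τ (σ s) := fun s => add_pos (hτ0 _) (hτ0 _)
  let d : I → Y := fun s => (τ s + τ (σ s))⁻¹ • ((f (w s) : Y) - f (-w (σ s)))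
  have hfc := hf.continuous
  have hd : Continuous d := by
    refine Continuous.smul (Continuous.inv₀ (hτc.add (hτc.comp hσ)) fun s => (hT s).ne') ?_
    refine Continuous.sub (continuous_subtype_val.comp (hfc.comp hw)) ?_
    exact continuous_subtype_val.comp (hfc.comp (continuous_neg.comp (hw.comp hσ)))
  have hφw : ∀ s, φ (w s) = s := by intro s; simp [w, hm, hφc]
  have hcount : (range d).Countable := by
    have hbad : {s : I | (w s : X) ∈ NSet X}.Countable := by
      refine (nset_countable hdim hsX).preimage_of_injOn (f := fun s : I => (w s : X)) ?_
      intro s _ s' _ h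
      ext
      rw [← hφw s, ← hφw s']
      exact congrArg φ h
    refine ((hbad.image d).union (nset_countable hdY hsY)).mono ?_
    rintro _ ⟨s, rfl⟩
    by_cases hs : (w s : X) ∈ NSet X
    · exact Or.inl ⟨s, hs, rfl⟩
    · exact Or.inr (kink hdim hdY hsX hsY f hf hcN (w s) (-w (σ s)) (hT s) (hww s) hs)
  have hconst : ∀ s s', d s = d s' := by
    intro s s'
    have : PreconnectedSpace I := Subtype.preconnectedSpace isPreconnected_Ioo
    exact hcount.isTotallyDisconnected _ subset_rfl (isPreconnected_range hd) ⟨s, rfl⟩ ⟨s', rfl⟩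
  -- value at zero
  have hd0 : ∀ s, d s = f c := by
    intro s
    let o : I := ⟨0, by norm_num, by norm_num⟩
    rw [hconst s o]
    have h1 : τ o = 1 := (huniq o 1 zero_le_one (by simp [o, hc1])).symm
    have h2 : σ o = o := by ext; simp [σ, o]
    have h3 : w o = c := by ext; simp [w, h1, o]
    simp only [d, h2, h3, h1, hneg, sub_neg_eq_add]
    rw [← two_smul ℝ (f c : Y), smul_smul]
    norm_num
  -- identify the chord
  have hyzc : (y : X) - z ≠ 0 := fun h => hyz0 (Subtype.ext (sub_eq_zero.1 h))
  have hl : 0 < ‖(y : X) - z‖ := norm_pos_iff.2 hyzc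
  set l := ‖(y : X) - z‖ with hldef
  have hφyz : φ z = φ y := by
    have := congrArg φ hyz
    rw [map_sub, map_smul, hφc, smul_zero] at this
    linarith
  have hφle : φ y ≤ 1 := (clm_le hφ1 _).trans (hn1 y).le
  have hφge : -1 ≤ φ y := by
    have := (clm_le hφ1 (-(y : X)))
    rw [norm_neg, hn1, map_neg] at this
    linarith
  have hne1 : φ y ≠ 1 := fun h =>
    hyz0 (Subtype.ext (hsX.eq_of_supp hφ1 (hn1 y) (hn1 z) h (hφyz.trans h)))
  have hne2 : φ y ≠ -1 := fun h =>
    hyz0 (Subtype.ext (hsX.eq_of_supp (G := -φ) (by rwa [norm_neg]) (hn1 y) (hn1 z)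
      (by simp [h]) (by simp [hφyz, h])))
  let s : I := ⟨φ y, lt_of_le_of_ne hφge hne2.symm, lt_of_le_of_ne hφle hne1⟩
  obtain ⟨r, hr⟩ := ker_one hdim hφ0 hc0 hφc (w := (y : X) - φ y • (m : X)) (by simp [hm])
  have hy' : (y : X) = (s : ℝ) • (m : X) + r • (c : X) := by
    rw [← hr]; simp [s]
  have hz' : (z : X) = (s : ℝ) • (m : X) + (r - l) • (c : X) := by
    rw [sub_smul, ← hyz, ← add_sub_assoc, ← hy']; simp
  have hyn := hn1 y
  have hzn := hn1 z
  rw [hy'] at hyn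
  rw [hz'] at hzn
  have hz'' : (σ s : ℝ) • (m : X) + (l - r) • (c : X) = -(z : X) := by
    rw [hz']; simp only [σ]; module
  have hzn2 : ‖(σ s : ℝ) • (m : X) + (l - r) • (c : X)‖ = 1 := by
    rw [hz'', norm_neg, hn1]
  have hyn2 : ‖(σ s : ℝ) • (m : X) + (-r) • (c : X)‖ = 1 := by
    have : (σ s : ℝ) • (m : X) + (-r) • (c : X) = -(y : X) := by
      rw [hy']; simp only [σ]; module
    rw [this, norm_neg, hn1]
  have hr0 : 0 ≤ r := by
    by_contra! h
    exact ray_unique (hsm (σ s)) (r := -r) (s := l - r) (by linarith) (by linarith) hyn2 hzn2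
  have hrl : 0 ≤ l - r := by
    by_contra! h
    exact ray_unique (hsm s) (r := r - l) (s := r) (by linarith) (by linarith) hzn hyn
  have e1 := huniq s r hr0 hyn
  have e2 := huniq (σ s) (l - r) hrl hzn2
  have ey : w s = y := by ext; rw [hy', e1]
  have ez : -w (σ s) = z := by
    ext
    have : (w (σ s) : X) = -(z : X) := by rw [← hz'', e2]
    rw [coe_neg_sphere, this, neg_neg]
  have el : τ s + τ (σ s) = l := by rw [← e1, ← e2]; ring
  have := hd0 s
  simp only [d] at this
  rw [ey, ez, el] at this
  rw [← this, smul_inv_smul₀ hl.ne']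
end

section
/- A 2-dimensional real Banach space X has the Mazur–Ulam property if its unit sphere S_X contains two linearly independent special points. -/
open Metric Set

/-- Transfer of the special-point property to arbitrary universes. -/
theorem special_transfer.{a, w, b} {X : Type a} [NormedAddCommGroup X] [NormedSpace ℝ X]
    [FiniteDimensional ℝ X]
    (x : sphere (0 : X) 1) (hx : IsSpecialPoint.{a, w} x)
    (Y : Type b) [NormedAddCommGroup Y] [NormedSpace ℝ Y] [CompleteSpace Y]
    (f : sphere (0 : X) 1 → sphere (0 : Y) 1) (hf : Isometry f) (hs : Function.Surjective f)
    (y z : sphere (0 : X) 1) (h : (y : X) - (z : X) = ‖(y : X) - (z : X)‖ • (x : X)) :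
    (f y : Y) - (f z : Y) = ‖(y : X) - (z : X)‖ • (f x : Y) := by
  classical
  have hXs : Small.{w} X := by
    let e := (Module.finBasis ℝ X).equivFun
    exact small_of_injective e.injective
  have hSX : Small.{w} (sphere (0 : X) 1) := small_of_injective Subtype.val_injective
  have hSY : Small.{w} (sphere (0 : Y) 1) := small_of_surjective hs
  have hYs : Small.{w} Y := by
    let G : ℝ × sphere (0 : Y) 1 → Y := fun p => p.1 • (p.2 : Y)
    have hG : Function.Surjective G := by
      intro y
      by_cases hy : y = 0
      · exact ⟨(0, f x), by simp [G, hy]⟩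
      · have hn : ‖y‖ ≠ 0 := norm_ne_zero_iff.2 hy
        refine ⟨(‖y‖, ⟨‖y‖⁻¹ • y, ?_⟩), ?_⟩
        · simp [norm_smul, hn]
        · simp [G, smul_smul, hn]
    exact small_of_surjective hG
  obtain ⟨Y', ⟨e⟩⟩ := hYs.equiv_small
  let i1 : AddCommGroup Y' := e.symm.addCommGroup
  let i2 : Module ℝ Y' := e.symm.module ℝ
  let L : Y' ≃ₗ[ℝ] Y := e.symm.linearEquiv ℝ
  let i3 : NormedAddCommGroup Y' := NormedAddCommGroup.induced Y' Y L L.injective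
  let i4 : NormedSpace ℝ Y' := NormedSpace.induced ℝ Y' Y L
  have hL : ∀ y, ‖L y‖ = ‖y‖ := fun y => rfl
  let LI : Y' ≃ₗᵢ[ℝ] Y := ⟨L, hL⟩
  have : CompleteSpace Y' := (LI.toIsometryEquiv.completeSpace_iff).2 inferInstance
  let f' : sphere (0 : X) 1 → sphere (0 : Y') 1 := fun s => ⟨LI.symm (f s), by
    simp⟩
  have h1 : Isometry f' := by
    refine Isometry.of_dist_eq fun s t => ?_
    rw [← hf.dist_eq s t, Subtype.dist_eq, Subtype.dist_eq]
    exact LI.symm.isometry.dist_eq _ _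
  have h2 : Function.Surjective f' := by
    intro t
    obtain ⟨s, hs⟩ := hs ⟨LI t, by simp⟩
    refine ⟨s, ?_⟩
    apply Subtype.ext
    simp [f', hs]
  have h3 := hx Y' f' h1 h2 y z h
  have h4 := congrArg LI h3
  simpa [f'] using h4

section MU
variable {X : Type*} [NormedAddCommGroup X] [NormedSpace ℝ X]

theorem exists_norm_eq_one (u y : X) (hu : u ≠ 0) (ε : ℝ) (h : ‖y + ε • u‖ ≤ 1) :
    ∃ t, ε ≤ t ∧ ‖y + t • u‖ = 1 := by
  have hn : 0 < ‖u‖ := norm_pos_iff.2 hu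
  let T := ε + 2 / ‖u‖
  have hT : ε ≤ T := by
    have : 0 ≤ 2 / ‖u‖ := by positivity
    simp only [T]; linarith
  have hc : ContinuousOn (fun t : ℝ => ‖y + t • u‖) (Icc ε T) := by fun_prop
  have h1 : 1 ≤ ‖y + T • u‖ := by
    have e1 : (2 / ‖u‖) • u = (y + T • u) - (y + ε • u) := by
      simp only [T]; module
    have e2 : ‖(2 / ‖u‖) • u‖ = 2 := by
      rw [norm_smul, Real.norm_of_nonneg (by positivity)]; field_simp
    have := norm_sub_le (y + T • u) (y + ε • u)
    rw [← e1, e2] at this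
    linarith
  obtain ⟨t, ht, ht'⟩ := intermediate_value_Icc hT hc ⟨h, h1⟩
  exact ⟨t, ht.1, ht'⟩

theorem seg_le (y u : X) (s t r : ℝ) (h1 : ‖y + s • u‖ ≤ 1) (h2 : ‖y + t • u‖ ≤ 1)
    (hs : s ≤ r) (ht : r ≤ t) : ‖y + r • u‖ ≤ 1 := by
  rcases eq_or_lt_of_le (hs.trans ht) with h | h
  · have : r = s := le_antisymm (h ▸ ht) hs
    rwa [this]
  have hd : 0 < t - s := by linarith
  have e : y + r • u = ((t - r) / (t - s)) • (y + s • u) + ((r - s) / (t - s)) • (y + t • u) := by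
    match_scalars <;> field_simp <;> ring
  have a1 : 0 ≤ (t - r) / (t - s) := div_nonneg (by linarith) hd.le
  have a2 : 0 ≤ (r - s) / (t - s) := div_nonneg (by linarith) hd.le
  have a3 : (t - r) / (t - s) + (r - s) / (t - s) = 1 := by field_simp; ring
  rw [e]
  refine (norm_add_le _ _).trans ?_
  rw [norm_smul, norm_smul, Real.norm_of_nonneg a1, Real.norm_of_nonneg a2]
  nlinarith

theorem seg_lt (y u : X) (s t r : ℝ) (h1 : ‖y + s • u‖ < 1) (h2 : ‖y + t • u‖ ≤ 1)
    (h : (s ≤ r ∧ r < t) ∨ (t < r ∧ r ≤ s)) : ‖y + r • u‖ < 1 := by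
  have hd : t - s ≠ 0 := by rcases h with h | h <;> intro h' <;> linarith
  have e : y + r • u = ((t - r) / (t - s)) • (y + s • u) + ((r - s) / (t - s)) • (y + t • u) := by
    match_scalars <;> field_simp <;> ring
  have a1 : 0 < (t - r) / (t - s) := by
    rcases h with h | h
    · exact div_pos (by linarith) (by linarith)
    · exact div_pos_of_neg_of_neg (by linarith) (by linarith)
  have a2 : 0 ≤ (r - s) / (t - s) := by
    rcases h with h | h
    · exact div_nonneg (by linarith) (by linarith)
    · exact div_nonneg_of_nonpos (by linarith) (by linarith)
  have a3 : (t - r) / (t - s) + (r - s) / (t - s) = 1 := by field_simp; ring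
  rw [e]
  refine (norm_add_le _ _).trans_lt ?_
  rw [norm_smul, norm_smul, Real.norm_of_nonneg a1.le, Real.norm_of_nonneg a2]
  nlinarith

/-- Largest `t` with `y + t u` in the unit ball. -/
noncomputable def chM (u y : X) : ℝ := sSup {t : ℝ | ‖y + t • u‖ ≤ 1}

theorem chM_bdd (u y : X) (hu : ‖u‖ = 1) : BddAbove {t : ℝ | ‖y + t • u‖ ≤ 1} := by
  refine ⟨1 + ‖y‖, fun t ht => ?_⟩
  have h1 : ‖t • u‖ ≤ ‖y + t • u‖ + ‖y‖ := by
    have := norm_sub_le (y + t • u) y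
    simpa using this
  rw [norm_smul, hu, mul_one] at h1
  have h2 : ‖y + t • u‖ ≤ 1 := ht
  have := le_abs_self t
  rw [Real.norm_eq_abs] at h1
  linarith

theorem le_chM (u y : X) (hu : ‖u‖ = 1) (t : ℝ) (h : ‖y + t • u‖ ≤ 1) : t ≤ chM u y :=
  le_csSup (chM_bdd u y hu) h

theorem chM_nonneg (u y : X) (hu : ‖u‖ = 1) (hy : ‖y‖ = 1) : 0 ≤ chM u y :=
  le_chM u y hu 0 (by simp [hy])

theorem chM_mem (u y : X) (hu : ‖u‖ = 1) (hy : ‖y‖ = 1) : ‖y + chM u y • u‖ ≤ 1 := by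
  have hc : IsClosed {t : ℝ | ‖y + t • u‖ ≤ 1} := isClosed_le (by fun_prop) continuous_const
  exact hc.csSup_mem ⟨0, by simp [hy]⟩ (chM_bdd u y hu)

theorem chM_norm (u y : X) (hu : ‖u‖ = 1) (hy : ‖y‖ = 1) : ‖y + chM u y • u‖ = 1 := by
  obtain ⟨t, ht, ht'⟩ := exists_norm_eq_one u y (by rintro rfl; simp at hu) _ (chM_mem u y hu hy)
  have := le_chM u y hu t ht'.le
  rwa [le_antisymm ht this]

theorem chM_continuous (u v : X) (hu : ‖u‖ = 1) (A B : X →L[ℝ] ℝ)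
    (hAB : ∀ x, x = A x • u + B x • v) :
    Continuous (fun y : sphere (0 : X) 1 => chM u (y : X)) := by
  have hS : ∀ y : sphere (0 : X) 1, ‖(y : X)‖ = 1 := fun y => by simp
  rw [continuous_iff_continuousAt]
  intro y0
  refine tendsto_order.2 ⟨fun c hc => ?_, fun c hc => ?_⟩
  · by_cases hc0 : c < 0
    · exact Filter.Eventually.of_forall fun y => hc0.trans_le (chM_nonneg u y hu (hS y))
    push Not at hc0
    set M := chM u (y0 : X) with hM
    set c' := (c + M) / 2 with hc'
    have hM1 : ‖(y0 : X) + M • u‖ ≤ 1 := chM_mem u y0 hu (hS y0)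
    have hle : ‖(y0 : X) + c' • u‖ ≤ 1 :=
      seg_le _ u 0 M c' (by simp) hM1 (by linarith) (by linarith)
    rcases hle.lt_or_eq with hlt | heq
    · have hcont : Continuous fun y : sphere (0 : X) 1 => ‖(y : X) + c' • u‖ := by fun_prop
      filter_upwards [hcont.continuousAt.eventually (gt_mem_nhds hlt)] with y hy
      have := le_chM u (y : X) hu c' hy.le
      linarith
    · obtain ⟨φ, hφ, hφ1⟩ := exists_dual_vector'' ℝ ((y0 : X) + c' • u)
      have hφle : ∀ x : X, ‖x‖ ≤ 1 → φ x ≤ 1 := fun x hx => by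
        have h1 := φ.le_opNorm x
        have h2 := le_abs_self (φ x)
        rw [Real.norm_eq_abs] at h1
        nlinarith [norm_nonneg x, norm_nonneg φ]
      rw [heq] at hφ1
      have k1 := hφle y0 (hS y0).le
      have k2 := hφle _ hM1
      simp only [map_add, map_smul, smul_eq_mul, RCLike.ofReal_real_eq_id, id] at hφ1 k2
      have hc'pos : 0 < c' := by linarith
      have hMc' : 0 < M - c' := by linarith
      have hφu : φ u = 0 := by
        apply le_antisymm
        · by_contra hh
          push Not at hh
          nlinarith [mul_pos hMc' hh]
        · by_contra hh
          push Not at hh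
          nlinarith [mul_pos_of_neg_of_neg (neg_lt_zero.2 hc'pos) hh]
      rw [hφu] at hφ1
      have hφv : ∀ x, φ x = B x * φ v := fun x => by
        conv_lhs => rw [hAB x]
        simp [hφu]
      have hy0 : φ (y0 : X) = 1 := by linarith
      have hcont : Continuous fun y : sphere (0 : X) 1 =>
          φ (y : X) * M - (A (y : X) - φ (y : X) * A (y0 : X)) := by fun_prop
      have hcont2 : Continuous fun y : sphere (0 : X) 1 => φ (y : X) := by fun_prop
      have hv0 : c < φ (y0 : X) * M - (A (y0 : X) - φ (y0 : X) * A (y0 : X)) := by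
        rw [hy0]; linarith
      have hv1 : 0 < φ (y0 : X) := by rw [hy0]; norm_num
      filter_upwards [hcont.continuousAt.eventually (lt_mem_nhds hv0),
        hcont2.continuousAt.eventually (lt_mem_nhds hv1)] with y hy hy'
      refine hy.trans_le (le_chM u (y : X) hu _ ?_)
      have hB : B (y : X) = φ (y : X) * B (y0 : X) := by
        have := hφv y0
        rw [hy0] at this
        rw [hφv y, mul_assoc, mul_comm (φ v), ← this, mul_one]
      have e : (y : X) + (φ (y : X) * M - (A (y : X) - φ (y : X) * A (y0 : X))) • u
          = φ (y : X) • ((y0 : X) + M • u) := by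
        have e1 := hAB y
        have e2 := hAB y0
        rw [hB] at e1
        calc _ = (A (y : X) • u + (φ (y : X) * B (y0 : X)) • v)
              + (φ (y : X) * M - (A (y : X) - φ (y : X) * A (y0 : X))) • u := by rw [← e1]
          _ = φ (y : X) • ((A (y0 : X) • u + B (y0 : X) • v) + M • u) := by module
          _ = _ := by rw [← e2]
      rw [e, norm_smul, Real.norm_of_nonneg hy'.le]
      have := hφle y (hS y).le
      nlinarith [norm_nonneg ((y0 : X) + M • u)]
  · have h0 := chM_nonneg u y0 hu (hS y0)
    have hgt : 1 < ‖(y0 : X) + c • u‖ := by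
      by_contra hh
      push Not at hh
      exact absurd (le_chM u y0 hu c hh) (not_le.2 hc)
    have hcont : Continuous fun y : sphere (0 : X) 1 => ‖(y : X) + c • u‖ := by fun_prop
    filter_upwards [hcont.continuousAt.eventually (lt_mem_nhds hgt)] with y hy
    by_contra hh
    push Not at hh
    exact absurd (seg_le (y : X) u 0 _ c (by simp) (chM_mem u y hu (hS y)) (by linarith) hh)
      (not_le.2 hy)

/-- Signed chord displacement. -/
noncomputable def chT (u y : X) : ℝ := chM u y - chM (-u) y

theorem chM_neg (u y : X) : chM u (-y) = chM (-u) y := by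
  unfold chM
  congr 1
  ext t
  simp only [Set.mem_ofPred_eq]
  rw [← norm_neg]
  have : -(-y + t • u) = y + t • (-u) := by module
  rw [this]

theorem chT_neg (u y : X) : chT u (-y) = - chT u y := by
  unfold chT
  have := chM_neg (-u) y
  rw [neg_neg] at this
  rw [chM_neg, this]; ring

theorem chT_norm (u y : X) (hu : ‖u‖ = 1) (hy : ‖y‖ = 1) : ‖y + chT u y • u‖ = 1 := by
  have h1 := chM_norm u y hu hy
  have h2 := chM_norm (-u) y (by simpa using hu) hy
  have n1 := chM_nonneg u y hu hy
  have n2 := chM_nonneg (-u) y (by simpa using hu) hy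
  unfold chT
  set M := chM u y
  set N := chM (-u) y
  have h2' : ‖y + (-N) • u‖ = 1 := by rw [← h2]; congr 1; module
  have hle : ‖y + (M - N) • u‖ ≤ 1 :=
    seg_le y u (-N) M _ h2'.le h1.le (by linarith) (by linarith)
  rcases hle.lt_or_eq with hlt | heq
  · exfalso
    rcases n1.eq_or_lt with e1 | e1
    · rw [← e1, zero_sub, h2'] at hlt
      exact lt_irrefl _ hlt
    rcases n2.eq_or_lt with e2 | e2
    · rw [← e2, sub_zero, h1] at hlt
      exact lt_irrefl _ hlt
    rcases le_total 0 (M - N) with h | h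
    · have := seg_lt y u (M - N) (-N) 0 hlt h2'.le (Or.inr ⟨by linarith, h⟩)
      simp [hy] at this
    · have := seg_lt y u (M - N) M 0 hlt h1.le (Or.inl ⟨h, by linarith⟩)
      simp [hy] at this
  · exact heq

theorem chT_continuous (u v : X) (hu : ‖u‖ = 1) (A B : X →L[ℝ] ℝ)
    (hAB : ∀ x, x = A x • u + B x • v) :
    Continuous (fun y : sphere (0 : X) 1 => chT u (y : X)) := by
  refine (chM_continuous u v hu A B hAB).sub
    (chM_continuous (-u) v (by simpa using hu) (-A) B fun x => ?_)
  simpa using hAB x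

/-- The corner case. -/
theorem corner_mem [FiniteDimensional ℝ X] (p q : X) (A B : X →L[ℝ] ℝ)
    (hAB : ∀ x, x = A x • p + B x • q) (hAp : A p = 1) (hAq : A q = 0) (hBp : B p = 0)
    (hBq : B q = 1) (hy : ‖p + q‖ = 1) (hp : ∀ t : ℝ, ‖p + q + t • p‖ ≤ 1 → t = 0)
    (hq : ∀ t : ℝ, ‖p + q + t • q‖ ≤ 1 → t = 0)
    (K : Set X) (hK : IsClosed K) (hKS : ∀ x ∈ K, ‖x‖ = 1)
    (x0 : X) (hx0 : x0 ∈ K) (hx0' : x0 ≠ -(p + q))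
    (hKp : ∀ x ∈ K, ∀ t : ℝ, ‖x + t • p‖ = 1 → x + t • p ∈ K)
    (hKq : ∀ x ∈ K, ∀ t : ℝ, ‖x + t • q‖ = 1 → x + t • q ∈ K) : p + q ∈ K := by
  have hp0 : p ≠ 0 := by rintro rfl; simp at hAp
  have hq0 : q ≠ 0 := by rintro rfl; simp at hBq
  have cl : ∀ x, ‖x‖ ≤ 1 → x ≠ p + q → A x < 1 ∧ B x < 1 := by
    intro x hx hne
    constructor
    · by_contra hh
      push Not at hh
      have hpos : 0 < A x := by linarith
      have e : p + q + (B x / A x - 1) • q = (A x)⁻¹ • x := by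
        calc _ = (A x)⁻¹ • (A x • p + B x • q) := by
              match_scalars <;> field_simp <;> ring
          _ = _ := by rw [← hAB x]
      have hi : (A x)⁻¹ ≤ 1 := inv_le_one_of_one_le₀ hh
      have h1 := hq _ (by
        rw [e, norm_smul, Real.norm_of_nonneg (by positivity)]
        have : 0 ≤ (A x)⁻¹ := by positivity
        nlinarith [norm_nonneg x])
      have h2 : B x = A x := by field_simp at h1; linarith
      have h3 : x = A x • (p + q) := by
        conv_lhs => rw [hAB x, h2]
        module
      have h4 : ‖x‖ = A x := by
        have h3' : ‖A x • (p + q)‖ = A x := by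
          rw [norm_smul, hy, mul_one, Real.norm_of_nonneg hpos.le]
        rwa [← h3] at h3'
      have h5 : A x = 1 := by linarith
      rw [h5, one_smul] at h3
      exact hne h3
    · by_contra hh
      push Not at hh
      have hpos : 0 < B x := by linarith
      have e : p + q + (A x / B x - 1) • p = (B x)⁻¹ • x := by
        calc _ = (B x)⁻¹ • (A x • p + B x • q) := by
              match_scalars <;> field_simp <;> ring
          _ = _ := by rw [← hAB x]
      have hi : (B x)⁻¹ ≤ 1 := inv_le_one_of_one_le₀ hh
      have h1 := hp _ (by
        rw [e, norm_smul, Real.norm_of_nonneg (by positivity)]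
        have : 0 ≤ (B x)⁻¹ := by positivity
        nlinarith [norm_nonneg x])
      have h2 : A x = B x := by field_simp at h1; linarith
      have h3 : x = B x • (p + q) := by
        conv_lhs => rw [hAB x, h2]
        module
      have h4 : ‖x‖ = B x := by
        have h3' : ‖B x • (p + q)‖ = B x := by
          rw [norm_smul, hy, mul_one, Real.norm_of_nonneg hpos.le]
        rwa [← h3] at h3'
      have h5 : B x = 1 := by linarith
      rw [h5, one_smul] at h3
      exact hne h3
  have hcpt : IsCompact K := by
    have : ProperSpace X := FiniteDimensional.proper ℝ X
    exact (isCompact_sphere (0 : X) 1).of_isClosed_subset hK fun x hx => by simp [hKS x hx]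
  obtain ⟨z, hz, hmax⟩ := hcpt.exists_isMaxOn ⟨x0, hx0⟩
    (f := fun x => A x + B x) (by fun_prop)
  have hmax' : ∀ x ∈ K, A x + B x ≤ A z + B z := fun x hx => hmax hx
  by_contra hnot
  have hzne : z ≠ p + q := by rintro rfl; exact hnot hz
  have hzn := hKS z hz
  have c1 := cl z hzn.le hzne
  have c2 : -1 ≤ A z ∧ -1 ≤ B z := by
    by_cases h : -z = p + q
    · have : z = -(p + q) := by rw [← h, neg_neg]
      rw [this]; simp [hAp, hAq, hBp, hBq]
    · have := cl (-z) (by simp [hzn]) h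
      simp only [map_neg] at this
      constructor <;> linarith
  rcases lt_trichotomy (A z) (B z) with h | h | h
  · have e : z + (B z - A z) • p = B z • (p + q) := by
      nth_rewrite 1 [hAB z]
      module
    obtain ⟨t, ht, ht'⟩ := exists_norm_eq_one p z hp0 (B z - A z) (by
      rw [e, norm_smul, hy, mul_one, Real.norm_eq_abs, abs_le]
      exact ⟨c2.2, c1.2.le⟩)
    have := hmax' _ (hKp z hz t ht')
    simp [hAp, hBp] at this
    linarith
  · have h3 : z = A z • (p + q) := by
      nth_rewrite 1 [hAB z]
      rw [← h]; module
    have h4 : |A z| = 1 := by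
      rw [h3, norm_smul, hy, mul_one] at hzn
      rwa [← Real.norm_eq_abs]
    have h5 : A z = -1 := by
      rcases (abs_eq (by norm_num : (0 : ℝ) ≤ 1)).1 h4 with h | h <;> linarith [c1.1]
    have h6 := hmax' _ hx0
    have h7 := cl (-x0) (by simp [hKS x0 hx0]) (by
      intro h; apply hx0'; rw [← h, neg_neg])
    simp only [map_neg] at h7
    linarith
  · have e : z + (A z - B z) • q = A z • (p + q) := by
      nth_rewrite 1 [hAB z]
      module
    obtain ⟨t, ht, ht'⟩ := exists_norm_eq_one q z hq0 (A z - B z) (by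
      rw [e, norm_smul, hy, mul_one, Real.norm_eq_abs, abs_le]
      exact ⟨c2.1, c1.1.le⟩)
    have := hmax' _ (hKq z hz t ht')
    simp [hAq, hBq] at this
    linarith

theorem conj_id {E : Type*} [MetricSpace E] (c : unitInterval → E) (hc : Continuous c)
    (hci : Function.Injective c) (φ : E → E) (hφ : Isometry φ) (ψ : unitInterval → unitInterval)
    (hψ : ∀ s, c (ψ s) = φ (c s)) (h0 : ψ 0 = 0) (h1 : ψ 1 = 1) (s : unitInterval) :
    φ (c s) = c s := by
  have hemb := hc.isClosedEmbedding hci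
  have hψc : Continuous ψ := by
    rw [hemb.isInducing.continuous_iff]
    have : c ∘ ψ = φ ∘ c := funext hψ
    rw [this]
    exact hφ.continuous.comp hc
  have hψi : Function.Injective ψ := by
    intro a b hab
    apply hci
    apply hφ.injective
    rw [← hψ, ← hψ, hab]
  have hmono : Monotone ψ := by
    rcases hψc.strictMono_of_inj hψi with h | h
    · exact h.monotone
    · have := h (show (0 : unitInterval) < 1 from zero_lt_one)
      rw [h0, h1] at this
      exact absurd this (not_lt.2 zero_le_one)
  have hit : ∀ n, c (ψ^[n] s) = φ^[n] (c s) := by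
    intro n
    induction n with
    | zero => rfl
    | succ n ih => rw [Function.iterate_succ_apply', Function.iterate_succ_apply', hψ, ih]
  have hlim : ∃ l, Filter.Tendsto (fun n => ψ^[n] s) Filter.atTop (nhds l) := by
    rcases le_total s (ψ s) with h | h
    · exact ⟨_, tendsto_atTop_ciSup (hmono.monotone_iterate_of_le_map h) (OrderTop.bddAbove _)⟩
    · exact ⟨_, tendsto_atTop_ciInf (hmono.antitone_iterate_of_map_le h) (OrderBot.bddBelow _)⟩
  obtain ⟨l, hl⟩ := hlim
  have t1 : Filter.Tendsto (fun n => c (ψ^[n] s)) Filter.atTop (nhds (c l)) :=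
    (hc.tendsto l).comp hl
  have t2 := (Filter.tendsto_add_atTop_iff_nat 1).2 t1
  have t3 := t2.dist t1
  have t4 : ∀ n, dist (c (ψ^[n + 1] s)) (c (ψ^[n] s)) = dist (φ (c s)) (c s) := by
    intro n
    rw [hit, hit, Function.iterate_succ_apply]
    have hiso : ∀ n, Isometry φ^[n] := by
      intro n
      induction n with
      | zero => exact isometry_id
      | succ n ih => rw [Function.iterate_succ]; exact ih.comp hφ
    exact (hiso n).dist_eq _ _
  simp only [t4, dist_self] at t3
  exact dist_eq_zero.1 (tendsto_nhds_unique tendsto_const_nhds t3)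

theorem arc_id (u v : X) (hu : ‖u‖ = 1) (hv : ‖v‖ = 1) (A B : X →L[ℝ] ℝ)
    (hAB : ∀ x, x = A x • u + B x • v) (hAu : A u = 1) (hAv : A v = 0) (hBu : B u = 0)
    (hBv : B v = 1) (φ : sphere (0 : X) 1 → sphere (0 : X) 1) (hφ : Isometry φ)
    (fix : ∀ x : sphere (0 : X) 1, ((x : X) = u ∨ (x : X) = -u ∨ (x : X) = v ∨ (x : X) = -v) →
      φ x = x)
    (x : sphere (0 : X) 1) (hxA : 0 ≤ A (x : X)) (hxB : 0 ≤ B (x : X)) : φ x = x := by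
  have hS : ∀ y : sphere (0 : X) 1, ‖(y : X)‖ = 1 := fun y => by simp
  let w : unitInterval → X := fun s => (1 - (s : ℝ)) • u + (s : ℝ) • v
  have hwA : ∀ s, A (w s) = 1 - s := fun s => by simp [w, hAu, hAv]
  have hwB : ∀ s, B (w s) = s := fun s => by simp [w, hBu, hBv]
  have hw0 : ∀ s, w s ≠ 0 := fun s h => by
    have h1 := hwA s
    have h2 := hwB s
    rw [h, map_zero] at h1 h2
    linarith
  have hwn : ∀ s, 0 < ‖w s‖ := fun s => norm_pos_iff.2 (hw0 s)
  have hwc : Continuous w := by fun_prop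
  let c : unitInterval → sphere (0 : X) 1 := fun s => ⟨‖w s‖⁻¹ • w s, by
    simp [norm_smul, (hwn s).ne']⟩
  have hcc : Continuous c := by
    refine Continuous.subtype_mk ?_ _
    exact (hwc.norm.inv₀ fun s => (hwn s).ne').smul hwc
  have hcA : ∀ s, A (c s : X) = ‖w s‖⁻¹ * (1 - s) := fun s => by simp [c, hwA]
  have hcB : ∀ s, B (c s : X) = ‖w s‖⁻¹ * s := fun s => by simp [c, hwB]
  have hci : Function.Injective c := by
    intro a b hab
    have h1 := hcA a
    have h2 := hcB a
    rw [hab] at h1 h2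
    rw [hcA] at h1
    rw [hcB] at h2
    have h3 : ‖w b‖⁻¹ = ‖w a‖⁻¹ := by linarith
    rw [h3] at h2
    have := mul_left_cancel₀ (inv_ne_zero (hwn a).ne') h2
    exact Subtype.ext this.symm
  have hc0 : (c 0 : X) = u := by simp [c, w, hu]
  have hc1 : (c 1 : X) = v := by simp [c, w, hv]
  have hfix0 : φ (c 0) = c 0 := fix _ (Or.inl hc0)
  have hfix1 : φ (c 1) = c 1 := fix _ (Or.inr (Or.inr (Or.inl hc1)))
  -- zeros of the coordinates
  have zA : ∀ s, A (φ (c s) : X) = 0 → s = 1 := by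
    intro s hs
    have h1 := hAB (φ (c s))
    rw [hs, zero_smul, zero_add] at h1
    have h2 := hS (φ (c s))
    rw [h1, norm_smul, hv, mul_one, Real.norm_eq_abs] at h2
    have h3 : (φ (c s) : X) = v ∨ (φ (c s) : X) = -v := by
      rcases (abs_eq (by norm_num : (0 : ℝ) ≤ 1)).1 h2 with h | h
      · left; rw [h1, h, one_smul]
      · right; rw [h1, h, neg_one_smul]
    have h4 : φ (φ (c s)) = φ (c s) := fix _ (Or.inr (Or.inr h3))
    have h5 : φ (c s) = c s := hφ.injective h4
    rw [h5, hcA] at hs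
    have := (mul_eq_zero.1 hs).resolve_left (inv_ne_zero (hwn s).ne')
    apply Subtype.ext
    show (s : ℝ) = 1
    linarith
  have zB : ∀ s, B (φ (c s) : X) = 0 → s = 0 := by
    intro s hs
    have h1 := hAB (φ (c s))
    rw [hs, zero_smul, add_zero] at h1
    have h2 := hS (φ (c s))
    rw [h1, norm_smul, hu, mul_one, Real.norm_eq_abs] at h2
    have h3 : (φ (c s) : X) = u ∨ (φ (c s) : X) = -u := by
      rcases (abs_eq (by norm_num : (0 : ℝ) ≤ 1)).1 h2 with h | h
      · left; rw [h1, h, one_smul]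
      · right; rw [h1, h, neg_one_smul]
    have h4 : φ (φ (c s)) = φ (c s) := fix _ (by tauto)
    have h5 : φ (c s) = c s := hφ.injective h4
    rw [h5, hcB] at hs
    have := (mul_eq_zero.1 hs).resolve_left (inv_ne_zero (hwn s).ne')
    apply Subtype.ext
    simpa using this
  have contA : Continuous fun s => A (φ (c s) : X) :=
    A.continuous.comp (continuous_subtype_val.comp (hφ.continuous.comp hcc))
  have contB : Continuous fun s => B (φ (c s) : X) :=
    B.continuous.comp (continuous_subtype_val.comp (hφ.continuous.comp hcc))
  have pA : ∀ s, 0 ≤ A (φ (c s) : X) := by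
    intro s
    by_contra hh
    push Not at hh
    have hz : (0 : ℝ) ∈ Icc (A (φ (c s) : X)) (A (φ (c 0) : X)) := by
      rw [hfix0, hc0, hAu]; exact ⟨hh.le, zero_le_one⟩
    obtain ⟨t, ht, ht'⟩ := intermediate_value_Icc' (f := fun s => A (φ (c s) : X))
      (show (0 : unitInterval) ≤ s from unitInterval.nonneg') contA.continuousOn hz
    have h1 := zA t ht'
    have h2 : s = 1 := le_antisymm unitInterval.le_one' (h1 ▸ ht.2)
    rw [h2, hfix1, hc1, hAv] at hh
    exact lt_irrefl _ hh
  have pB : ∀ s, 0 ≤ B (φ (c s) : X) := by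
    intro s
    by_contra hh
    push Not at hh
    have hz : (0 : ℝ) ∈ Icc (B (φ (c s) : X)) (B (φ (c 1) : X)) := by
      rw [hfix1, hc1, hBv]; exact ⟨hh.le, zero_le_one⟩
    obtain ⟨t, ht, ht'⟩ := intermediate_value_Icc (f := fun s => B (φ (c s) : X))
      (show s ≤ (1 : unitInterval) from unitInterval.le_one') contB.continuousOn hz
    have h1 := zB t ht'
    have h2 : s = 0 := le_antisymm (h1 ▸ ht.1) unitInterval.nonneg'
    rw [h2, hfix0, hc0, hBu] at hh
    exact lt_irrefl _ hh
  have surj : ∀ y : sphere (0 : X) 1, 0 ≤ A (y : X) → 0 ≤ B (y : X) → ∃ s, c s = y := by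
    intro y ha hb
    have hpos : 0 < A (y : X) + B (y : X) := by
      rcases (add_nonneg ha hb).eq_or_lt with h | h
      · exfalso
        have h1 : A (y : X) = 0 := by linarith
        have h2 : B (y : X) = 0 := by linarith
        have h3 := hAB y
        rw [h1, h2, zero_smul, zero_smul, add_zero] at h3
        have := hS y
        rw [h3] at this
        simp at this
      · exact h
    refine ⟨⟨B (y : X) / (A (y : X) + B (y : X)), div_nonneg hb hpos.le,
      (div_le_one hpos).2 (by linarith)⟩, ?_⟩
    apply Subtype.ext
    have hw : w ⟨B (y : X) / (A (y : X) + B (y : X)), div_nonneg hb hpos.le,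
      (div_le_one hpos).2 (by linarith)⟩ = (A (y : X) + B (y : X))⁻¹ • (y : X) := by
      calc _ = (A (y : X) + B (y : X))⁻¹ • (A (y : X) • u + B (y : X) • v) := by
            simp only [w]
            match_scalars <;> field_simp <;> ring
        _ = _ := by rw [← hAB y]
    simp only [c, hw, norm_smul, hS, mul_one]
    rw [Real.norm_of_nonneg (by positivity), inv_inv, smul_smul, mul_inv_cancel₀ hpos.ne',
      one_smul]
  choose ψ hψ using fun s => surj (φ (c s)) (pA s) (pB s)
  have h0 : ψ 0 = 0 := hci (by rw [hψ, hfix0])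
  have h1 : ψ 1 = 1 := hci (by rw [hψ, hfix1])
  obtain ⟨s, rfl⟩ := surj x hxA hxB
  exact conj_id c hcc hci φ hφ ψ hψ h0 h1 s

theorem zero_half (u v : X) (hu : ‖u‖ = 1) (hv : ‖v‖ = 1) (A B : X →L[ℝ] ℝ)
    (hAB : ∀ x, x = A x • u + B x • v) (y : X) (hy : ‖y‖ = 1)
    (h1 : chT u y = 0) (h2 : chT v y = 0) : chM u y = 0 := by
  by_contra hne
  have hs : 0 < chM u y := lt_of_le_of_ne (chM_nonneg u y hu hy) (Ne.symm hne)
  have e1 : chM (-u) y = chM u y := by unfold chT at h1; linarith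
  have e2 : chM (-v) y = chM v y := by unfold chT at h2; linarith
  have m1 := chM_mem u y hu hy
  have m2 := chM_mem (-u) y (by simpa using hu) hy
  have m3 := chM_mem v y hv hy
  have m4 := chM_mem (-v) y (by simpa using hv) hy
  rw [e1] at m2
  rw [e2] at m4
  set s := chM u y
  obtain ⟨φ, hφ, hφ1⟩ := exists_dual_vector'' ℝ y
  have hφle : ∀ x : X, ‖x‖ ≤ 1 → φ x ≤ 1 := fun x hx => by
    have h1 := φ.le_opNorm x
    have h2 := le_abs_self (φ x)
    rw [Real.norm_eq_abs] at h1
    nlinarith [norm_nonneg x, norm_nonneg φ]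
  have hφy : φ y = 1 := by rw [hφ1, hy]; simp
  have key : ∀ (w : X) (r : ℝ), 0 < r → ‖y + r • w‖ ≤ 1 → ‖y + r • (-w)‖ ≤ 1 → φ w = 0 := by
    intro w r hr k1 k2
    have k1 := hφle _ k1
    have k2 := hφle _ k2
    simp only [map_add, map_smul, map_neg, smul_eq_mul, hφy] at k1 k2
    apply le_antisymm
    · by_contra hh
      push Not at hh
      nlinarith [mul_pos hr hh]
    · by_contra hh
      push Not at hh
      nlinarith [mul_pos_of_neg_of_neg (neg_lt_zero.2 hr) hh]
  have hφu := key u s hs m1 m2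
  have hB : B y * φ v = 1 := by
    have h3 := congrArg φ (hAB y)
    rw [hφy] at h3
    simp [hφu] at h3
    exact h3.symm
  have hB0 : B y ≠ 0 := by intro h; rw [h, zero_mul] at hB; exact zero_ne_one hB
  have hr : ∃ r : ℝ, ‖y + r • u‖ ≤ 1 ∧ A y + r ≠ 0 ∧ 0 ≤ A y / (A y + r) ∧
      A y / (A y + r) ≤ 1 ∧ r ≠ 0 := by
    rcases le_or_gt 0 (A y) with h | h
    · refine ⟨s, m1, by linarith, div_nonneg h (by linarith), ?_, hs.ne'⟩
      rw [div_le_one (by linarith)]; linarith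
    · refine ⟨-s, ?_, by linarith, div_nonneg_of_nonpos h.le (by linarith), ?_,
        by linarith⟩
      · have : y + (-s) • u = y + s • (-u) := by module
        rw [this]; exact m2
      · rw [div_le_one_of_neg (by linarith)]; linarith
  obtain ⟨r, r1, r2, r3, r4, r5⟩ := hr
  have ek : y + (-(r / (A y + r) * B y)) • v = (A y / (A y + r)) • (y + r • u) := by
    have := hAB y
    generalize A y = a at *
    generalize B y = b at *
    rw [this]
    match_scalars <;> field_simp <;> ring
  have hk1 : ‖y + (-(r / (A y + r) * B y)) • v‖ ≤ 1 := by
    rw [ek, norm_smul, Real.norm_of_nonneg r3]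
    nlinarith [norm_nonneg (y + r • u)]
  have hk0 : -(r / (A y + r) * B y) ≠ 0 := neg_ne_zero.2 (mul_ne_zero (div_ne_zero r5 r2) hB0)
  generalize -(r / (A y + r) * B y) = k at hk1 hk0
  have ht : 0 < chM v y := by
    rcases lt_or_gt_of_ne hk0 with h | h
    · have : y + k • v = y + (-k) • (-v) := by module
      rw [this] at hk1
      have := le_chM (-v) y (by simpa using hv) _ hk1
      linarith
    · have := le_chM v y hv _ hk1
      linarith
  have hφv := key v _ ht m3 m4
  rw [hφv, mul_zero] at hB
  exact zero_ne_one hB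

theorem zero_half' (u v : X) (hu : ‖u‖ = 1) (hv : ‖v‖ = 1) (A B : X →L[ℝ] ℝ)
    (hAB : ∀ x, x = A x • u + B x • v) (y : X) (hy : ‖y‖ = 1)
    (h1 : chT u y = 0) (h2 : chT v y = 0) (t : ℝ) (ht : ‖y + t • u‖ ≤ 1) : t = 0 := by
  have h := zero_half u v hu hv A B hAB y hy h1 h2
  have e1 : chM (-u) y = 0 := by unfold chT at h1; linarith
  apply le_antisymm
  · rw [← h]; exact le_chM u y hu t ht
  · have := le_chM (-u) y (by simpa using hu) (-t) (by
      have : y + (-t) • (-u) = y + t • u := by module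
      rwa [this])
    linarith

end MU

/-- A 2-dimensional real Banach space whose unit sphere contains two linearly independent
special points has the Mazur–Ulam property. -/
theorem two_special_points_mazur_ulam
    {X : Type*} [NormedAddCommGroup X] [NormedSpace ℝ X] [CompleteSpace X]
    (hdim : Module.finrank ℝ X = 2)
    (u v : sphere (0 : X) 1)
    (huv : LinearIndependent ℝ ![(u : X), (v : X)])
    (hu : IsSpecialPoint u) (hv : IsSpecialPoint v)
    (Y : Type*) [NormedAddCommGroup Y] [NormedSpace ℝ Y] [CompleteSpace Y]
    (f : sphere (0 : X) 1 → sphere (0 : Y) 1)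
    (hf_iso : Isometry f) (hf_surj : Function.Surjective f) :
    ∃ F : X ≃ₗᵢ[ℝ] Y, ∀ x : sphere (0 : X) 1, F (x : X) = (f x : Y) := by
  classical
  have hfd : FiniteDimensional ℝ X := FiniteDimensional.of_finrank_pos (by omega)
  have hrank : 1 < Module.rank ℝ X := by
    rw [← Module.finrank_eq_rank, hdim]; norm_num
  have hun : ‖(u : X)‖ = 1 := by simp
  have hvn : ‖(v : X)‖ = 1 := by simp
  have hS : ∀ y : sphere (0 : X) 1, ‖(y : X)‖ = 1 := fun y => by simp
  have hSY : ∀ y : sphere (0 : Y) 1, ‖(y : Y)‖ = 1 := fun y => by simp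
  -- coordinates
  obtain ⟨A, B, hAB, hAu, hAv, hBu, hBv⟩ : ∃ A B : X →L[ℝ] ℝ,
      (∀ x, x = A x • (u : X) + B x • (v : X)) ∧ A u = 1 ∧ A v = 0 ∧ B u = 0 ∧ B v = 1 := by
    let b := basisOfLinearIndependentOfCardEqFinrank huv (by simp [hdim])
    have hb : ⇑b = ![(u : X), (v : X)] := coe_basisOfLinearIndependentOfCardEqFinrank _ _
    have hb0 : b 0 = (u : X) := by rw [hb]; rfl
    have hb1 : b 1 = (v : X) := by rw [hb]; rfl
    refine ⟨LinearMap.toContinuousLinearMap (b.coord 0),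
      LinearMap.toContinuousLinearMap (b.coord 1), fun x => ?_, ?_, ?_, ?_, ?_⟩
    · have := b.sum_repr x
      rw [Fin.sum_univ_two, hb0, hb1] at this
      exact this.symm
    · rw [← hb0]; simp
    · rw [← hb1]; simp
    · rw [← hb0]; simp
    · rw [← hb1]; simp
  have hABs : ∀ x, x = B x • (v : X) + A x • (u : X) := fun x => by
    rw [add_comm]; exact hAB x
  -- chords
  have chord : ∀ w : sphere (0 : X) 1, (∀ y z : sphere (0 : X) 1,
      (y : X) - (z : X) = ‖(y : X) - (z : X)‖ • (w : X) →
        (f y : Y) - (f z : Y) = ‖(y : X) - (z : X)‖ • (f w : Y)) →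
      ∀ (y z : sphere (0 : X) 1) (t : ℝ), (y : X) = z + t • (w : X) →
        (f y : Y) = f z + t • (f w : Y) := by
    intro w hw y z t h
    rcases le_total 0 t with ht | ht
    · have hn : ‖(y : X) - z‖ = t := by
        rw [h, add_sub_cancel_left, norm_smul, hS, mul_one, Real.norm_of_nonneg ht]
      have := hw y z (by rw [hn, h, add_sub_cancel_left])
      rw [hn] at this
      rw [← this]; abel
    · have e : (z : X) - y = (-t) • (w : X) := by rw [h]; module
      have hn : ‖(z : X) - y‖ = -t := by
        rw [e, norm_smul, hS, mul_one, Real.norm_of_nonneg (by linarith)]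
      have := hw z y (by rw [hn, e])
      rw [hn] at this
      have h2 : (f y : Y) = f z - ((f z : Y) - f y) := by abel
      rw [h2, this]; module
  have cu := chord u (special_transfer u hu Y f hf_iso hf_surj)
  have cv := chord v (special_transfer v hv Y f hf_iso hf_surj)
  let F : X →ₗ[ℝ] Y := (A : X →ₗ[ℝ] ℝ).smulRight (f u : Y) + (B : X →ₗ[ℝ] ℝ).smulRight (f v : Y)
  have hF : ∀ x, F x = A x • (f u : Y) + B x • (f v : Y) := fun x => rfl
  have hFu : F u = f u := by rw [hF, hAu, hBu]; simp
  have hFv : F v = f v := by rw [hF, hAv, hBv]; simp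
  have hFc : Continuous F := by
    have : (F : X → Y) = fun x => A x • (f u : Y) + B x • (f v : Y) := rfl
    rw [this]; fun_prop
  have fneg : ∀ w : sphere (0 : X) 1, (∀ (y z : sphere (0 : X) 1) (t : ℝ),
      (y : X) = z + t • (w : X) → (f y : Y) = f z + t • (f w : Y)) →
      ∀ x : sphere (0 : X) 1, (x : X) = -w → (f x : Y) = -(f w : Y) := by
    intro w hw x hx
    rw [hw x w (-2) (by rw [hx]; module)]
    module
  have fnu := fneg u cu
  have fnv := fneg v cv
  -- enough
  suffices hmain : ∀ x : sphere (0 : X) 1, F x = f x by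
    have hnorm : ∀ x, ‖F x‖ = ‖x‖ := by
      intro x
      by_cases hx : x = 0
      · simp [hx]
      · have hn : ‖x‖ ≠ 0 := norm_ne_zero_iff.2 hx
        have h1 := hmain ⟨‖x‖⁻¹ • x, by simp [norm_smul, hn]⟩
        have h2 := congrArg norm h1
        simp only [map_smul, norm_smul, hSY, norm_inv, norm_norm] at h2
        field_simp at h2
        exact h2
    let FI : X →ₗᵢ[ℝ] Y := ⟨F, hnorm⟩
    have hsurj : Function.Surjective FI := by
      intro y
      by_cases hy : y = 0
      · exact ⟨0, by simp [hy]⟩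
      · have hn : ‖y‖ ≠ 0 := norm_ne_zero_iff.2 hy
        obtain ⟨x, hx⟩ := hf_surj ⟨‖y‖⁻¹ • y, by simp [norm_smul, hn]⟩
        refine ⟨‖y‖ • (x : X), ?_⟩
        have h1 : FI x = f x := hmain x
        rw [map_smul, h1, hx, smul_smul, mul_inv_cancel₀ hn, one_smul]
    exact ⟨LinearIsometryEquiv.ofSurjective FI hsurj, fun x => hmain x⟩
  by_cases hcz : ∃ y : sphere (0 : X) 1, chT (u : X) (y : X) = 0 ∧ chT (v : X) (y : X) = 0
  · -- corner case
    obtain ⟨y0, z1, z2⟩ := hcz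
    have hp := zero_half' (u : X) v hun hvn A B hAB y0 (hS y0) z1 z2
    have hq := zero_half' (v : X) u hvn hun B A hABs y0 (hS y0) z2 z1
    set a := A (y0 : X) with ha
    set b := B (y0 : X) with hb
    have hy0 : (y0 : X) = a • (u : X) + b • (v : X) := hAB y0
    have ha0 : a ≠ 0 := by
      intro h
      have h2 : (y0 : X) + (-2 * b) • (v : X) = -y0 := by
        rw [hy0, h]; module
      have h3 := hq (-2 * b) (by rw [h2, norm_neg, hS])
      have h4 : b = 0 := by linarith
      have h5 := hS y0
      rw [hy0, h, h4] at h5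
      simp at h5
    have hb0 : b ≠ 0 := by
      intro h
      have h2 : (y0 : X) + (-2 * a) • (u : X) = -y0 := by
        rw [hy0, h]; module
      have h3 := hp (-2 * a) (by rw [h2, norm_neg, hS])
      exact ha0 (by linarith)
    -- the sets
    have hclosed : ∀ c : Y, IsClosed {x : X | ∃ h : ‖x‖ = 1, (f ⟨x, by simp [h]⟩ : Y) - F x = c} := by
      intro c
      have h1 : IsClosed {x : sphere (0 : X) 1 | (f x : Y) - F x = c} := by
        refine isClosed_eq ?_ continuous_const
        exact (continuous_subtype_val.comp hf_iso.continuous).sub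
          (hFc.comp continuous_subtype_val)
      have h2 := (isClosed_sphere (x := (0 : X)) (ε := 1)).isClosedEmbedding_subtypeVal.isClosedMap _ h1
      convert h2 using 1
      ext x
      constructor
      · rintro ⟨h, hx⟩
        exact ⟨⟨x, by simp [h]⟩, hx, rfl⟩
      · rintro ⟨x, hx, rfl⟩
        exact ⟨hS x, hx⟩
    have corner : ∀ (σ : ℝ), σ ≠ 0 → |σ| = 1 → ∀ x : sphere (0 : X) 1,
        (x : X) ≠ -(σ • (y0 : X)) → ∀ y : sphere (0 : X) 1, (y : X) = σ • (y0 : X) →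
        (f y : Y) - F y = f x - F x := by
      intro σ hσ hσ1 x hx y hy
      have hsum : (σ * a) • (u : X) + (σ * b) • (v : X) = σ • (y0 : X) := by rw [hy0]; module
      have hσσ : σ * σ = 1 := by
        rw [← abs_mul_abs_self, hσ1, one_mul]
      have hm := corner_mem ((σ * a) • (u : X)) ((σ * b) • (v : X))
        ((σ * a)⁻¹ • A) ((σ * b)⁻¹ • B) (fun x => by
          conv_lhs => rw [hAB x]
          simp only [_root_.smul_apply, smul_eq_mul]
          match_scalars <;> field_simp) (by simp [hAu]; field_simp)
        (by simp [hAv]) (by simp [hBu]) (by simp [hBv]; field_simp)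
        (by rw [hsum, norm_smul, hS, mul_one, Real.norm_eq_abs, hσ1])
        (fun t ht => by
          have e : (y0 : X) + (t * a) • (u : X) = σ • (σ • (y0 : X) + t • (σ * a) • (u : X)) := by
            simp only [smul_add, smul_smul]
            rw [hσσ, one_smul, show σ * (t * (σ * a)) = (σ * σ) * (t * a) by ring, hσσ, one_mul]
          have := hp (t * a) (by
            rw [e, norm_smul, Real.norm_eq_abs, hσ1, one_mul, ← hsum]; exact ht)
          exact (mul_eq_zero.1 this).resolve_right ha0)
        (fun t ht => by
          have e : (y0 : X) + (t * b) • (v : X) = σ • (σ • (y0 : X) + t • (σ * b) • (v : X)) := by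
            simp only [smul_add, smul_smul]
            rw [hσσ, one_smul, show σ * (t * (σ * b)) = (σ * σ) * (t * b) by ring, hσσ, one_mul]
          have := hq (t * b) (by
            rw [e, norm_smul, Real.norm_eq_abs, hσ1, one_mul, ← hsum]; exact ht)
          exact (mul_eq_zero.1 this).resolve_right hb0)
        _ (hclosed ((f x : Y) - F x)) (fun x hx => hx.1) x ⟨hS x, rfl⟩ (by rw [hsum]; exact hx)
        (fun z hz t ht => by
          obtain ⟨hz1, hz2⟩ := hz
          refine ⟨ht, ?_⟩
          rw [← hz2, cu ⟨z + t • (σ * a) • (u : X), by simp [ht]⟩ ⟨z, by simp [hz1]⟩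
            (t * (σ * a)) (by simp [smul_smul])]
          simp only [map_add, map_smul, hFu]
          module)
        (fun z hz t ht => by
          obtain ⟨hz1, hz2⟩ := hz
          refine ⟨ht, ?_⟩
          rw [← hz2, cv ⟨z + t • (σ * b) • (v : X), by simp [ht]⟩ ⟨z, by simp [hz1]⟩
            (t * (σ * b)) (by simp [smul_smul])]
          simp only [map_add, map_smul, hFv]
          module)
      rw [hsum] at hm
      obtain ⟨h1, h2⟩ := hm
      have : y = ⟨σ • (y0 : X), by simp [h1]⟩ := Subtype.ext hy
      rw [this]
      exact h2
    have huy : ∀ σ : ℝ, (u : X) ≠ σ • (y0 : X) := by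
      intro σ h
      have h1 := congrArg B h
      rw [hBu, map_smul, smul_eq_mul] at h1
      have h2 : σ = 0 := (mul_eq_zero.1 h1.symm).resolve_right hb0
      rw [h2, zero_smul] at h
      rw [h] at hun; simp at hun
    have g1 : (f y0 : Y) - F y0 = 0 := by
      rw [corner 1 one_ne_zero (by simp) u (by rw [← neg_smul]; exact huy _) y0 (by simp), hFu,
        sub_self]
    intro x
    by_cases hx : (x : X) = -(y0 : X)
    · have := corner (-1) (by norm_num) (by simp) u (by rw [← neg_smul]; exact huy _) x (by simp [hx])
      rw [hFu, sub_self] at this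
      exact (sub_eq_zero.1 this).symm
    · have := corner 1 one_ne_zero (by simp) x (by simpa using hx) y0 (by simp)
      rw [g1] at this
      exact (sub_eq_zero.1 this.symm).symm
  · -- regular case
    push Not at hcz
    have hconn : PreconnectedSpace (sphere (0 : X) 1) :=
      isPreconnected_iff_preconnectedSpace.1 (isPreconnected_sphere hrank 0 1)
    have hTu := chT_continuous (u : X) v hun A B hAB
    have hTv := chT_continuous (v : X) u hvn B A hABs
    have hnorm : ∀ d, ‖F d‖ = ‖d‖ := by
      intro d
      let h : sphere (0 : X) 1 → ℝ := fun y => A d * chT (v : X) y + B d * chT (u : X) y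
      have hc : Continuous h := by
        simp only [h]
        exact (continuous_const.mul hTv).add (continuous_const.mul hTu)
      have hneg : ∀ y, h (-y) = -h y := by
        intro y
        have h1 := chT_neg (u : X) y
        have h2 := chT_neg (v : X) y
        simp only [h]
        rw [show ((-y : sphere (0 : X) 1) : X) = -(y : X) from rfl, h1, h2]; ring
      obtain ⟨y, hy⟩ : (0 : ℝ) ∈ range h := by
        rcases le_total (h u) 0 with h0 | h0
        · exact mem_range_of_exists_le_of_exists_ge hc ⟨u, h0⟩ ⟨-u, by rw [hneg]; linarith⟩
        · exact mem_range_of_exists_le_of_exists_ge hc ⟨-u, by rw [hneg]; linarith⟩ ⟨u, h0⟩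
      simp only [h] at hy
      have hs := chT_norm (u : X) y hun (hS y)
      have ht := chT_norm (v : X) y hvn (hS y)
      have hne := hcz y
      generalize chT (u : X) (y : X) = s at *
      generalize chT (v : X) (y : X) = t at *
      obtain ⟨k, hk⟩ : ∃ k : ℝ, d = k • (s • (u : X) - t • (v : X)) := by
        by_cases hs0 : s = 0
        · have ht0 := hne hs0
          rw [hs0, mul_zero, add_zero] at hy
          have hA : A d = 0 := (mul_eq_zero.1 hy).resolve_right ht0
          refine ⟨-(B d) / t, ?_⟩
          nth_rewrite 1 [hAB d]
          rw [hA, hs0]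
          match_scalars <;> field_simp <;> ring
        · refine ⟨A d / s, ?_⟩
          have hB : B d = - (A d / s * t) := by field_simp; linarith
          nth_rewrite 1 [hAB d]
          rw [hB]
          match_scalars <;> field_simp
      have e1 := cu ⟨(y : X) + s • (u : X), by simp [hs]⟩ y s rfl
      have e2 := cv ⟨(y : X) + t • (v : X), by simp [ht]⟩ y t rfl
      have e3 : F (s • (u : X) - t • (v : X)) = (f ⟨(y : X) + s • (u : X), by simp [hs]⟩ : Y)
          - f ⟨(y : X) + t • (v : X), by simp [ht]⟩ := by
        rw [e1, e2, map_sub, map_smul, map_smul, hFu, hFv]; abel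
      have e4 : ‖F (s • (u : X) - t • (v : X))‖ = ‖s • (u : X) - t • (v : X)‖ := by
        rw [e3, ← dist_eq_norm, ← Subtype.dist_eq, hf_iso.dist_eq, Subtype.dist_eq, dist_eq_norm]
        congr 1
        simp
      rw [hk, map_smul, norm_smul, norm_smul, e4]
    let FS : sphere (0 : X) 1 → sphere (0 : Y) 1 := fun x => ⟨F x, by simp [hnorm]⟩
    let φ : sphere (0 : X) 1 → sphere (0 : X) 1 := fun x => Function.surjInv hf_surj (FS x)
    have hφf : ∀ x, f (φ x) = FS x := fun x => Function.surjInv_eq hf_surj (FS x)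
    have hφ : Isometry φ := by
      refine Isometry.of_dist_eq fun x y => ?_
      rw [← hf_iso.dist_eq, hφf, hφf, Subtype.dist_eq, Subtype.dist_eq, dist_eq_norm, dist_eq_norm]
      simp only [FS]
      rw [← map_sub, hnorm]
    have fix : ∀ x : sphere (0 : X) 1, ((x : X) = u ∨ (x : X) = -u ∨ (x : X) = v ∨ (x : X) = -v) →
        φ x = x := by
      intro x hx
      apply hf_iso.injective
      rw [hφf]
      apply Subtype.ext
      show F x = f x
      rcases hx with hx | hx | hx | hx
      · rw [hx, hFu, Subtype.ext hx]
      · rw [fnu x hx, hx, map_neg, hFu]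
      · rw [hx, hFv, Subtype.ext hx]
      · rw [fnv x hx, hx, map_neg, hFv]
    intro x
    suffices hx : φ x = x by
      have := hφf x
      rw [hx] at this
      rw [this]
    have arc : ∀ σ τ : ℝ, (σ = 1 ∨ σ = -1) → (τ = 1 ∨ τ = -1) → 0 ≤ σ * A (x : X) →
        0 ≤ τ * B (x : X) → φ x = x := by
      intro σ τ hσ hτ h1 h2
      have hσσ : σ * σ = 1 := by rcases hσ with rfl | rfl <;> norm_num
      have hττ : τ * τ = 1 := by rcases hτ with rfl | rfl <;> norm_num
      refine arc_id (σ • (u : X)) (τ • (v : X)) ?_ ?_ (σ • A) (τ • B) ?_ ?_ ?_ ?_ ?_ φ hφ ?_ x ?_ ?_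
      · rcases hσ with rfl | rfl <;> simp
      · rcases hτ with rfl | rfl <;> simp
      · intro x
        simp only [_root_.smul_apply, smul_eq_mul, smul_smul]
        rw [show σ * A x * σ = (σ * σ) * A x by ring, show τ * B x * τ = (τ * τ) * B x by ring,
          hσσ, hττ, one_mul, one_mul]
        exact hAB x
      · simp [hAu, hσσ]
      · simp [hAv]
      · simp [hBu]
      · simp [hBv, hττ]
      · intro x hx
        apply fix
        rcases hσ with rfl | rfl <;> rcases hτ with rfl | rfl <;>
          simp only [one_smul, neg_smul, neg_neg] at hx <;> tauto
      · simpa using h1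
      · simpa using h2
    rcases le_total 0 (A (x : X)) with h1 | h1 <;> rcases le_total 0 (B (x : X)) with h2 | h2
    · exact arc 1 1 (by simp) (by simp) (by linarith) (by linarith)
    · exact arc 1 (-1) (by simp) (by simp) (by linarith) (by linarith)
    · exact arc (-1) 1 (by simp) (by simp) (by linarith) (by linarith)
    · exact arc (-1) (-1) (by simp) (by simp) (by linarith) (by linarith)
end
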